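/- Let (R,m,k) be a regular local ring containing a field and let I be an ideal of height d such that R/I satisfies Serre's condition S_2. Let x_1,…,x_d ∈ I be an R-regular sequence and set Ω̃ = ((x_1,…,x_d) :_R I); assume Ω̃ is not generated by d elements. Then for any minimal set of generators y_1,…,y_s of Ω̃, the natural map K_d(y;R) ⊗_R k → Tor_d^R(R/Ω̃, k) is the zero map. -/

import Mathlib

open IsLocalRing

universe u

variable (R : Type u) [CommRing R]

/-- Index type for the degree-`n` part of the Koszul complex on `s` generators:
`n`-element subsets of `Fin s` (i.e. strictly increasing `n`-tuples). -/
abbrev KIdx (s n : ℕ) : Type := {T : Finset (Fin s) // T.card = n}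

/-- The degree-`n` part of the Koszul complex `K_•(x₁,…,x_s; R)`:
the free `R`-module on `KIdx s n`. -/
abbrev KMod (s n : ℕ) : Type u := KIdx s n →₀ R

/-- The Koszul differential `K_{n+1}(x;R) → K_n(x;R)`,
`e_T ↦ ∑_{j ∈ T} (-1)^{#{i ∈ T : i < j}} x_j e_{T∖{j}}`. -/
noncomputable def koszulD {s : ℕ} (x : Fin s → R) (n : ℕ) :
    KMod R s (n + 1) →ₗ[R] KMod R s n :=
  Finsupp.lsum R fun T => LinearMap.toSpanSingleton R (KMod R s n)
    (∑ j ∈ T.1.attach,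
      ((-1 : R) ^ (T.1.filter (fun i => i < j.1)).card * x j.1) •
        Finsupp.single ⟨T.1.erase j.1, by
          simp [Finset.card_erase_of_mem j.2, T.2]⟩ (1 : R))

/-- A projective resolution `⋯ → F 1 → F 0 → M → 0` of an `R`-module `M`. -/
structure ProjRes (M : Type u) [AddCommGroup M] [Module R M] where
  F : ℕ → ModuleCat.{u} R
  d : ∀ n, F (n + 1) →ₗ[R] F n
  ε : F 0 →ₗ[R] M
  projective : ∀ n, Module.Projective R (F n)
  surj : Function.Surjective ε
  exact0 : LinearMap.ker ε = LinearMap.range (d 0)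
  exact : ∀ n, LinearMap.ker (d n) = LinearMap.range (d (n + 1))

/-- A chain map `ψ : K_•(x;R) → F_•` lifting the natural surjection
`R/(x₁,…,x_s) → R/I` (for `(x) ⊆ I`), where `F_•` is a projective resolution of
`R/I`.  The condition `aug` says that on `K_0 = R·e_∅` the augmentations are
compatible: `ε(ψ₀(r·e_∅)) = r mod I`. -/
structure KoszulLift {s : ℕ} (x : Fin s → R) (I : Ideal R)
    (P : ProjRes R (R ⧸ I)) where
  ψ : ∀ n, KMod R s n →ₗ[R] P.F n
  comm : ∀ n, (ψ n).comp (koszulD R x n) = (P.d n).comp (ψ (n + 1))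
  aug : ∀ v : KMod R s 0, P.ε (ψ 0 v) = Ideal.Quotient.mk I (v ⟨∅, rfl⟩)

/-- The natural map `K_i(x;R) ⊗ k → Tor_i^R(R/I, k)` is the zero map: for every
projective resolution `F_•` of `R/I` and every chain map `ψ : K_•(x;R) → F_•`
lifting the natural surjection `R/(x) → R/I`, every element of `ψ_i(K_i)` lies in
`im(d_{i+1}) + m·F_i`.  (As every element of `K_i ⊗ k` is a cycle, the induced
map on `i`-th homology `K_i ⊗ k → H_i(F_• ⊗ k) = Tor_i^R(R/I,k)` is zero exactly
when `ψ_i(K_i) ⊆ im(d_{i+1}) + m·F_i`.) -/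
def KoszulTorMapZero [IsLocalRing R] {s : ℕ} (x : Fin s → R) (I : Ideal R)
    (i : ℕ) : Prop :=
  ∀ (P : ProjRes R (R ⧸ I)) (L : KoszulLift R x I P) (v : KMod R s i),
    L.ψ i v ∈ LinearMap.range (P.d i) ⊔ (maximalIdeal R) • (⊤ : Submodule R (P.F i))

/-- `R` is a regular local ring: a Noetherian local ring whose maximal ideal is
generated by `dim R` elements. -/
def IsRegularLocal [IsLocalRing R] : Prop :=
  IsNoetherianRing R ∧ ∃ (n : ℕ) (x : Fin n → R),
    Ideal.span (Set.range x) = maximalIdeal R ∧ ringKrullDim R = n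

/-- The ideal `I` has height `d`: `d` is the minimum of the heights of the primes
containing `I`, the height of a prime `P` being `dim R_P`. -/
def HeightEq (I : Ideal R) (d : ℕ) : Prop :=
  (∃ (P : Ideal R) (h : P.IsPrime), I ≤ P ∧
      ringKrullDim (@Localization.AtPrime R _ P h) = d) ∧
    ∀ (P : Ideal R) (h : P.IsPrime), I ≤ P →
      (d : WithBot ℕ∞) ≤ ringKrullDim (@Localization.AtPrime R _ P h)

/-- Serre's condition `S_n` for the ring `A`: for every prime `P` of `A`,
`depth A_P ≥ min(n, dim A_P)`, expressed by the existence of regular sequences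
in the maximal ideal of `A_P` of every length `j ≤ min(n, dim A_P)`. -/
def SerreS (A : Type u) [CommRing A] (n : ℕ) : Prop :=
  ∀ (P : Ideal A) (h : P.IsPrime) (j : ℕ), j ≤ n →
    (j : WithBot ℕ∞) ≤ ringKrullDim (@Localization.AtPrime A _ P h) →
      ∃ rs : List (@Localization.AtPrime A _ P h), rs.length = j ∧
        (∀ r ∈ rs, r ∈ maximalIdeal (@Localization.AtPrime A _ P h)) ∧
        RingTheory.Sequence.IsWeaklyRegular (@Localization.AtPrime A _ P h) rs

/-- `x₁, …, x_s` is a minimal set of generators of `I`: the `x_j` generate `I`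
and no `x_j` is redundant (over a local ring this says exactly that
`s = dim_k I/mI`). -/
def MinimalGenerators {s : ℕ} (x : Fin s → R) (I : Ideal R) : Prop :=
  Ideal.span (Set.range x) = I ∧
    ∀ j, x j ∉ Ideal.span (x '' ({j}ᶜ : Set (Fin s)))

universe v

/-- The exterior algebra on `n` generators with coefficients in `M`, as an iterated product. -/
def KProd : ℕ → Type v → Type v
  | 0, M => M
  | n + 1, M => KProd n M × KProd n M

namespace KProd

noncomputable instance instAddCommGroup {M : Type*} [AddCommGroup M] :
    ∀ n, AddCommGroup (KProd n M)
  | 0 => inferInstanceAs (AddCommGroup M)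
  | n + 1 => letI := instAddCommGroup (M := M) n
    inferInstanceAs (AddCommGroup (KProd n M × KProd n M))

noncomputable instance instModule {A M : Type*} [CommRing A] [AddCommGroup M] [Module A M] :
    ∀ n, Module A (KProd n M)
  | 0 => inferInstanceAs (Module A M)
  | n + 1 => letI := instModule (A := A) (M := M) n
    inferInstanceAs (Module A (KProd n M × KProd n M))

section Operators

variable {A M : Type*} [CommRing A] [AddCommGroup M] [Module A M]

/-- Koszul differential. -/
noncomputable def del : ∀ {n : ℕ} (_ : Fin n → A), KProd n M →ₗ[A] KProd n M
  | 0, _ => 0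
  | n + 1, x => LinearMap.prod
      ((del (Fin.tail x)).comp (LinearMap.fst A (KProd n M) (KProd n M)) +
        x 0 • LinearMap.snd A (KProd n M) (KProd n M))
      (-((del (Fin.tail x)).comp (LinearMap.snd A (KProd n M) (KProd n M))))

/-- Left multiplication by a vector. -/
noncomputable def wedge : ∀ {n : ℕ} (_ : Fin n → A), KProd n M →ₗ[A] KProd n M
  | 0, _ => 0
  | n + 1, v => LinearMap.prod
      ((wedge (Fin.tail v)).comp (LinearMap.fst A (KProd n M) (KProd n M)))
      (v 0 • LinearMap.fst A (KProd n M) (KProd n M) -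
        (wedge (Fin.tail v)).comp (LinearMap.snd A (KProd n M) (KProd n M)))

/-- The inclusion in degree zero. -/
noncomputable def incl : ∀ n : ℕ, M →ₗ[A] KProd n M
  | 0 => LinearMap.id
  | n + 1 => (LinearMap.inl A (KProd n M) (KProd n M)).comp (incl n)

/-- The projection to degree zero. -/
noncomputable def zeroth : ∀ n : ℕ, KProd n M →ₗ[A] M
  | 0 => LinearMap.id
  | n + 1 => (zeroth n).comp (LinearMap.fst A (KProd n M) (KProd n M))

/-- The projection to degree `i`. -/
noncomputable def proj : ∀ (n : ℕ) (_ : ℕ), KProd n M →ₗ[A] KProd n M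
  | 0, 0 => LinearMap.id
  | 0, _ + 1 => 0
  | n + 1, 0 => LinearMap.prodMap (proj n 0) 0
  | n + 1, i + 1 => LinearMap.prodMap (proj n (i + 1)) (proj n i)

lemma del_succ {n : ℕ} (x : Fin (n + 1) → A) (a b : KProd n M) :
    del x ((a, b) : KProd (n + 1) M) =
      ((del (Fin.tail x) a + x 0 • b, -del (Fin.tail x) b) : KProd n M × KProd n M) := rfl

lemma wedge_succ {n : ℕ} (v : Fin (n + 1) → A) (a b : KProd n M) :
    wedge v ((a, b) : KProd (n + 1) M) =
      ((wedge (Fin.tail v) a, v 0 • a - wedge (Fin.tail v) b) : KProd n M × KProd n M) := rfl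

omit [AddCommGroup M] in
lemma ext_succ {n : ℕ} {a b c d : KProd n M} (h₁ : a = c) (h₂ : b = d) :
    ((a, b) : KProd n M × KProd n M) = (c, d) := by rw [h₁, h₂]

lemma del_del : ∀ {n : ℕ} (x : Fin n → A) (c : KProd n M), del x (del x c) = 0
  | 0, _, _ => rfl
  | n + 1, x, (a, b) => by
    rw [del_succ, del_succ]
    refine ext_succ ?_ ?_
    · rw [map_add, del_del, map_smul, smul_neg, zero_add, add_neg_cancel]
    · rw [map_neg, del_del, neg_neg]

lemma del_wedge : ∀ {n : ℕ} (x v : Fin n → A) (c : KProd n M),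
    del x (wedge v c) = (∑ k, v k * x k) • c - wedge v (del x c)
  | 0, x, v, c => by simp [del, wedge]
  | n + 1, x, v, (a, b) => by
    have h : ∑ k, v k * x k = v 0 * x 0 + ∑ k, Fin.tail v k * Fin.tail x k := Fin.sum_univ_succ _
    rw [del_succ, wedge_succ, del_succ, wedge_succ, h]
    generalize hS : ∑ k, Fin.tail v k * Fin.tail x k = S
    change _ = (((v 0 * x 0 + S) • a - _, (v 0 * x 0 + S) • b - _) : KProd n M × KProd n M)
    refine ext_succ ?_ ?_
    · rw [del_wedge, map_add, map_smul, hS]; dsimp only; module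
    · rw [map_sub, del_wedge, map_smul, map_neg, hS]; dsimp only; module

lemma del_incl : ∀ {n : ℕ} (x : Fin n → A) (m : M), del x (incl (A := A) n m) = 0
  | 0, _, _ => rfl
  | n + 1, x, m => by
    change del x ((incl (A := A) n m, 0) : KProd (n + 1) M) = _
    rw [del_succ, del_incl, map_zero]; simp; rfl

lemma zeroth_incl : ∀ {n : ℕ} (m : M), zeroth (A := A) n (incl (A := A) n m) = m
  | 0, _ => rfl
  | n + 1, m => zeroth_incl (n := n) m

lemma proj_proj : ∀ {n : ℕ} (i : ℕ) (c : KProd n M),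
    proj (A := A) n i (proj (A := A) n i c) = proj (A := A) n i c
  | 0, 0, _ => rfl
  | 0, _ + 1, _ => rfl
  | _ + 1, 0, (a, _) => ext_succ (proj_proj 0 a) rfl
  | _ + 1, i + 1, (a, b) => ext_succ (proj_proj (i + 1) a) (proj_proj i b)

lemma del_proj_zero : ∀ {n : ℕ} (x : Fin n → A) (c : KProd n M),
    del x (proj (A := A) n 0 c) = 0
  | 0, _, _ => rfl
  | n + 1, x, (a, b) => by
    change del x ((proj (A := A) n 0 a, 0) : KProd (n + 1) M) = _
    rw [del_succ, del_proj_zero, map_zero, smul_zero, add_zero, neg_zero]; rfl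

lemma del_proj_succ : ∀ {n : ℕ} (x : Fin n → A) (i : ℕ) (c : KProd n M),
    del x (proj (A := A) n (i + 1) c) = proj (A := A) n i (del x c)
  | 0, _, 0, _ => rfl
  | 0, _, _ + 1, _ => rfl
  | n + 1, x, 0, (a, b) => by
    change del x ((proj (A := A) n 1 a, proj (A := A) n 0 b) : KProd (n + 1) M) =
      ((proj (A := A) n 0 (del (Fin.tail x) a + x 0 • b), 0) : KProd n M × KProd n M)
    rw [del_succ, del_proj_succ, del_proj_zero, map_add, map_smul, neg_zero]
  | n + 1, x, i + 1, (a, b) => by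
    change del x ((proj (A := A) n (i + 2) a, proj (A := A) n (i + 1) b) : KProd (n + 1) M) =
      ((proj (A := A) n (i + 1) (del (Fin.tail x) a + x 0 • b),
        proj (A := A) n i (- del (Fin.tail x) b)) : KProd n M × KProd n M)
    rw [del_succ, del_proj_succ, del_proj_succ, map_add, map_smul, map_neg]

lemma wedge_proj : ∀ {n : ℕ} (x : Fin n → A) (i : ℕ) (c : KProd n M),
    wedge x (proj (A := A) n i c) = proj (A := A) n (i + 1) (wedge x c)
  | 0, _, 0, _ => rfl
  | 0, _, _ + 1, _ => rfl
  | n + 1, x, 0, (a, b) => by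
    change wedge x ((proj (A := A) n 0 a, 0) : KProd (n + 1) M) =
      ((proj (A := A) n 1 (wedge (Fin.tail x) a),
        proj (A := A) n 0 (x 0 • a - wedge (Fin.tail x) b)) : KProd n M × KProd n M)
    rw [wedge_succ, wedge_proj, map_zero, sub_zero, map_sub, map_smul, proj_zero_wedge, sub_zero]
  | n + 1, x, i + 1, (a, b) => by
    change wedge x ((proj (A := A) n (i + 1) a, proj (A := A) n i b) : KProd (n + 1) M) =
      ((proj (A := A) n (i + 2) (wedge (Fin.tail x) a),
        proj (A := A) n (i + 1) (x 0 • a - wedge (Fin.tail x) b)) : KProd n M × KProd n M)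
    rw [wedge_succ, wedge_proj, wedge_proj, map_sub, map_smul]
where
  proj_zero_wedge : ∀ {n : ℕ} (x : Fin n → A) (c : KProd n M),
      proj (A := A) n 0 (wedge x c) = 0
  | 0, _, _ => rfl
  | _ + 1, x, (a, _) => ext_succ (proj_zero_wedge (Fin.tail x) a) rfl

lemma proj_zero_incl : ∀ {n : ℕ} (m : M),
    proj (A := A) n 0 (incl (A := A) n m) = incl (A := A) n m
  | 0, _ => rfl
  | _ + 1, m => ext_succ (proj_zero_incl m) rfl

lemma eq_incl_of_proj_zero : ∀ {n : ℕ} (c : KProd n M), proj (A := A) n 0 c = c →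
    c = incl (A := A) n (zeroth (A := A) n c)
  | 0, _, _ => rfl
  | _ + 1, (a, _), h => by
    have h' := Prod.mk.inj h
    exact ext_succ (eq_incl_of_proj_zero a h'.1) h'.2.symm

/-- Elements all of whose coordinates lie in a submodule. -/
noncomputable def coef (N : Submodule A M) : ∀ n : ℕ, Submodule A (KProd n M)
  | 0 => N
  | n + 1 => (coef N n).prod (coef N n)

variable {N N' : Submodule A M}

lemma coef_mono (h : N ≤ N') : ∀ {n : ℕ}, coef N n ≤ coef N' n
  | 0 => h
  | _ + 1 => fun _ hc => ⟨coef_mono h hc.1, coef_mono h hc.2⟩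

lemma coef_bot : ∀ {n : ℕ} {c : KProd n M}, c ∈ coef (⊥ : Submodule A M) n → c = 0
  | 0, _, h => h
  | _ + 1, (_, _), h => ext_succ (coef_bot h.1) (coef_bot h.2)

lemma del_mem_coef : ∀ {n : ℕ} (x : Fin n → A) {c : KProd n M}, c ∈ coef N n →
    del x c ∈ coef N n
  | 0, _, _, _ => N.zero_mem
  | _ + 1, _, (_, _), h => ⟨add_mem (del_mem_coef _ h.1) (Submodule.smul_mem _ _ h.2),
      neg_mem (del_mem_coef _ h.2)⟩

lemma wedge_mem_coef : ∀ {n : ℕ} (x : Fin n → A) {c : KProd n M}, c ∈ coef N n →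
    wedge x c ∈ coef N n
  | 0, _, _, _ => N.zero_mem
  | _ + 1, _, (_, _), h => ⟨wedge_mem_coef _ h.1,
      sub_mem (Submodule.smul_mem _ _ h.1) (wedge_mem_coef _ h.2)⟩

lemma proj_mem_coef : ∀ {n : ℕ} (i : ℕ) {c : KProd n M}, c ∈ coef N n →
    proj (A := A) n i c ∈ coef N n
  | 0, 0, _, h => h
  | 0, _ + 1, _, _ => N.zero_mem
  | _ + 1, 0, (_, _), h => ⟨proj_mem_coef 0 h.1, zero_mem _⟩
  | _ + 1, i + 1, (_, _), h => ⟨proj_mem_coef (i + 1) h.1, proj_mem_coef i h.2⟩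

lemma exists_of_coef_sup : ∀ {n : ℕ} {c : KProd n M}, c ∈ coef (N ⊔ N') n →
    ∃ a ∈ coef N n, ∃ b ∈ coef N' n, c = a + b
  | 0, _, h => by
    obtain ⟨a, ha, b, hb, h⟩ := (Submodule.mem_sup (p := N) (p' := N')).mp h
    exact ⟨a, ha, b, hb, h.symm⟩
  | n + 1, (c, c'), h => by
    obtain ⟨a, ha, b, hb, e⟩ := exists_of_coef_sup h.1
    obtain ⟨a', ha', b', hb', e'⟩ := exists_of_coef_sup h.2
    exact ⟨(a, a'), ⟨ha, ha'⟩, (b, b'), ⟨hb, hb'⟩, ext_succ e e'⟩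

lemma smul_mem_coef (r : A) (h : ∀ m ∈ N, r • m ∈ N') : ∀ {n : ℕ} {c : KProd n M},
    c ∈ coef N n → r • c ∈ coef N' n
  | 0, _, hc => h _ hc
  | _ + 1, (_, _), hc => ⟨smul_mem_coef r h hc.1, smul_mem_coef r h hc.2⟩

lemma mem_coef_of_smul_mem (r : A) (h : ∀ m, r • m ∈ N' → m ∈ N) : ∀ {n : ℕ} {c : KProd n M},
    r • c ∈ coef N' n → c ∈ coef N n
  | 0, _, hc => h _ hc
  | _ + 1, (_, _), hc => ⟨mem_coef_of_smul_mem r h hc.1, mem_coef_of_smul_mem r h hc.2⟩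

lemma mem_coef_of_forall {ι : Type*} (r : ι → A) (h : ∀ m, (∀ i, r i • m ∈ N') → m ∈ N) :
    ∀ {n : ℕ} {c : KProd n M}, (∀ i, r i • c ∈ coef N' n) → c ∈ coef N n
  | 0, _, hc => h _ hc
  | _ + 1, (_, _), hc =>
    ⟨mem_coef_of_forall r h fun i => (hc i).1, mem_coef_of_forall r h fun i => (hc i).2⟩

lemma mem_coef_top : ∀ {n : ℕ} (c : KProd n M), c ∈ coef (⊤ : Submodule A M) n
  | 0, _ => trivial
  | _ + 1, (_, _) => ⟨mem_coef_top _, mem_coef_top _⟩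

section Map

variable {B P : Type*} [CommRing B] [AddCommGroup P] [Module B P]

/-- Functoriality in the coefficients. -/
noncomputable def map (f : M →+ P) : ∀ n : ℕ, KProd n M →+ KProd n P
  | 0 => f
  | n + 1 => (map f n).prodMap (map f n)

lemma map_succ (f : M →+ P) {n : ℕ} (a b : KProd n M) :
    map f (n + 1) ((a, b) : KProd (n + 1) M) = ((map f n a, map f n b) : KProd n P × KProd n P) :=
  rfl

lemma map_smul_of (f : M →+ P) {r : A} {r' : B} (h : ∀ m, f (r • m) = r' • f m) :
    ∀ {n : ℕ} (c : KProd n M), map f n (r • c) = r' • map f n c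
  | 0, c => h c
  | _ + 1, (a, b) => ext_succ (map_smul_of f h a) (map_smul_of f h b)

lemma map_del (f : M →+ P) : ∀ {n : ℕ} {x : Fin n → A} {x' : Fin n → B}
    (_ : ∀ k m, f (x k • m) = x' k • f m) (c : KProd n M),
    map f n (del x c) = del x' (map f n c)
  | 0, _, _, _, _ => f.map_zero
  | n + 1, x, x', h, (a, b) => by
    rw [map_succ, del_succ, del_succ, map_succ, map_add, map_neg,
      map_del f (x := Fin.tail x) (x' := Fin.tail x') (fun k m => h _ m),
      map_del f (x := Fin.tail x) (x' := Fin.tail x') (fun k m => h _ m), map_smul_of f (h 0)]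

lemma map_wedge (f : M →+ P) : ∀ {n : ℕ} {x : Fin n → A} {x' : Fin n → B}
    (_ : ∀ k m, f (x k • m) = x' k • f m) (c : KProd n M),
    map f n (wedge x c) = wedge x' (map f n c)
  | 0, _, _, _, _ => f.map_zero
  | n + 1, x, x', h, (a, b) => by
    rw [map_succ, wedge_succ, wedge_succ, map_succ, map_sub,
      map_wedge f (x := Fin.tail x) (x' := Fin.tail x') (fun k m => h _ m),
      map_wedge f (x := Fin.tail x) (x' := Fin.tail x') (fun k m => h _ m), map_smul_of f (h 0)]

lemma map_incl (f : M →+ P) : ∀ {n : ℕ} (m : M),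
    map f n (incl (A := A) n m) = incl (A := B) n (f m)
  | 0, _ => rfl
  | _ + 1, m => ext_succ (map_incl f m) (map_zero (map f _))

lemma map_mem_coef (f : M →+ P) {N : Submodule A M} {N' : Submodule B P}
    (h : ∀ m ∈ N, f m ∈ N') : ∀ {n : ℕ} {c : KProd n M}, c ∈ coef N n → map f n c ∈ coef N' n
  | 0, _, hc => h _ hc
  | _ + 1, (_, _), hc => ⟨map_mem_coef f h hc.1, map_mem_coef f h hc.2⟩

lemma mem_coef_of_map_mem (f : M →+ P) {N : Submodule A M} {N' : Submodule B P}
    (h : ∀ m, f m ∈ N' → m ∈ N) : ∀ {n : ℕ} {c : KProd n M}, map f n c ∈ coef N' n → c ∈ coef N n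
  | 0, _, hc => h _ hc
  | _ + 1, (_, _), hc => ⟨mem_coef_of_map_mem f h hc.1, mem_coef_of_map_mem f h hc.2⟩

end Map

end Operators
end KProd

namespace KProd

variable {A : Type v} [CommRing A]

/-- A sequence which is regular when read from the last entry to the first. -/
def RevRegular {n : ℕ} (x : Fin n → A) : Prop :=
  ∀ k m, x k * m ∈ Ideal.span (x '' Set.Ioi k) → m ∈ Ideal.span (x '' Set.Ioi k)

lemma RevRegular.tail {n : ℕ} {x : Fin (n + 1) → A} (h : RevRegular x) :
    RevRegular (Fin.tail x) := by
  intro k m hm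
  have e : Fin.tail x '' Set.Ioi k = x '' Set.Ioi k.succ := by
    rw [← Fin.image_succ_Ioi, Set.image_image]; rfl
  rw [e] at hm ⊢
  exact h _ _ hm

lemma incl_mem_range_of_mem {n : ℕ} {x : Fin n → A} {m : A} (hm : m ∈ Ideal.span (Set.range x)) :
    ∃ e, incl (A := A) n m = del x e := by
  obtain ⟨v, hv⟩ := Ideal.mem_span_range_iff_exists_fun.mp hm
  refine ⟨wedge v (incl (A := A) n (1 : A)), ?_⟩
  rw [del_wedge, del_incl, map_zero, sub_zero, hv, ← map_smul, smul_eq_mul, mul_one]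

lemma zeroth_del_mem : ∀ {n : ℕ} (x : Fin n → A) (c : KProd n A),
    zeroth (A := A) n (del x c) ∈ Ideal.span (Set.range x)
  | 0, _, _ => zero_mem (Ideal.span _)
  | n + 1, x, (a, b) => by
    change zeroth (A := A) n (del (Fin.tail x) a + x 0 • b) ∈ _
    rw [map_add, map_smul]
    refine add_mem (Ideal.span_mono ?_ (zeroth_del_mem (Fin.tail x) a))
      (Ideal.mul_mem_right _ _ (Ideal.subset_span ⟨0, rfl⟩))
    rintro _ ⟨k, rfl⟩
    exact ⟨k.succ, rfl⟩

/-- The Koszul complex of a regular sequence is acyclic in positive degrees. -/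
lemma exact_of_revRegular : ∀ {n : ℕ} {x : Fin n → A} (_ : RevRegular x) (i : ℕ) (c : KProd n A),
    proj (A := A) n (i + 1) c = c → del x c = 0 → ∃ e, c = del x e
  | 0, x, _, _, c, h, _ => ⟨0, h.symm⟩
  | n + 1, x, hx, i, (a, b), h, h' => by
    have ha : proj (A := A) n (i + 1) a = a := (Prod.mk.inj h).1
    have hb : proj (A := A) n i b = b := (Prod.mk.inj h).2
    have h1 : del (Fin.tail x) a + x 0 • b = 0 := (Prod.mk.inj h').1
    have h2 : del (Fin.tail x) b = 0 := neg_eq_zero.mp (Prod.mk.inj h').2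
    have key : ∃ b', b = del (Fin.tail x) b' := by
      cases i with
      | succ i => exact exact_of_revRegular hx.tail i b hb h2
      | zero =>
        rw [eq_incl_of_proj_zero b hb]
        have e : x '' Set.Ioi 0 = Set.range (Fin.tail x) := by
          have e0 : Set.Ioi (0 : Fin (n + 1)) = Set.range Fin.succ := by
            rw [Fin.range_succ]; ext i; simp [Fin.pos_iff_ne_zero]
          rw [e0, ← Set.range_comp]; rfl
        refine incl_mem_range_of_mem (e ▸ hx 0 _ ?_)
        rw [e]
        have h3 : x 0 * zeroth (A := A) n b = - zeroth (A := A) n (del (Fin.tail x) a) := by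
          rw [← map_neg, ← smul_eq_mul, ← map_smul]
          congr 1
          exact eq_neg_of_add_eq_zero_right h1
        rw [h3]
        exact neg_mem (zeroth_del_mem _ _)
    obtain ⟨b', hb'⟩ := key
    obtain ⟨a', ha'⟩ := exact_of_revRegular hx.tail i (a + x 0 • proj (A := A) n (i + 1) b')
      (by rw [map_add, map_smul, proj_proj, ha]) (by
        rw [map_add, map_smul, del_proj_succ, ← hb', hb, h1])
    refine ⟨((a', - proj (A := A) n (i + 1) b') : KProd n A × KProd n A), ?_⟩
    have e := del_succ (A := A) x a' (- proj (A := A) n (i + 1) b')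
    refine Eq.trans ?_ e.symm
    refine ext_succ ?_ ?_
    · rw [← ha']; module
    · rw [map_neg, neg_neg, del_proj_succ, ← hb', hb]

section Linked

variable {n : ℕ} (x : Fin n → A) (v : ℕ → Fin n → A)

/-- The iterated products `v (j-1) ∧ ⋯ ∧ v 0`. -/
noncomputable def wedges : ℕ → KProd n A
  | 0 => incl (A := A) n 1
  | j + 1 => wedge (v j) (wedges j)

/-- The ideal generated by the first `j` members of a sequence. -/
def initIdeal (y : ℕ → A) (j : ℕ) : Ideal A := Ideal.span (y '' Set.Iio j)

lemma initIdeal_succ (y : ℕ → A) (j : ℕ) :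
    initIdeal y (j + 1) = Ideal.span {y j} ⊔ initIdeal y j := by
  rw [initIdeal, initIdeal, ← Ideal.span_union, ← Set.image_singleton (f := y), ← Set.image_union]
  congr 2; ext i; simp

lemma initIdeal_zero (y : ℕ → A) : initIdeal y 0 = ⊥ := by simp [initIdeal]

lemma initIdeal_mono (y : ℕ → A) {i j : ℕ} (h : i ≤ j) : initIdeal y i ≤ initIdeal y j :=
  Ideal.span_mono (Set.image_mono (Set.Iio_subset_Iio h))

lemma mem_initIdeal (y : ℕ → A) {i j : ℕ} (h : i < j) : y i ∈ initIdeal y j :=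
  Ideal.subset_span ⟨i, h, rfl⟩

lemma exists_of_coef_span {y : A} : ∀ {n : ℕ} {c : KProd n A}, c ∈ coef (Ideal.span {y}) n →
    ∃ c', c = y • c'
  | 0, _, h => by
    obtain ⟨a, ha⟩ := Ideal.mem_span_singleton'.mp (show (_ : A) ∈ Ideal.span {y} from h)
    exact ⟨a, ha.symm.trans (mul_comm _ _)⟩
  | n + 1, (c, c'), h => by
    obtain ⟨a, ha⟩ := exists_of_coef_span h.1
    obtain ⟨b, hb⟩ := exists_of_coef_span h.2
    exact ⟨(a, b), ext_succ ha hb⟩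

lemma smul_mem_coef_of_mem {J : Ideal A} {r : A} (hr : r ∈ J) (c : KProd n A) : r • c ∈ coef J n :=
  smul_mem_coef (N := ⊤) r (fun m _ => J.mul_mem_right m hr) (mem_coef_top c)

/-- Boundaries modulo an ideal. -/
noncomputable def bdry (J : Ideal A) : Submodule A (KProd n A) := LinearMap.range (del x) ⊔ coef J n

variable {x v}

lemma mem_bdry {J : Ideal A} {c : KProd n A} :
    c ∈ bdry x J ↔ ∃ b, c - del x b ∈ coef J n := by
  rw [bdry, Submodule.mem_sup]
  constructor
  · rintro ⟨_, ⟨b, rfl⟩, e, he, rfl⟩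
    exact ⟨b, by simpa using he⟩
  · rintro ⟨b, hb⟩
    exact ⟨_, ⟨b, rfl⟩, _, hb, by abel⟩

lemma bdry_mono {J J' : Ideal A} (h : J ≤ J') : bdry x J ≤ bdry x J' :=
  sup_le_sup le_rfl (coef_mono h)

lemma coef_le_bdry {J : Ideal A} : coef J n ≤ bdry x J := le_sup_right

lemma del_mem_bdry {J : Ideal A} (c : KProd n A) : del x c ∈ bdry x J :=
  Submodule.mem_sup_left ⟨c, rfl⟩

variable {y : ℕ → A} {d : ℕ}

/-- The Koszul complex modulo `j` members of a regular sequence is acyclic in degrees above `j`. -/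
theorem mem_bdry_initIdeal (hx : RevRegular x)
    (hy : ∀ j < d, ∀ r, y j * r ∈ initIdeal y j → r ∈ initIdeal y j) (j : ℕ) (hj : j ≤ d) :
    ∀ i, j < i → ∀ c : KProd n A, proj (A := A) n i c = c → del x c ∈ coef (initIdeal y j) n →
      c ∈ bdry x (initIdeal y j) := by
  induction j with
  | zero =>
    intro i hi c hc h
    rw [initIdeal_zero] at h
    obtain ⟨i, rfl⟩ := Nat.exists_eq_succ_of_ne_zero hi.ne'
    obtain ⟨e, rfl⟩ := exact_of_revRegular hx i c hc (coef_bot h)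
    exact del_mem_bdry e
  | succ j ih =>
    have ih1 := ih (by omega)
    intro i hi c hc h
    obtain ⟨i, rfl⟩ : ∃ i', i = i' + 2 := ⟨i - 2, by omega⟩
    rw [initIdeal_succ] at h
    obtain ⟨e₁, he₁, e₂, he₂, he⟩ := exists_of_coef_sup h
    obtain ⟨c₀, rfl⟩ := exists_of_coef_span he₁
    have h0 : del x c₀ ∈ coef (initIdeal y j) n := by
      refine mem_coef_of_smul_mem (N := initIdeal y j) (y j) (hy j (by omega)) ?_
      have := congrArg (del x) he
      rw [del_del, map_add, map_smul] at this
      rw [eq_neg_of_add_eq_zero_left this.symm]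
      exact neg_mem (del_mem_coef _ he₂)
    obtain ⟨b, hb⟩ := mem_bdry.mp (ih1 (i + 1) (by omega) (proj (A := A) n (i + 1) c₀)
      (proj_proj _ _) (by rw [del_proj_succ]; exact proj_mem_coef _ h0))
    have h1 : del x c - y j • proj (A := A) n (i + 1) c₀ ∈ coef (initIdeal y j) n := by
      have : del x c - y j • proj (A := A) n (i + 1) c₀ = proj (A := A) n (i + 1) e₂ := by
        rw [← hc, del_proj_succ, he, map_add, map_smul]; abel
      rw [this]
      exact proj_mem_coef _ he₂
    have h3 : del x (c - y j • b) ∈ coef (initIdeal y j) n := by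
      have : del x (c - y j • b) = (del x c - y j • proj (A := A) n (i + 1) c₀) +
          y j • (proj (A := A) n (i + 1) c₀ - del x b) := by
        rw [map_sub, map_smul, smul_sub]; abel
      rw [this]
      exact add_mem h1 (Submodule.smul_mem _ _ hb)
    have h4 := ih1 (i + 2) (by omega) (proj (A := A) n (i + 2) (c - y j • b)) (proj_proj _ _)
      (by rw [del_proj_succ]; exact proj_mem_coef _ h3)
    have h5 : c = proj (A := A) n (i + 2) (c - y j • b) + y j • proj (A := A) n (i + 2) b := by
      rw [map_sub, map_smul, hc]; abel
    rw [h5]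
    exact add_mem (bdry_mono (initIdeal_mono y (Nat.le_succ j)) h4)
      (coef_le_bdry (smul_mem_coef_of_mem (mem_initIdeal y (Nat.lt_succ_self j)) _))

lemma del_wedge_mem {v : Fin n → A} {J : Ideal A} (hv : ∑ k, v k * x k ∈ J) {c : KProd n A}
    (hc : c ∈ bdry x J) : wedge v c ∈ bdry x J := by
  obtain ⟨b, hb⟩ := mem_bdry.mp hc
  have : wedge v c = (∑ k, v k * x k) • b - del x (wedge v b) + wedge v (c - del x b) := by
    rw [map_sub, del_wedge]; abel
  rw [this]
  exact add_mem (sub_mem (coef_le_bdry (smul_mem_coef_of_mem hv _)) (del_mem_bdry _))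
    (coef_le_bdry (wedge_mem_coef _ hb))

/-- Comparison of a multiple of the fundamental cycle of the powers `y j ^ (q + 1)` with the
fundamental cycle of the `y j`. -/
theorem smul_wedges_mem (hx : RevRegular x)
    (hy : ∀ j < d, ∀ r, y j * r ∈ initIdeal y j → r ∈ initIdeal y j) {q : ℕ}
    (hv : ∀ j < d, ∑ k, v j k * x k = y j ^ (q + 1)) {ρ : A}
    (hρ : ∀ j < d, y j * ρ ∈ Ideal.span (Set.range x)) :
    ∃ κ : KProd n A, ρ • wedges v d - (∏ j ∈ Finset.range d, y j) ^ q • κ ∈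
      bdry x (initIdeal (fun j => y j ^ (q + 1)) d) := by
  suffices H : ∀ j ≤ d, ∃ κ : KProd n A, proj (A := A) n j κ = κ ∧
      del x κ ∈ coef (initIdeal y j) n ∧
      (∀ l, j ≤ l → l < d → y l • κ ∈ bdry x (initIdeal y j)) ∧
      ρ • wedges v j - (∏ j ∈ Finset.range j, y j) ^ q • κ ∈
        bdry x (initIdeal (fun j => y j ^ (q + 1)) j) by
    obtain ⟨κ, -, -, -, h⟩ := H d le_rfl
    exact ⟨κ, h⟩
  intro j
  induction j with
  | zero =>
    intro _
    refine ⟨incl (A := A) n ρ, proj_zero_incl _, ?_, fun l _ hl => ?_, ?_⟩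
    · rw [del_incl]; exact zero_mem _
    · obtain ⟨e, he⟩ := incl_mem_range_of_mem (hρ l hl)
      rw [← map_smul, smul_eq_mul, he]
      exact del_mem_bdry e
    · rw [wedges, ← map_smul, smul_eq_mul, mul_one, Finset.prod_range_zero, one_pow, one_smul,
        sub_self]
      exact zero_mem _
  | succ j ih =>
    intro hj
    obtain ⟨E, hE, hdE, hyE, hwE⟩ := ih (by omega)
    have acyc := mem_bdry_initIdeal hx hy j (by omega) (j + 1) (by omega)
    obtain ⟨c₀, hc₀⟩ := mem_bdry.mp (hyE j le_rfl (by omega))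
    set c := proj (A := A) n (j + 1) c₀ with hc
    have h1 : y j • E - del x c ∈ coef (initIdeal y j) n := by
      have : y j • E - del x c = proj (A := A) n j (y j • E - del x c₀) := by
        rw [hc, del_proj_succ, map_sub, map_smul, hE]
      rw [this]
      exact proj_mem_coef _ hc₀
    have acyc' : ∀ e : KProd n A, proj (A := A) n (j + 1) e = e →
        del x e ∈ coef (initIdeal y j) n → e ∈ bdry x (initIdeal y j) := acyc
    refine ⟨c, proj_proj _ _, ?_, fun l hl hl' => ?_, ?_⟩
    · have : del x c = y j • E - (y j • E - del x c) := by abel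
      rw [this]
      exact sub_mem (smul_mem_coef_of_mem (mem_initIdeal y (Nat.lt_succ_self j)) _)
        (coef_mono (initIdeal_mono y (Nat.le_succ j)) h1)
    · obtain ⟨b₀, hb₀⟩ := mem_bdry.mp (hyE l (by omega) hl')
      set b := proj (A := A) n (j + 1) b₀ with hb
      have h2 : y l • E - del x b ∈ coef (initIdeal y j) n := by
        have : y l • E - del x b = proj (A := A) n j (y l • E - del x b₀) := by
          rw [hb, del_proj_succ, map_sub, map_smul, hE]
        rw [this]
        exact proj_mem_coef _ hb₀
      have h3 : y l • c - y j • b ∈ bdry x (initIdeal y j) := by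
        refine acyc' _ ?_ ?_
        · rw [map_sub, map_smul, map_smul, hc, hb, proj_proj, proj_proj]
        · have : del x (y l • c - y j • b)
              = y j • (y l • E - del x b) - y l • (y j • E - del x c) := by
            rw [map_sub, map_smul, map_smul]; module
          rw [this]
          exact sub_mem (Submodule.smul_mem _ _ h2) (Submodule.smul_mem _ _ h1)
      have : y l • c = (y l • c - y j • b) + y j • b := by abel
      rw [this]
      exact add_mem (bdry_mono (initIdeal_mono y (Nat.le_succ j)) h3)
        (coef_le_bdry (smul_mem_coef_of_mem (mem_initIdeal y (Nat.lt_succ_self j)) _))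
    · have h4 : wedge (v j) E - y j ^ q • c ∈ bdry x (initIdeal y j) := by
        refine acyc' _ ?_ ?_
        · rw [map_sub, map_smul, hc, proj_proj, ← wedge_proj, hE]
        · have : del x (wedge (v j) E - y j ^ q • c)
              = y j ^ q • (y j • E - del x c) - wedge (v j) (del x E) := by
            rw [map_sub, map_smul, del_wedge, hv j (by omega), pow_succ]; module
          rw [this]
          exact sub_mem (Submodule.smul_mem _ _ h1) (wedge_mem_coef _ hdE)
      have h5 : ρ • wedges v (j + 1) - (∏ j ∈ Finset.range (j + 1), y j) ^ q • c
          = wedge (v j) (ρ • wedges v j - (∏ j ∈ Finset.range j, y j) ^ q • E)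
            + (∏ j ∈ Finset.range j, y j) ^ q • (wedge (v j) E - y j ^ q • c) := by
        rw [wedges, Finset.prod_range_succ, mul_pow, map_sub, map_smul, map_smul]; module
      rw [h5]
      have hle := initIdeal_mono (fun j => y j ^ (q + 1)) (Nat.le_succ j)
      refine add_mem (del_wedge_mem ?_ (bdry_mono hle hwE)) ?_
      · rw [hv j (by omega)]
        exact mem_initIdeal (fun j => y j ^ (q + 1)) (Nat.lt_succ_self j)
      · obtain ⟨b, hb⟩ := mem_bdry.mp h4
        refine mem_bdry.mpr ⟨(∏ j ∈ Finset.range j, y j) ^ q • b, ?_⟩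
        rw [map_smul, ← smul_sub]
        refine smul_mem_coef (N := initIdeal y j) _ (fun r hr => ?_) hb
        rw [smul_eq_mul, mul_comm]
        refine (?_ : initIdeal y j ≤ Submodule.comap
          (LinearMap.mulRight A ((∏ j ∈ Finset.range j, y j) ^ q))
          (initIdeal (fun j => y j ^ (q + 1)) (j + 1))) hr
        refine Ideal.span_le.mpr ?_
        rintro _ ⟨i, hi, rfl⟩
        change y i * (∏ j ∈ Finset.range j, y j) ^ q ∈ initIdeal (fun j => y j ^ (q + 1)) (j + 1)
        obtain ⟨t, ht⟩ := Finset.dvd_prod_of_mem y (Finset.mem_range.mpr hi)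
        rw [ht, mul_pow, ← mul_assoc, ← pow_succ']
        exact Ideal.mul_mem_right _ _
          (mem_initIdeal (fun j => y j ^ (q + 1)) (hi.trans (Nat.lt_succ_self j)))

end Linked
end KProd

namespace KProd

variable {A : Type v} [CommRing A]

/-- Families of additive maps which are linear over `q`-th powers and detect membership in
`(x k ^ q)`. -/
def RootDetects {n : ℕ} (x : Fin n → A) (q : ℕ) : Prop :=
  ∀ s : A, (∀ f : A →+ A, (∀ a m, f (a ^ q * m) = a * f m) → f s ∈ Ideal.span (Set.range x)) →
    s ∈ Ideal.span (Set.range fun k => x k ^ q)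

lemma map_smul_wedges {n : ℕ} {v v' : ℕ → Fin n → A} (f : A →+ A)
    (hf : ∀ j k m, f (v' j k * m) = v j k * f m) (s : A) :
    ∀ j, map f n (s • wedges v' j) = f s • wedges v j
  | 0 => by
    rw [wedges, wedges, ← map_smul, ← map_smul, map_incl (B := A), smul_eq_mul, mul_one,
      smul_eq_mul, mul_one]
  | j + 1 => by
    rw [wedges, wedges, ← map_smul, ← map_smul, map_wedge (B := A) f (hf j),
      map_smul_wedges f hf s j]

/-- If the fundamental cycle of a regular sequence `y` is not a boundary modulo `𝔞 = (y) : b`,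
then the multiples by elements of `𝔞` of anything conducting `(y)` into `(x k ^ q)` lie in
`(x k ^ q)`. -/
theorem mul_mem_of_wedges_notMem {n d p q : ℕ} [Fact p.Prime] [CharP A p] [IsLocalRing A]
    {x : Fin n → A} (hxm : Ideal.span (Set.range x) = IsLocalRing.maximalIdeal A)
    (hq : ∃ e, q + 1 = p ^ e) (hx : RevRegular fun k => x k ^ (q + 1))
    (hroot : RootDetects x (q + 1)) {v : ℕ → Fin n → A} {y : ℕ → A}
    (hv : ∀ j < d, ∑ k, v j k * x k = y j)
    (hy : ∀ j < d, ∀ r, y j * r ∈ initIdeal y j → r ∈ initIdeal y j)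
    {ι : Type*} {b : ι → A}
    {𝔞 : Ideal A} (mem𝔞 : ∀ a, a ∈ 𝔞 ↔ ∀ i, a * b i ∈ initIdeal y d) (hz : wedges v d ∉ bdry x 𝔞)
    {ρ a : A} (hρ : ∀ j < d, y j * ρ ∈ Ideal.span (Set.range fun k => x k ^ (q + 1)))
    (ha : ∀ i, a * b i ∈ initIdeal y d) :
    a * ρ ∈ Ideal.span (Set.range fun k => x k ^ (q + 1)) := by
  obtain ⟨e, he⟩ := hq
  refine hroot _ fun f hf => ?_
  have hJ : ∀ r ∈ initIdeal (fun j => y j ^ (q + 1)) d, f r ∈ initIdeal y d := by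
    intro r hr
    induction hr using Submodule.span_induction with
    | mem r hr =>
      obtain ⟨j, hj, rfl⟩ := hr
      have := hf (y j) 1
      rw [mul_one] at this
      change f (y j ^ (q + 1)) ∈ initIdeal y d
      rw [this]
      exact Ideal.mul_mem_right _ _ (mem_initIdeal y hj)
    | zero => rw [map_zero]; exact zero_mem _
    | add r s _ _ hr hs => rw [map_add]; exact add_mem hr hs
    | smul t r h hr =>
      have hgen : ∀ r ∈ initIdeal (fun j => y j ^ (q + 1)) d, ∀ t, f (t * r) ∈ initIdeal y d := by
        intro r hr
        induction hr using Submodule.span_induction with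
        | mem r hr =>
          obtain ⟨j, hj, rfl⟩ := hr
          intro t
          change f (t * y j ^ (q + 1)) ∈ initIdeal y d
          rw [mul_comm, hf]
          exact Ideal.mul_mem_right _ _ (mem_initIdeal y hj)
        | zero => intro t; rw [mul_zero, map_zero]; exact zero_mem _
        | add r s _ _ hr hs => intro t; rw [mul_add, map_add]; exact add_mem (hr t) (hs t)
        | smul u r _ hr => intro t; rw [smul_eq_mul, ← mul_assoc]; exact hr _
      exact hgen r h t
  obtain ⟨κ, hκ⟩ := smul_wedges_mem (v := fun j k => v j k ^ (q + 1)) hx hy (q := q) (ρ := ρ)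
    (by
      intro j hj
      rw [← hv j hj, he, sum_pow_char_pow]
      simp_rw [mul_pow]) hρ
  obtain ⟨g, hg⟩ := mem_bdry.mp hκ
  set w := (∏ j ∈ Finset.range d, y j) ^ q with hw
  have hwJ : ∀ r ∈ initIdeal y d, w * r ∈ initIdeal (fun j => y j ^ (q + 1)) d := by
    intro r hr
    refine (?_ : initIdeal y d ≤ Submodule.comap (LinearMap.mulLeft A w)
      (initIdeal (fun j => y j ^ (q + 1)) d)) hr
    refine Ideal.span_le.mpr ?_
    rintro _ ⟨i, hi, rfl⟩
    change w * y i ∈ initIdeal (fun j => y j ^ (q + 1)) d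
    obtain ⟨t, ht⟩ := Finset.dvd_prod_of_mem y (Finset.mem_range.mpr hi)
    rw [hw, ht, mul_pow, mul_right_comm, ← pow_succ]
    exact Ideal.mul_mem_right _ _ (mem_initIdeal (fun j => y j ^ (q + 1)) hi)
  have key : f (a * ρ) • wedges v d ∈ bdry x 𝔞 := by
    rw [← map_smul_wedges (v' := fun j k => v j k ^ (q + 1)) f (fun j k m => hf _ _)]
    refine mem_bdry.mpr ⟨map f n (a • g), ?_⟩
    rw [← map_del (x := fun k => x k ^ (q + 1)) f (fun k m => hf _ _), ← map_sub]
    have e1 : (a * ρ) • wedges (fun j k => v j k ^ (q + 1)) d - del (fun k => x k ^ (q + 1)) (a • g)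
        = a • (ρ • wedges (fun j k => v j k ^ (q + 1)) d - w • κ
            - del (fun k => x k ^ (q + 1)) g) + (w * a) • κ := by
      rw [map_smul]; module
    rw [e1, map_add]
    refine add_mem ?_ ?_
    · refine map_mem_coef f (N := initIdeal (fun j => y j ^ (q + 1)) d) (fun r hr => ?_)
        (Submodule.smul_mem _ _ hg)
      exact (mem𝔞 _).mpr fun i => Ideal.mul_mem_right _ _ (hJ r hr)
    · refine map_mem_coef f (N := Ideal.span {w * a}) (fun r hr => (mem𝔞 _).mpr fun i => ?_)
        (smul_mem_coef_of_mem (Ideal.mem_span_singleton_self _) κ)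
      obtain ⟨t, rfl⟩ := Ideal.mem_span_singleton.mp hr
      rw [mul_comm, ← hf]
      refine hJ _ ?_
      have : b i ^ (q + 1) * (w * a * t) = b i ^ q * t * (w * (a * b i)) := by ring
      rw [this]
      exact Ideal.mul_mem_left _ _ (hwJ _ (ha i))
  by_contra hf'
  rw [hxm, IsLocalRing.notMem_maximalIdeal] at hf'
  refine hz ?_
  obtain ⟨u, hu⟩ := hf'
  have := Submodule.smul_mem _ ((u⁻¹ : Aˣ) : A) key
  rwa [smul_smul, ← hu, Units.inv_mul, one_smul] at this

end KProd

namespace MvPowerSeries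

section Monomials

variable {σ : Type} {F : Type v} [CommRing F]

lemma mem_span_X_pow_iff (q : ℕ) (S : Finset σ) (f : MvPowerSeries σ F) :
    f ∈ Ideal.span ((fun k => (X k : MvPowerSeries σ F) ^ q) '' S) ↔
      ∀ β : σ →₀ ℕ, (∀ k ∈ S, β k < q) → coeff β f = 0 := by
  classical
  constructor
  · intro hf
    induction hf using Submodule.span_induction with
    | mem r hr =>
      obtain ⟨k, hk, rfl⟩ := hr
      exact fun β hβ => X_pow_dvd_iff.mp dvd_rfl β (hβ k hk)
    | zero => simp
    | add r s _ _ hr hs => intro β hβ; rw [map_add, hr β hβ, hs β hβ, add_zero]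
    | smul t r _ hr =>
      intro β hβ
      rw [smul_eq_mul, coeff_mul]
      refine Finset.sum_eq_zero fun ij hij => ?_
      rw [hr ij.2 fun k hk => (Finsupp.le_def.mp
        (Finset.HasAntidiagonal.antidiagonal.snd_le hij) k).trans_lt (hβ k hk), mul_zero]
  · intro hf
    induction S using Finset.induction_on generalizing f with
    | empty =>
      have : f = 0 := by ext β; simpa using hf β (by simp)
      rw [this]; exact zero_mem _
    | insert k S hk ih =>
      set g : MvPowerSeries σ F := fun β => if q ≤ β k then coeff β f else 0 with hg
      have hg' : ∀ β, coeff β g = if q ≤ β k then coeff β f else 0 := fun β => rfl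
      have h1 : f - g ∈ Ideal.span ((fun k => (X k : MvPowerSeries σ F) ^ q) '' S) := by
        refine ih _ fun β hβ => ?_
        rw [map_sub, hg']
        split_ifs with h
        · rw [sub_self]
        · rw [sub_zero]
          refine hf β fun l hl => ?_
          rcases Finset.mem_insert.mp hl with rfl | hl
          · omega
          · exact hβ l hl
      have h2 : g ∈ Ideal.span ((fun k => (X k : MvPowerSeries σ F) ^ q) ''
          (insert k S : Finset σ)) := by
        refine Ideal.mem_of_dvd _ (X_pow_dvd_iff.mpr fun m hm => ?_)
          (Ideal.subset_span ⟨k, by simp, rfl⟩)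
        rw [hg', if_neg (by omega)]
      rw [← sub_add_cancel f g]
      exact add_mem (Ideal.span_mono (Set.image_mono (by simp)) h1) h2

lemma mem_span_range_X_pow_iff [Fintype σ] (q : ℕ) (f : MvPowerSeries σ F) :
    f ∈ Ideal.span (Set.range fun k => (X k : MvPowerSeries σ F) ^ q) ↔
      ∀ β : σ →₀ ℕ, (∀ k, β k < q) → coeff β f = 0 := by
  rw [← Set.image_univ, ← Finset.coe_univ, mem_span_X_pow_iff]
  simp

lemma revRegular_X_pow (n q : ℕ) :
    KProd.RevRegular fun k : Fin n => (X k : MvPowerSeries (Fin n) F) ^ q := by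
  intro k m hm
  have e : Set.Ioi k = ((Finset.Ioi k : Finset (Fin n)) : Set (Fin n)) := by simp
  rw [e, mem_span_X_pow_iff] at hm ⊢
  intro β hβ
  have := hm (Finsupp.single k q + β) fun l hl => by
    rw [Finsupp.add_apply, Finsupp.single_apply, if_neg (Finset.mem_Ioi.mp hl).ne, zero_add]
    exact hβ l hl
  beta_reduce at this
  rwa [X_pow_eq, coeff_add_monomial_mul, one_mul] at this

lemma span_range_X {F : Type v} [Field F] (n : ℕ) :
    Ideal.span (Set.range (X : Fin n → MvPowerSeries (Fin n) F)) =
      IsLocalRing.maximalIdeal (MvPowerSeries (Fin n) F) := by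
  have e : (X : Fin n → MvPowerSeries (Fin n) F) = fun k => X k ^ 1 := by simp
  ext f
  rw [e, mem_span_range_X_pow_iff, IsLocalRing.mem_maximalIdeal, mem_nonunits_iff,
    isUnit_iff_constantCoeff, isUnit_iff_ne_zero, not_not]
  constructor
  · intro h
    exact h 0 (by simp)
  · intro h β hβ
    have : β = 0 := by ext k; simpa using hβ k
    rw [this]; exact h

end Monomials

section Frobenius

variable {n : ℕ} {F : Type v} [Field F] (p : ℕ) [Fact p.Prime] [CharP F p] [PerfectRing F p]

omit [PerfectRing F p] in
lemma coeff_smul_pow (e : ℕ) (a : MvPowerSeries (Fin n) F) (m : Fin n →₀ ℕ) :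
    coeff (p ^ e • m) (a ^ p ^ e) = coeff m a ^ p ^ e := by
  rw [← map_iterateFrobenius_expand p (Nat.Prime.ne_zero Fact.out), coeff_map, coeff_expand_smul]
  rfl

omit [PerfectRing F p] in
lemma coeff_pow_of_not_dvd (e : ℕ) (a : MvPowerSeries (Fin n) F) {m : Fin n →₀ ℕ} {i : Fin n}
    (h : ¬ p ^ e ∣ m i) : coeff m (a ^ p ^ e) = 0 := by
  rw [← map_iterateFrobenius_expand p (Nat.Prime.ne_zero Fact.out), coeff_map,
    coeff_expand_of_not_dvd _ _ _ h, map_zero]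

/-- The `p ^ e`-th roots of the coefficients in a residue class of exponents. -/
noncomputable def rootPart (e : ℕ) (ε : Fin n →₀ ℕ) :
    MvPowerSeries (Fin n) F →+ MvPowerSeries (Fin n) F where
  toFun f := fun α => (iterateFrobeniusEquiv F p e).symm (coeff (p ^ e • α + ε) f)
  map_zero' := by
    ext α
    change (iterateFrobeniusEquiv F p e).symm (coeff _ 0) = _
    rw [map_zero, map_zero, map_zero]
  map_add' f g := by
    ext α
    change (iterateFrobeniusEquiv F p e).symm (coeff _ (f + g)) = _
    rw [map_add, map_add]; rfl

lemma coeff_rootPart (e : ℕ) (ε α : Fin n →₀ ℕ) (f : MvPowerSeries (Fin n) F) :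
    coeff α (rootPart p e ε f) =
      (iterateFrobeniusEquiv F p e).symm (coeff (p ^ e • α + ε) f) := rfl

lemma rootPart_pow_mul (e : ℕ) (ε : Fin n →₀ ℕ) (hε : ∀ i, ε i < p ^ e)
    (a f : MvPowerSeries (Fin n) F) :
    rootPart p e ε (a ^ p ^ e * f) = a * rootPart p e ε f := by
  classical
  have hp : 0 < p ^ e := pow_pos (Nat.Prime.pos Fact.out) e
  ext α
  rw [coeff_rootPart, RingEquiv.symm_apply_eq, coeff_mul, coeff_mul, map_sum]
  symm
  refine Finset.sum_of_injOn (fun ij => (p ^ e • ij.1, p ^ e • ij.2 + ε)) ?_ ?_ ?_ ?_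
  · rintro ⟨i, j⟩ _ ⟨i', j'⟩ _ h
    obtain ⟨h1, h2⟩ := Prod.mk.inj h
    have h2 := add_right_cancel h2
    refine Prod.ext ?_ ?_
    · ext k
      have := DFunLike.congr_fun h1 k
      exact Nat.eq_of_mul_eq_mul_left hp this
    · ext k
      have := DFunLike.congr_fun h2 k
      exact Nat.eq_of_mul_eq_mul_left hp this
  · rintro ⟨i, j⟩ h
    have h := Finset.HasAntidiagonal.mem_antidiagonal.mp h
    refine Finset.mem_coe.mpr (Finset.HasAntidiagonal.mem_antidiagonal.mpr ?_)
    change p ^ e • i + (p ^ e • j + ε) = _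
    rw [← h, smul_add, add_assoc]
  · rintro ⟨i, j⟩ h hn
    have h := Finset.HasAntidiagonal.mem_antidiagonal.mp h
    by_cases hd : ∀ k, p ^ e ∣ i k
    · exfalso
      choose i' hi' using hd
      refine hn ⟨(Finsupp.equivFunOnFinite.symm i', α - Finsupp.equivFunOnFinite.symm i'), ?_, ?_⟩
      · refine Finset.mem_coe.mpr (Finset.HasAntidiagonal.mem_antidiagonal.mpr ?_)
        refine add_tsub_cancel_of_le fun k => ?_
        have h := DFunLike.congr_fun h k
        simp only [Finsupp.add_apply, Finsupp.smul_apply, smul_eq_mul, hi'] at h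
        change i' k ≤ α k
        by_contra hk
        have : p ^ e * (α k + 1) ≤ p ^ e * i' k := Nat.mul_le_mul_left _ (by omega)
        have := hε k
        rw [mul_add] at *
        omega
      · have hi : i = p ^ e • Finsupp.equivFunOnFinite.symm i' := by ext k; simp [hi']
        refine Prod.ext hi.symm ?_
        change p ^ e • (α - Finsupp.equivFunOnFinite.symm i') + ε = j
        ext k
        have h := DFunLike.congr_fun h k
        simp only [Finsupp.add_apply, Finsupp.smul_apply, smul_eq_mul, hi', Finsupp.tsub_apply,
          Finsupp.equivFunOnFinite_symm_apply_apply] at h ⊢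
        have hk : i' k ≤ α k := by
          by_contra hk
          have : p ^ e * (α k + 1) ≤ p ^ e * i' k := Nat.mul_le_mul_left _ (by omega)
          have := hε k
          rw [mul_add] at *
          omega
        obtain ⟨t, ht⟩ := Nat.exists_eq_add_of_le hk
        rw [ht, Nat.add_sub_cancel_left]
        rw [ht, mul_add] at h
        omega
    · push Not at hd
      obtain ⟨k, hk⟩ := hd
      rw [coeff_pow_of_not_dvd p e a hk, zero_mul]
  · rintro ⟨i, j⟩ _
    rw [map_mul, coeff_rootPart, RingEquiv.apply_symm_apply, coeff_smul_pow]
    rfl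

lemma rootDetects_X (e : ℕ) :
    KProd.RootDetects (X : Fin n → MvPowerSeries (Fin n) F) (p ^ e) := by
  intro s hs
  have hp : 0 < p ^ e := pow_pos (Nat.Prime.pos Fact.out) e
  rw [mem_span_range_X_pow_iff]
  intro β hβ
  have := hs (rootPart p e β) (rootPart_pow_mul p e β hβ)
  rw [span_range_X, IsLocalRing.mem_maximalIdeal, mem_nonunits_iff,
    isUnit_iff_constantCoeff, isUnit_iff_ne_zero, not_not, ← coeff_zero_eq_constantCoeff_apply,
    coeff_rootPart, smul_zero, zero_add] at this
  simpa using this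

end Frobenius

end MvPowerSeries

namespace MvPowerSeries

section Duality

variable {n : ℕ} {K : Type v} [Field K] (N : ℕ)

/-- The ideal generated by the `(N + 1)`-st powers of the variables. -/
noncomputable def powIdeal (n : ℕ) (K : Type v) [Field K] (N : ℕ) :
    Ideal (MvPowerSeries (Fin n) K) :=
  Ideal.span (Set.range fun k => (X k : MvPowerSeries (Fin n) K) ^ (N + 1))

/-- The exponent of the socle monomial modulo `powIdeal`. -/
noncomputable def topExp (n N : ℕ) : Fin n →₀ ℕ := Finsupp.equivFunOnFinite.symm fun _ => N

lemma mem_powIdeal {f : MvPowerSeries (Fin n) K} :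
    f ∈ powIdeal n K N ↔ ∀ β, β ≤ topExp n N → coeff β f = 0 := by
  rw [powIdeal, mem_span_range_X_pow_iff]
  exact forall_congr' fun β => imp_congr_left (forall_congr' fun k => Nat.lt_succ_iff)

lemma coeff_monomial_mul_add {α β δ : Fin n →₀ ℕ} (h : α + β = topExp n N) (hδ : δ ≤ topExp n N)
    (a : K) (f : MvPowerSeries (Fin n) K) (hf : ∀ γ ≤ β, γ ≠ β → coeff γ f = 0)
    (hne : δ ≠ topExp n N) :
    coeff δ (monomial α a * f) = 0 := by
  rw [coeff_monomial_mul]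
  split_ifs with h'
  · obtain ⟨γ, rfl⟩ := exists_add_of_le h'
    rw [add_tsub_cancel_left, hf γ, mul_zero]
    · rw [← h] at hδ; exact le_of_add_le_add_left hδ
    · rintro rfl; exact hne h
  · rfl

/-- Every nonzero ideal modulo `powIdeal` contains the socle monomial. -/
lemma exists_mul_sub_mem_powIdeal {c : MvPowerSeries (Fin n) K} (hc : c ∉ powIdeal n K N) :
    ∃ t, t * c - monomial (topExp n N) 1 ∈ powIdeal n K N := by
  classical
  rw [mem_powIdeal] at hc
  push Not at hc
  obtain ⟨β, ⟨hβ, hβc⟩, hmin⟩ := WellFounded.has_min (wellFounded_lt (α := Fin n →₀ ℕ))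
    {β | β ≤ topExp n N ∧ coeff β c ≠ 0} hc
  obtain ⟨α, hα⟩ := exists_add_of_le hβ
  rw [add_comm] at hα
  refine ⟨monomial α (coeff β c)⁻¹, (mem_powIdeal N).mpr fun δ hδ => ?_⟩
  rw [map_sub, sub_eq_zero]
  by_cases hne : δ = topExp n N
  · rw [hne, coeff_monomial_same, hα, coeff_add_monomial_mul, inv_mul_cancel₀ hβc]
  · rw [coeff_monomial_ne hne]
    refine coeff_monomial_mul_add N hα.symm hδ _ _ (fun γ hγ hγβ => ?_) hne
    by_contra h
    exact hmin γ ⟨hγ.trans hβ, h⟩ (lt_of_le_of_ne hγ hγβ)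

/-- The quotient by `powIdeal` cogenerates the modules it annihilates. -/
theorem exists_linearMap_eq_top {M : Type*} [AddCommGroup M] [Module (MvPowerSeries (Fin n) K) M]
    (hM : ∀ t ∈ powIdeal n K N, ∀ m : M, t • m = 0) {v : M} (hv : v ≠ 0) :
    ∃ f : M →ₗ[MvPowerSeries (Fin n) K] MvPowerSeries (Fin n) K ⧸ powIdeal n K N,
      f v = Ideal.Quotient.mk _ (monomial (topExp n N) 1) := by
  classical
  let _ : Module K M := Module.compHom M (C : K →+* MvPowerSeries (Fin n) K)
  have hsmul : ∀ (c : K) (m : M), c • m = (C c : MvPowerSeries (Fin n) K) • m := fun _ _ => rfl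
  obtain ⟨g, hg⟩ : ∃ g : Module.Dual K M, g v ≠ 0 := by
    by_contra! h
    exact hv ((Module.forall_dual_apply_eq_zero_iff K v).mp h)
  let F : M → MvPowerSeries (Fin n) K := fun m β =>
    if β ≤ topExp n N then g ((monomial (topExp n N - β) 1 : MvPowerSeries (Fin n) K) • m) else 0
  have hF : ∀ m β, β ≤ topExp n N →
      coeff β (F m) = g ((monomial (topExp n N - β) 1 : MvPowerSeries (Fin n) K) • m) :=
    fun m β h => if_pos h
  have hadd : ∀ m m', F (m + m') - (F m + F m') ∈ powIdeal n K N := fun m m' =>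
    (mem_powIdeal N).mpr fun β hβ => by
      rw [map_sub, map_add, hF _ _ hβ, hF _ _ hβ, hF _ _ hβ, smul_add, map_add, sub_self]
  have hsm : ∀ t m, F (t • m) - t * F m ∈ powIdeal n K N := fun t m =>
    (mem_powIdeal N).mpr fun β hβ => by
      rw [map_sub, hF _ _ hβ, coeff_mul, sub_eq_zero]
      have h1 : ∀ ij ∈ Finset.HasAntidiagonal.antidiagonal β, coeff ij.1 t * coeff ij.2 (F m) =
          g ((monomial (topExp n N - β) 1 * monomial ij.1 (coeff ij.1 t) :
            MvPowerSeries (Fin n) K) • m) := by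
        rintro ⟨i, j⟩ hij
        rw [Finset.HasAntidiagonal.mem_antidiagonal] at hij
        subst hij
        have hj : j ≤ topExp n N := le_trans le_add_self hβ
        rw [hF _ _ hj, monomial_mul_monomial, one_mul]
        have e : topExp n N - (i + j) + i = topExp n N - j := by
          ext k
          have := hβ k
          simp only [Finsupp.add_apply, Finsupp.tsub_apply] at this ⊢
          omega
        rw [e, ← smul_eq_mul, ← map_smul, hsmul, smul_smul, ← monomial_zero_eq_C_apply,
          monomial_mul_monomial, zero_add, mul_one]
      rw [Finset.sum_congr rfl h1, ← map_sum, ← Finset.sum_smul, ← Finset.mul_sum, smul_smul,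
        ← sub_eq_zero, ← map_sub, ← sub_smul, ← mul_sub, hM _ _ m, map_zero]
      refine (mem_powIdeal N).mpr fun δ hδ => ?_
      rw [coeff_monomial_mul]
      split_ifs with h
      · have hle : δ - (topExp n N - β) ≤ β := fun k => by
          have := hδ k
          have := hβ k
          simp only [Finsupp.tsub_apply] at *
          omega
        rw [map_sub, map_sum, one_mul, sub_eq_zero,
          Finset.sum_eq_single (δ - (topExp n N - β), β - (δ - (topExp n N - β)))]
        · rw [coeff_monomial_same]
        · rintro ⟨i, j⟩ hij hne
          rw [coeff_monomial_ne]
          rintro rfl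
          refine hne (Prod.ext rfl ?_)
          exact eq_tsub_of_add_eq
            ((add_comm _ _).trans (Finset.HasAntidiagonal.mem_antidiagonal.mp hij))
        · intro h
          exact absurd (Finset.HasAntidiagonal.mem_antidiagonal.mpr (add_tsub_cancel_of_le hle)) h
      · rfl
  let f : M →ₗ[MvPowerSeries (Fin n) K] MvPowerSeries (Fin n) K ⧸ powIdeal n K N :=
    { toFun := fun m => Ideal.Quotient.mk _ (F m)
      map_add' := fun m m' => by
        rw [← map_add]; exact Ideal.Quotient.eq.mpr (hadd m m')
      map_smul' := fun t m => by
        rw [RingHom.id_apply]; exact Ideal.Quotient.eq.mpr (hsm t m) }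
  have hfv : F v ∉ powIdeal n K N := fun h => by
    have := (mem_powIdeal N).mp h (topExp n N) le_rfl
    rw [hF _ _ le_rfl, tsub_self] at this
    exact hg (by simpa [monomial_zero_one] using this)
  obtain ⟨t, ht⟩ := exists_mul_sub_mem_powIdeal N hfv
  exact ⟨t • f, Ideal.Quotient.eq.mpr ht⟩

/-- A double annihilator property modulo `powIdeal`. -/
theorem mem_of_forall_mul_mem {J : Ideal (MvPowerSeries (Fin n) K)} {a : MvPowerSeries (Fin n) K}
    (h : ∀ ρ, (∀ r ∈ J, r * ρ ∈ powIdeal n K N) → a * ρ ∈ powIdeal n K N) :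
    a ∈ J ⊔ powIdeal n K N := by
  by_contra ha
  obtain ⟨f, hf⟩ := exists_linearMap_eq_top (n := n) (K := K) N
    (M := MvPowerSeries (Fin n) K ⧸ (J ⊔ powIdeal n K N))
    (fun t ht m => by
      obtain ⟨m, rfl⟩ := Ideal.Quotient.mk_surjective m
      exact Ideal.Quotient.eq_zero_iff_mem.mpr (Ideal.mul_mem_right _ _ (Ideal.mem_sup_right ht)))
    (v := Ideal.Quotient.mk _ a) (fun h => ha (Ideal.Quotient.eq_zero_iff_mem.mp h))
  obtain ⟨ρ, hρ⟩ := Ideal.Quotient.mk_surjective (f 1)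
  have key : ∀ r, f (Ideal.Quotient.mk _ r) = Ideal.Quotient.mk _ (r * ρ) := by
    intro r
    have e : Ideal.Quotient.mk (J ⊔ powIdeal n K N) r = r • 1 := by
      rw [Algebra.smul_def, mul_one]; rfl
    rw [e, map_smul, ← hρ]; rfl
  have := h ρ fun r hr => by
    rw [← Ideal.Quotient.eq_zero_iff_mem, ← key,
      Ideal.Quotient.eq_zero_iff_mem.mpr (Ideal.mem_sup_left hr), map_zero]
  rw [← Ideal.Quotient.eq_zero_iff_mem, ← key, hf, Ideal.Quotient.eq_zero_iff_mem,
    mem_powIdeal] at this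
  simpa [coeff_monomial_same] using this _ le_rfl

end Duality
end MvPowerSeries

section Krull

variable {A : Type v} [CommRing A] [IsLocalRing A] [IsNoetherianRing A]

lemma Ideal.mem_of_forall_mem_sup_pow {M : Type*} [AddCommGroup M] [Module A M] [Module.Finite A M]
    {W : Submodule A M} {v : M}
    (h : ∀ k, v ∈ W ⊔ (IsLocalRing.maximalIdeal A ^ k) • (⊤ : Submodule A M)) : v ∈ W := by
  rw [← Submodule.Quotient.mk_eq_zero, ← Submodule.mem_bot A, ←
    Ideal.iInf_pow_smul_eq_bot_of_isLocalRing (IsLocalRing.maximalIdeal A)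
      (Ideal.IsPrime.ne_top' (I := IsLocalRing.maximalIdeal A)), Submodule.mem_iInf]
  intro k
  have : Submodule.map W.mkQ (W ⊔ (IsLocalRing.maximalIdeal A ^ k) • (⊤ : Submodule A M)) ≤
      IsLocalRing.maximalIdeal A ^ k • ⊤ := by
    rw [Submodule.map_sup, Submodule.map_smul'', Submodule.mkQ_map_self, bot_sup_eq]
    exact Submodule.smul_mono le_rfl le_top
  exact this ⟨v, h k, rfl⟩

lemma Ideal.mem_of_forall_mem_sup_pow' {J : Ideal A} {a : A}
    (h : ∀ k, a ∈ J ⊔ IsLocalRing.maximalIdeal A ^ k) : a ∈ J :=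
  Ideal.mem_of_forall_mem_sup_pow (W := J) fun k => by
    rw [smul_eq_mul, Ideal.mul_top]; exact h k

end Krull

namespace MvPowerSeries

lemma powIdeal_le_pow (n : ℕ) (K : Type v) [Field K] (N : ℕ) :
    powIdeal n K N ≤ IsLocalRing.maximalIdeal (MvPowerSeries (Fin n) K) ^ (N + 1) := by
  rw [powIdeal, Ideal.span_le, ← span_range_X]
  rintro _ ⟨k, rfl⟩
  exact Ideal.pow_mem_pow (Ideal.subset_span (Set.mem_range_self k)) _

/-- The canonical element theorem for a linkage class over a power series ring of
characteristic `p`. -/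
theorem wedges_mem_bdry_of_charP {n d p : ℕ} {F : Type v} [Field F] [Fact p.Prime] [CharP F p]
    [PerfectRing F p] {v : ℕ → Fin n → MvPowerSeries (Fin n) F} {y : ℕ → MvPowerSeries (Fin n) F}
    (hv : ∀ j < d, ∑ k, v j k * X k = y j)
    (hy : ∀ j < d, ∀ r, y j * r ∈ KProd.initIdeal y j → r ∈ KProd.initIdeal y j)
    {ι : Type*} {b : ι → MvPowerSeries (Fin n) F} {𝔞 : Ideal (MvPowerSeries (Fin n) F)}
    (mem𝔞 : ∀ a, a ∈ 𝔞 ↔ ∀ i, a * b i ∈ KProd.initIdeal y d)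
    {a : MvPowerSeries (Fin n) F} (ha : a ∈ 𝔞) (ha' : a ∉ KProd.initIdeal y d) :
    KProd.wedges v d ∈ KProd.bdry X 𝔞 := by
  by_contra hz
  have : CharP (MvPowerSeries (Fin n) F) p :=
    charP_of_injective_ringHom (f := (C : F →+* MvPowerSeries (Fin n) F)) C_injective p
  refine ha' (Ideal.mem_of_forall_mem_sup_pow' fun k => ?_)
  have hp : 1 < p := Nat.Prime.one_lt Fact.out
  obtain ⟨q, hq⟩ : ∃ q, q + 1 = p ^ k :=
    ⟨p ^ k - 1, Nat.sub_add_cancel (Nat.one_le_pow _ _ (by omega))⟩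
  have hk : k ≤ q + 1 := hq ▸ (Nat.lt_pow_self hp).le
  refine sup_le_sup le_rfl ((powIdeal_le_pow n F q).trans (Ideal.pow_le_pow_right hk)) ?_
  refine mem_of_forall_mul_mem q fun ρ hρ => ?_
  exact KProd.mul_mem_of_wedges_notMem (p := p) (span_range_X n) ⟨k, hq⟩ (revRegular_X_pow n _)
    (hq ▸ rootDetects_X p k) hv hy mem𝔞 hz (fun j hj => hρ _ (KProd.mem_initIdeal y hj))
    ((mem𝔞 a).mp ha)

end MvPowerSeries

/-- A map on generators that respects all relations extends to a ring homomorphism. -/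
theorem Subring.exists_closure_ringHom {T T' : Type*} [CommRing T] [CommRing T'] {S : Set T}
    (e : S → T') (he : ∀ q : MvPolynomial S ℤ,
      MvPolynomial.eval₂Hom (Int.castRingHom T) ((↑) : S → T) q = 0 →
      MvPolynomial.eval₂Hom (Int.castRingHom T') e q = 0) :
    ∃ Φ : Subring.closure S →+* T', ∀ s : S, Φ ⟨s, Subring.subset_closure s.2⟩ = e s := by
  let A : MvPolynomial S ℤ →+* Subring.closure S :=
    MvPolynomial.eval₂Hom (Int.castRingHom _) fun s => ⟨s, Subring.subset_closure s.2⟩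
  have hA : (Subring.closure S).subtype.comp A =
      MvPolynomial.eval₂Hom (Int.castRingHom T) ((↑) : S → T) := by
    ext <;> simp [A]
  have hsurj : Function.Surjective A := by
    rintro ⟨x, hx⟩
    have : Subring.closure S ≤ ((Subring.closure S).subtype.comp A).range := by
      rw [Subring.closure_le]
      intro s hs
      exact ⟨MvPolynomial.X ⟨s, hs⟩, by simp [A]⟩
    obtain ⟨q, hq⟩ := this hx
    exact ⟨q, Subtype.ext hq⟩
  have hk : ∀ q ∈ RingHom.ker A, MvPolynomial.eval₂Hom (Int.castRingHom T') e q = 0 := by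
    intro q hq
    refine he q ?_
    rw [← hA, RingHom.comp_apply, RingHom.mem_ker.mp hq, map_zero]
  refine ⟨A.liftOfSurjective hsurj ⟨MvPolynomial.eval₂Hom (Int.castRingHom T') e, hk⟩,
    fun s => ?_⟩
  have := RingHom.liftOfRightInverse_comp_apply A _ (Function.rightInverse_surjInv hsurj)
    ⟨MvPolynomial.eval₂Hom (Int.castRingHom T') e, hk⟩ (MvPolynomial.X s)
  simpa [A] using this

/-- A ring generated by fractions maps to any ring to which the fractions specialise. -/
theorem Subring.exists_closure_ringHom_of_fractions {B T T' : Type*} [CommRing B] [CommRing T]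
    [IsDomain T] [CommRing T'] [IsDomain T'] (f : B →+* T) (f' : B →+* T')
    (hker : ∀ b, f b = 0 → f' b = 0) {g : B} (hg : f' g ≠ 0) {S : Set T} (G : S → B)
    (hG : ∀ s, f g * s = f (G s)) (e : S → T') (he : ∀ s, f' g * e s = f' (G s)) :
    ∃ Φ : Subring.closure S →+* T', ∀ s : S, Φ ⟨s, Subring.subset_closure s.2⟩ = e s := by
  have key : ∀ q : MvPolynomial S ℤ, ∃ N : ℕ, ∃ Q : B,
      f g ^ N * MvPolynomial.eval₂Hom (Int.castRingHom T) ((↑) : S → T) q = f Q ∧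
        f' g ^ N * MvPolynomial.eval₂Hom (Int.castRingHom T') e q = f' Q := by
    intro q
    induction q using MvPolynomial.induction_on with
    | C a => exact ⟨0, a, by simp, by simp⟩
    | add p q hp hq =>
      obtain ⟨N, P, h1, h2⟩ := hp
      obtain ⟨M, Q, h3, h4⟩ := hq
      refine ⟨N + M, g ^ M * P + g ^ N * Q, ?_, ?_⟩
      · simp only [map_add, map_mul, map_pow, ← h1, ← h3]; ring
      · simp only [map_add, map_mul, map_pow, ← h2, ← h4]; ring
    | mul_X p s hp =>
      obtain ⟨N, P, h1, h2⟩ := hp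
      refine ⟨N + 1, P * G s, ?_, ?_⟩
      · rw [map_mul, map_mul, ← h1, ← hG, MvPolynomial.coe_eval₂Hom, MvPolynomial.eval₂_X]; ring
      · rw [map_mul, map_mul, ← h2, ← he, MvPolynomial.coe_eval₂Hom, MvPolynomial.eval₂_X]; ring
  refine Subring.exists_closure_ringHom e fun q hq => ?_
  obtain ⟨N, Q, h1, h2⟩ := key q
  rw [hq, mul_zero] at h1
  rw [hker Q h1.symm] at h2
  exact (mul_eq_zero.mp h2).resolve_left (pow_ne_zero _ hg)

section Primitive

attribute [local instance] FractionRing.liftAlgebra in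
theorem Algebra.exists_integral_primitive (B C : Type*) [CommRing B] [IsDomain B] [CharZero B]
    [CommRing C] [IsDomain C] [Algebra B C] [FaithfulSMul B C] [Algebra.IsAlgebraic B C]
    [Algebra.FiniteType B C] :
    ∃ θ : C, IsIntegral B θ ∧ ∀ c : C, ∃ g : B, g ≠ 0 ∧ ∃ G : Polynomial B,
      g • c = Polynomial.aeval θ G := by
  let k := FractionRing B
  let L := FractionRing C
  have : CharZero k := charZero_of_injective_algebraMap (IsFractionRing.injective B k)
  have : Algebra.IsAlgebraic k L := Algebra.IsPushout.isAlgebraic B C k L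
  have : Algebra.EssFiniteType B L := .comp B C L
  have : Algebra.EssFiniteType k L := .of_comp B k L
  have : FiniteDimensional k L := by
    obtain ⟨s, hs⟩ := IntermediateField.fg_top_iff.mpr ‹Algebra.EssFiniteType k L›
    have := IntermediateField.finiteDimensional_adjoin (K := k) (L := L) (S := s)
      (fun x _ => Algebra.IsIntegral.isIntegral x)
    rw [hs] at this
    exact IntermediateField.topEquiv.toLinearEquiv.finiteDimensional
  obtain ⟨θ₀, hθ₀⟩ := Field.exists_primitive_element k L
  obtain ⟨⟨c₁, _, b, hb, rfl⟩, h₁⟩ := IsLocalization.surj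
    (Algebra.algebraMapSubmonoid C (nonZeroDivisors B)) θ₀
  replace h₁ : θ₀ * algebraMap C L (algebraMap B C b) = algebraMap C L c₁ := h₁
  obtain ⟨b', hb', h₂⟩ := (Algebra.IsAlgebraic.isAlgebraic (R := B) c₁).exists_integral_multiple
  have hbb : algebraMap B k (b' * b) ≠ 0 := by
    rw [Ne, IsFractionRing.to_map_eq_zero_iff]
    exact mul_ne_zero hb' (nonZeroDivisors.ne_zero hb)
  have hθ : algebraMap C L (b' • c₁) = algebraMap B k (b' * b) • θ₀ := by
    rw [algebraMap_smul, Algebra.smul_def, map_mul, ← h₁, Algebra.smul_def, map_mul,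
      IsScalarTower.algebraMap_apply B C L, IsScalarTower.algebraMap_apply B C L]
    ring
  refine ⟨b' • c₁, h₂, fun c => ?_⟩
  have htop : IntermediateField.adjoin k {algebraMap C L (b' • c₁)} = ⊤ := by
    refine top_unique (hθ₀.symm.trans_le (IntermediateField.adjoin_simple_le_iff.mpr ?_))
    have : θ₀ = (algebraMap B k (b' * b))⁻¹ • algebraMap C L (b' • c₁) := by
      rw [hθ, smul_smul, inv_mul_cancel₀ hbb, one_smul]
    rw [this]
    exact IntermediateField.smul_mem _ (IntermediateField.mem_adjoin_simple_self _ _)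
  have hmem : algebraMap C L c ∈ Algebra.adjoin k {algebraMap C L (b' • c₁)} := by
    rw [← IntermediateField.adjoin_simple_toSubalgebra_of_isAlgebraic
      (Algebra.IsAlgebraic.isAlgebraic _), htop]
    trivial
  rw [Algebra.adjoin_singleton_eq_range_aeval] at hmem
  obtain ⟨G, hG⟩ := hmem
  obtain ⟨e, he₀, he⟩ := IsLocalization.integerNormalization_spec (nonZeroDivisors B) G
  refine ⟨e, nonZeroDivisors.ne_zero he₀, IsLocalization.integerNormalization (nonZeroDivisors B) G,
    IsFractionRing.injective C L ?_⟩
  have h3 := congrArg (Polynomial.aeval (algebraMap C L (b' • c₁))) he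
  rw [Polynomial.aeval_map_algebraMap, Polynomial.aeval_algebraMap_apply,
    ← algebraMap_smul k e G, map_smul] at h3
  rw [h3, Algebra.smul_def, map_mul, ← IsScalarTower.algebraMap_apply B C L, algebraMap_smul,
    Algebra.smul_def]
  congr 1
  exact hG.symm

end Primitive

/-- A contraction `a ↦ t • φ(a)` given by a polynomial `φ` and `t ∈ I` has a fixed point in an
`I`-adically complete ring. -/
theorem IsAdicComplete.exists_eq_mul_eval {S : Type*} [CommRing S] (I : Ideal S)
    [IsAdicComplete I S] {t : S} (ht : t ∈ I) (φ : Polynomial S) : ∃ a, a = t * φ.eval a := by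
  let a : ℕ → S := fun n => (fun a => t * φ.eval a)^[n] 0
  have hs : ∀ n, a (n + 1) = t * φ.eval (a n) := fun n =>
    Function.iterate_succ_apply' _ _ _
  have hd : ∀ n, a (n + 1) - a n ∈ I ^ n := by
    intro n
    induction n with
    | zero => simp
    | succ n ih =>
      rw [hs (n + 1)]
      nth_rewrite 2 [hs n]
      rw [← mul_sub, pow_succ']
      exact Ideal.mul_mem_mul ht (Ideal.mem_of_dvd _ (Polynomial.sub_dvd_eval_sub _ _ _) ih)
  have hc : ∀ {m n}, m ≤ n → a m ≡ a n [SMOD (I ^ m • ⊤ : Submodule S S)] := by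
    intro m n hmn
    induction n, hmn using Nat.le_induction with
    | base => rfl
    | succ n hmn ih =>
      refine ih.trans (SModEq.symm (SModEq.sub_mem.mpr ?_))
      simpa using Ideal.pow_le_pow_right hmn (hd n)
  obtain ⟨L, hL⟩ := IsPrecomplete.prec ‹IsAdicComplete I S›.toIsPrecomplete hc
  refine ⟨L, sub_eq_zero.mp (IsHausdorff.haus ‹IsAdicComplete I S›.toIsHausdorff _ fun n => ?_)⟩
  have h : ∀ n, a n - L ∈ I ^ n := fun n => by simpa using SModEq.sub_mem.mp (hL n)
  rw [SModEq.zero, smul_eq_mul, Ideal.mul_top]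
  have h1 : L - t * φ.eval L = t * (φ.eval (a n) - φ.eval L) - (a (n + 1) - L) := by
    rw [hs]; ring
  rw [h1]
  exact sub_mem (Ideal.mul_mem_left _ _
    (Ideal.mem_of_dvd _ (Polynomial.sub_dvd_eval_sub _ _ _) (h n)))
    (Ideal.pow_le_pow_right n.le_succ (h (n + 1)))

/-- Newton's lemma: an approximate root modulo `P'(a)² I²` is close to a root. -/
theorem IsAdicComplete.exists_root_of_sq_dvd {S : Type*} [CommRing S] (I : Ideal S)
    [IsAdicComplete I S] (P : Polynomial S) (a : S) {h : S} (hh : h ∈ I)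
    (hP : (P.derivative.eval a * h) ^ 2 ∣ P.eval a) :
    ∃ b, P.eval b = 0 ∧ P.derivative.eval a * h ∣ b - a := by
  obtain ⟨c, hc⟩ := hP
  obtain ⟨k, hk⟩ := (P.map Polynomial.C).binomExpansion (Polynomial.C a)
    (Polynomial.C (P.derivative.eval a * h) * Polynomial.X)
  obtain ⟨z, hz⟩ := IsAdicComplete.exists_eq_mul_eval I hh
    (-(Polynomial.C c + k * Polynomial.X ^ 2))
  refine ⟨a + P.derivative.eval a * h * z, ?_, by simp⟩
  have h2 := congrArg (Polynomial.eval z) hk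
  simp only [Polynomial.eval_add, Polynomial.eval_mul, Polynomial.eval_pow, Polynomial.eval_C,
    Polynomial.eval_X, Polynomial.eval_map, Polynomial.derivative_map] at h2
  have h3 : ∀ (Q : Polynomial S) (q : Polynomial S),
      Polynomial.eval z (Polynomial.eval₂ Polynomial.C q Q) = Q.eval (q.eval z) := by
    intro Q q
    rw [← Polynomial.comp, Polynomial.eval_comp]
  rw [h3, h3, h3] at h2
  simp only [Polynomial.eval_add, Polynomial.eval_mul, Polynomial.eval_C,
    Polynomial.eval_X] at h2
  rw [h2, hc]
  simp only [Polynomial.eval_neg, Polynomial.eval_add, Polynomial.eval_mul, Polynomial.eval_pow,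
    Polynomial.eval_C, Polynomial.eval_X] at hz
  linear_combination (P.derivative.eval a ^ 2 * h) * hz

/-- Specialising coefficients modulo a distinguished polynomial: a homomorphism `ψ` on a ring `C`
of coefficients induces one on rings generated by power series that are congruent to polynomials
with coefficients in `C`. -/
theorem Polynomial.IsDistinguishedAt.exists_closure_ringHom {A A' C : Type v} [CommRing A]
    [CommRing A'] [CommRing C] {I : Ideal A} [IsAdicComplete I A] (j : C →+* A)
    (hj : Function.Injective j) (ψ : C →+* A') {W : Polynomial C}
    (hWm : W.Monic) (hW : (W.map j).IsDistinguishedAt I) {S : Set (PowerSeries A)}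
    (r : S → Polynomial C)
    (hr : ∀ s : S, ((s : PowerSeries A) - ((r s).map j : Polynomial A)) ∈
      Ideal.span {((W.map j : Polynomial A) : PowerSeries A)}) :
    ∃ χ : Subring.closure S →+*
        PowerSeries A' ⧸ Ideal.span {((W.map ψ : Polynomial A') : PowerSeries A')},
      ∀ s : S, χ ⟨s, Subring.subset_closure s.2⟩ =
        Ideal.Quotient.mk _ (((r s).map ψ : Polynomial A') : PowerSeries A') := by
  refine Subring.exists_closure_ringHom (fun s : S => Ideal.Quotient.mk
    (Ideal.span {((W.map ψ : Polynomial A') : PowerSeries A')})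
    (((r s).map ψ : Polynomial A') : PowerSeries A')) fun q hq => ?_
  let H : ∀ {B : Type v} [CommRing B], (S → B) → MvPolynomial S ℤ →+* B :=
    fun {B} _ => MvPolynomial.eval₂Hom (Int.castRingHom B)
  have hH : ∀ {B B' : Type v} [CommRing B] [CommRing B'] (f : S → B) (θ : B →+* B'),
      H (fun s => θ (f s)) q = θ (H f q) := by
    intro B B' _ _ f θ
    simp only [H]
    rw [MvPolynomial.map_eval₂Hom]
    congr 2
    exact Subsingleton.elim _ _
  have hmap : ∀ {B : Type v} [CommRing B] (φ : C →+* B),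
      H (fun s : S => Ideal.Quotient.mk
        (Ideal.span {((W.map φ : Polynomial B) : PowerSeries B)})
        (((r s).map φ : Polynomial B) : PowerSeries B)) q =
      Ideal.Quotient.mk _ (((H r q).map φ : Polynomial B) : PowerSeries B) := fun {B} _ φ =>
    hH r ((Ideal.Quotient.mk _).comp (Polynomial.coeToPowerSeries.ringHom.comp
        (Polynomial.mapRingHom φ)))
  have hmod : H (fun s : S => Ideal.Quotient.mk
        (Ideal.span {((W.map j : Polynomial A) : PowerSeries A)})
        (((r s).map j : Polynomial A) : PowerSeries A)) q = 0 := by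
    have : (fun s : S => Ideal.Quotient.mk
        (Ideal.span {((W.map j : Polynomial A) : PowerSeries A)})
        (((r s).map j : Polynomial A) : PowerSeries A)) = fun s : S =>
        (Ideal.Quotient.mk _) (s : PowerSeries A) :=
      _root_.funext fun s => (Ideal.Quotient.eq.mpr (hr s)).symm
    rw [this, hH]
    exact (congrArg _ hq).trans (map_zero _)
  rw [hmap j] at hmod
  refine (hmap ψ).trans ?_
  let Q := H r q
  have h1 : Ideal.Quotient.mk (Ideal.span {W.map j}) (Q.map j) = 0 := by
    apply hW.algEquivQuotient.injective
    rw [map_zero, ← hmod]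
    rfl
  rw [Ideal.Quotient.eq_zero_iff_mem, Ideal.mem_span_singleton] at h1
  have h2 : W ∣ Q := by
    rwa [Polynomial.map_dvd_map j hj hWm] at h1
  obtain ⟨Q', hQ'⟩ := h2
  rw [Ideal.Quotient.eq_zero_iff_mem, Ideal.mem_span_singleton]
  refine ⟨((Q'.map ψ : Polynomial A') : PowerSeries A'), ?_⟩
  rw [← Polynomial.coe_mul, ← Polynomial.map_mul, ← hQ']

namespace MvPowerSeries

section Shear

variable {n : ℕ} (K : Type*) [CommRing K]

/-- The variables after the linear change of coordinates `X (i + 1) ↦ X (i + 1) + l i • X 0`. -/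
noncomputable def shearVars (l : Fin n → ℤ) : Fin (n + 1) → MvPowerSeries (Fin (n + 1)) K :=
  Fin.cons (X 0) fun i => X i.succ + (l i : MvPowerSeries (Fin (n + 1)) K) * X 0

theorem hasSubst_shearVars (l : Fin n → ℤ) : HasSubst (shearVars K l) :=
  hasSubst_of_constantCoeff_zero fun i => by
    refine Fin.cases ?_ (fun i => ?_) i <;> simp [shearVars]

theorem subst_shearVars_neg (l : Fin n → ℤ) (f : MvPowerSeries (Fin (n + 1)) K) :
    subst (shearVars K (-l)) (subst (shearVars K l) f) = f := by
  rw [subst_comp_subst_apply (hasSubst_shearVars K l) (hasSubst_shearVars K (-l))]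
  have : (fun s => subst (shearVars K (-l)) (shearVars K l s)) = X := by
    funext s
    rw [← coe_substAlgHom (hasSubst_shearVars K (-l))]
    refine Fin.cases ?_ (fun i => ?_) s
    · simp only [shearVars, Fin.cons_zero, substAlgHom_X]
    · simp only [shearVars, Fin.cons_succ, map_add, map_mul, map_intCast, substAlgHom_X,
        Fin.cons_zero, Pi.neg_apply, Int.cast_neg]
      ring
  rw [this, subst_self, id]

/-- The linear change of coordinates `X (i + 1) ↦ X (i + 1) + l i • X 0`, with values in power
series in `X 0`. -/
noncomputable def shear (l : Fin n → ℤ) :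
    MvPowerSeries (Fin (n + 1)) K ≃+* PowerSeries (MvPowerSeries (Fin n) K) :=
  (RingEquiv.ofRingHom
    (substAlgHom (R := K) (hasSubst_shearVars K l)).toRingHom
    (substAlgHom (R := K) (hasSubst_shearVars K (-l))).toRingHom
    (RingHom.ext fun f => by
      have := subst_shearVars_neg K (-l) f
      rw [neg_neg] at this
      simpa [substAlgHom_apply] using this)
    (RingHom.ext fun f => by
      simpa [substAlgHom_apply] using subst_shearVars_neg K l f)).trans
    (finSuccEquiv K n).toRingEquiv

theorem shear_apply (l : Fin n → ℤ) (f : MvPowerSeries (Fin (n + 1)) K) :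
    shear K l f = finSuccEquiv K n (subst (shearVars K l) f) := by
  simp [shear, RingEquiv.ofRingHom]

theorem shear_X_zero (l : Fin n → ℤ) : shear K l (X 0) = PowerSeries.X := by
  rw [shear_apply, subst_X (hasSubst_shearVars K l)]
  simp [shearVars]

theorem shear_X_succ (l : Fin n → ℤ) (i : Fin n) :
    shear K l (X i.succ) = PowerSeries.C (X i) + (l i : PowerSeries (MvPowerSeries (Fin n) K)) *
      PowerSeries.X := by
  rw [shear_apply, subst_X (hasSubst_shearVars K l)]
  simp [shearVars]

theorem constantCoeff_coeff_shear (l : Fin n → ℤ) (f : MvPowerSeries (Fin (n + 1)) K) (h : ℕ) :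
    constantCoeff (PowerSeries.coeff h (shear K l f)) =
      ∑ α ∈ Finset.univ.finsuppAntidiag h, coeff α f * ∏ i : Fin n, (l i : K) ^ α i.succ := by
  rw [shear_apply, ← coeff_zero_eq_constantCoeff_apply, coeff_coeff_finSuccEquiv,
    coeff_subst (hasSubst_shearVars K l)]
  have key : ∀ α : Fin (n + 1) →₀ ℕ,
      coeff (Finsupp.cons h 0) (α.prod fun s e => shearVars K l s ^ e) =
        if α ∈ Finset.univ.finsuppAntidiag h then ∏ i : Fin n, (l i : K) ^ α i.succ else 0 := by
    intro α
    let ρ : MvPowerSeries (Fin (n + 1)) K →+* PowerSeries K :=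
      (PowerSeries.map constantCoeff).comp (finSuccEquiv K n).toRingEquiv.toRingHom
    have h1 : ∀ g, coeff (Finsupp.cons h 0) g = PowerSeries.coeff h (ρ g) := by
      intro g
      simp [ρ, ← coeff_zero_eq_constantCoeff_apply, coeff_coeff_finSuccEquiv]
    have h2 : ρ (α.prod fun s e => shearVars K l s ^ e) =
        PowerSeries.C (∏ i : Fin n, (l i : K) ^ α i.succ) * PowerSeries.X ^ (∑ s, α s) := by
      rw [Finsupp.prod_fintype _ _ (fun _ => pow_zero _), map_prod, Fin.prod_univ_succ,
        Fin.sum_univ_succ, pow_add, ← Finset.prod_pow_eq_pow_sum, map_prod]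
      have h3 : ρ (shearVars K l 0 ^ α 0) = PowerSeries.X ^ α 0 := by
        simp [ρ, shearVars]
      have h4 : ∀ i : Fin n, ρ (shearVars K l i.succ ^ α i.succ) =
          PowerSeries.C ((l i : K) ^ α i.succ) * PowerSeries.X ^ α i.succ := by
        intro i
        simp [ρ, shearVars, mul_pow]
      rw [h3, Finset.prod_congr rfl fun i _ => h4 i, Finset.prod_mul_distrib]
      ring
    rw [h1, h2, PowerSeries.coeff_C_mul_X_pow]
    simp [Finset.mem_finsuppAntidiag, eq_comm]
  rw [finsum_eq_sum_of_support_subset (s := Finset.univ.finsuppAntidiag h)]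
  · refine Finset.sum_congr rfl fun α hα => ?_
    rw [key, if_pos hα, smul_eq_mul]
  · intro α hα
    by_contra hc
    refine hα ?_
    dsimp only
    rw [key, if_neg (by simpa using hc), smul_zero]

end Shear

/-- A nonzero power series becomes regular in `X 0` after a suitable change of coordinates. -/
theorem exists_isUnit_coeff_shear {n : ℕ} {K : Type*} [Field K] [CharZero K]
    {f : MvPowerSeries (Fin (n + 1)) K} (hf : f ≠ 0) :
    ∃ (l : Fin n → ℤ) (h : ℕ), IsUnit (PowerSeries.coeff h (shear K l f)) := by
  obtain ⟨α, hα⟩ : ∃ α, coeff α f ≠ 0 := by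
    by_contra! hc
    exact hf (ext fun α => by simpa using hc α)
  let h := ∑ s, α s
  let g : MvPolynomial (Fin n) K := ∑ β ∈ Finset.univ.finsuppAntidiag h,
    MvPolynomial.monomial β.tail (coeff β f)
  have hg : g ≠ 0 := by
    intro h0
    apply hα
    have h1 : MvPolynomial.coeff α.tail g = coeff α f := by
      simp only [g, MvPolynomial.coeff_sum, MvPolynomial.coeff_monomial]
      rw [Finset.sum_eq_single α, if_pos rfl]
      · intro β hβ hne
        rw [if_neg]
        intro htail
        apply hne
        have h2 : ∑ s, β s = ∑ s, α s := by simpa [Finset.mem_finsuppAntidiag, h] using hβ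
        have h3 : ∀ i : Fin n, β i.succ = α i.succ := fun i => by
          exact DFunLike.congr_fun htail i
        rw [Fin.sum_univ_succ, Fin.sum_univ_succ, Finset.sum_congr rfl fun i _ => h3 i] at h2
        ext s
        refine Fin.cases (by omega) h3 s
      · intro hn
        exact absurd (by simp [Finset.mem_finsuppAntidiag, h]) hn
    rw [← h1, h0, MvPolynomial.coeff_zero]
  obtain ⟨x, hx, hxg⟩ : ∃ x ∈ Set.pi .univ (fun _ : Fin n => Set.range ((↑) : ℤ → K)),
      MvPolynomial.eval x g ≠ 0 := by
    by_contra! hc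
    exact hg (MvPolynomial.funext_set _
      (fun _ => Set.infinite_range_of_injective Int.cast_injective)
      fun x hx => by rw [hc x hx, map_zero])
  choose l hl using fun i => hx i trivial
  refine ⟨l, h, ?_⟩
  rw [isUnit_iff_constantCoeff, isUnit_iff_ne_zero, constantCoeff_coeff_shear]
  convert hxg
  simp only [g, map_sum, MvPolynomial.eval_monomial]
  refine Finset.sum_congr rfl fun β _ => ?_
  rw [Finsupp.prod_fintype _ _ (fun _ => pow_zero _)]
  simp [← hl, Finsupp.tail_apply]

end MvPowerSeries

open Polynomial in
/-- A finitely generated domain of characteristic zero is, up to one denominator, generated by one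
integral element over a polynomial ring. -/
theorem Subring.exists_presentation {T : Type v} [CommRing T] [IsDomain T] [CharZero T]
    {S₀ S : Set T} (hS : S.Finite) (h₀ : S₀ ⊆ S) (hind : AlgebraicIndepOn ℤ id S₀) :
    ∃ (ι : Type v) (c : ι → T) (f : MvPolynomial ι ℤ →+* T) (θ : T) (P : (MvPolynomial ι ℤ)[X])
      (g : MvPolynomial ι ℤ) (G : S → (MvPolynomial ι ℤ)[X]),
      Finite ι ∧ (∀ i, f (MvPolynomial.X i) = c i) ∧ (∀ i, c i ∈ S) ∧ (∀ z ∈ S₀, ∃ i, c i = z) ∧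
      P.eval₂ f θ = 0 ∧ P.derivative.eval₂ f θ ≠ 0 ∧ f g ≠ 0 ∧
      (∀ s : S, f g * s = (G s).eval₂ f θ) ∧ ∀ b : (MvPolynomial ι ℤ)[X], b.eval₂ f θ = 0 → P ∣ b := by
  let C := Algebra.adjoin ℤ S
  let S' : Set C := (↑) ⁻¹' S
  let S₀' : Set C := (↑) ⁻¹' S₀
  have hadj : Algebra.adjoin ℤ S' = ⊤ := Algebra.adjoin_adjoin_coe_preimage
  have hft : Algebra.FiniteType ℤ C :=
    (Subalgebra.fg_iff_finiteType _).mp ⟨hS.toFinset, by simp [C]⟩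
  have hS' : S'.Finite := hS.preimage Subtype.val_injective.injOn
  have hind' : AlgebraicIndepOn ℤ id S₀' := by
    have h1 : AlgebraicIndependent ℤ
        ((fun z : S₀ => id (z : T)) ∘ fun z : S₀' => (⟨z.1.1, z.2⟩ : S₀)) :=
      AlgebraicIndependent.comp hind _ fun a b hab =>
        Subtype.ext (Subtype.ext (Subtype.mk.inj hab))
    exact AlgebraicIndependent.of_comp C.val h1
  have halg : Algebra.IsAlgebraic (Algebra.adjoin ℤ S') C := by
    rw [hadj]
    exact ⟨fun c => isAlgebraic_algebraMap (⟨c, trivial⟩ : (⊤ : Subalgebra ℤ C))⟩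
  obtain ⟨u, hu₀, hu, htb⟩ := exists_isTranscendenceBasis_between S₀' S'
    (Set.preimage_mono h₀) hind'
  let B := MvPolynomial u ℤ
  let a : B →ₐ[ℤ] C := MvPolynomial.aeval ((↑) : u → C)
  have ha : Function.Injective a := htb.1
  let : Algebra B C := a.toRingHom.toAlgebra
  have hBC : ∀ b : B, algebraMap B C b = a b := fun _ => rfl
  have : IsScalarTower ℤ B C := IsScalarTower.of_algebraMap_eq fun z => by simp [hBC]
  have : FaithfulSMul B C := (faithfulSMul_iff_algebraMap_injective B C).mpr ha
  have : Algebra.IsAlgebraic B C := by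
    have h1 := htb.isAlgebraic
    refine ⟨fun c => ?_⟩
    obtain ⟨p, hp0, hp⟩ := h1.isAlgebraic c
    let e := htb.1.aevalEquiv
    refine ⟨p.map (e.symm : _ →+* B), ?_, ?_⟩
    · exact (Polynomial.map_ne_zero_iff e.symm.injective).mpr hp0
    · rw [Polynomial.aeval_def, Polynomial.eval₂_map]
      have h2 : (algebraMap B C).comp (e.symm : _ →+* B) =
          algebraMap (Algebra.adjoin ℤ (Set.range ((↑) : u → C))) C := by
        refine RingHom.ext fun z => ?_
        have := htb.1.algebraMap_aevalEquiv (e.symm z)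
        rw [AlgEquiv.apply_symm_apply] at this
        exact this.symm
      rw [h2]
      exact hp
  have : Algebra.FiniteType B C := .of_restrictScalars_finiteType ℤ B C
  have : CharZero B := inferInstance
  obtain ⟨θ, hθ, hall⟩ := Algebra.exists_integral_primitive B C
  choose g hg G hG using hall
  have : Finite S := hS
  have := Fintype.ofFinite S
  classical
  let cS : S → C := fun s => ⟨s, Algebra.subset_adjoin s.2⟩
  have hinj : Function.Injective (algebraMap C T) := Subtype.val_injective
  have heval : ∀ b : B[X], b.eval₂ ((algebraMap C T).comp (algebraMap B C)) (θ : T) =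
      algebraMap C T (aeval θ b) := fun b => by
    rw [aeval_def, hom_eval₂]; rfl
  refine ⟨u, fun i => i.1.1, (algebraMap C T).comp (algebraMap B C), θ, minpoly B θ,
    ∏ s, g (cS s), fun s => Polynomial.C (∏ t ∈ Finset.univ.erase s, g (cS t)) * G (cS s),
    hS'.subset hu, ?_, fun i => hu i.2, ?_, ?_, ?_, ?_, ?_, ?_⟩
  · intro i
    change ((a (MvPolynomial.X i) : C) : T) = _
    exact congrArg _ (MvPolynomial.aeval_X _ i)
  · intro z hz
    exact ⟨⟨⟨z, Algebra.subset_adjoin (h₀ hz)⟩, hu₀ hz⟩, rfl⟩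
  · rw [heval, minpoly.aeval, map_zero]
  · rw [heval, Ne, map_eq_zero_iff _ hinj]
    intro h
    have h1 := minpoly.isIntegrallyClosed_dvd hθ h
    have h2 : (minpoly B θ).natDegree ≠ 0 := (minpoly.natDegree_pos hθ).ne'
    have h3 : (minpoly B θ).derivative = 0 :=
      eq_zero_of_dvd_of_degree_lt h1 (degree_derivative_lt (minpoly.ne_zero hθ))
    exact h2 (derivative_eq_zero.mp h3)
  · rw [RingHom.comp_apply, Ne, map_eq_zero_iff _ hinj, hBC, map_eq_zero_iff _ ha]
    exact Finset.prod_ne_zero_iff.mpr fun s _ => hg _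
  · intro s
    rw [heval, map_mul, aeval_C, ← hG, ← Finset.mul_prod_erase _ _ (Finset.mem_univ s),
      Algebra.smul_def]
    simp only [map_mul, RingHom.comp_apply]
    change _ * algebraMap C T (cS s) = _
    ring
  · intro b hb
    rw [heval, map_eq_zero_iff _ hinj] at hb
    exact minpoly.isIntegrallyClosed_dvd hθ hb

open Polynomial in
/-- Lifting a presentation along a quotient map `A⟦X⟧ → A⟦X⟧ ⧸ (w²)`, where `w` is a common
multiple of the denominator and of the derivative of the integral equation. -/
theorem PowerSeries.exists_root_lift {B Q A : Type*} [CommRing B] [CommRing Q] [CommRing A]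
    [IsDomain A] {w : PowerSeries A} (hw : w ≠ 0) (hXw : PowerSeries.X ∣ w)
    (χ : Q →+* PowerSeries A ⧸ Ideal.span {w ^ 2}) (fQ : B →+* Q) (f' : B →+* PowerSeries A)
    (hf' : ∀ b, Ideal.Quotient.mk _ (f' b) = χ (fQ b)) {θQ xQ wQ uQ : Q} (hu : IsUnit uQ)
    (hx : χ xQ = Ideal.Quotient.mk _ PowerSeries.X) (hwQ : χ wQ = Ideal.Quotient.mk _ w)
    {P : B[X]} {g : B} (hP : P.eval₂ fQ θQ = 0)
    (hD : xQ * fQ g * P.derivative.eval₂ fQ θQ = wQ * uQ) {ι : Type*} (G : ι → B[X]) (s : ι → Q)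
    (hG : ∀ i, fQ g * s i = (G i).eval₂ fQ θQ) :
    ∃ θ', P.eval₂ f' θ' = 0 ∧ f' g ≠ 0 ∧ ∀ i, f' g ∣ (G i).eval₂ f' θ' := by
  let J : Ideal (PowerSeries A) := Ideal.span {w ^ 2}
  have hJ : ∀ {a b}, Ideal.Quotient.mk J a = Ideal.Quotient.mk J b ↔ w ^ 2 ∣ a - b := by
    intro a b
    rw [Ideal.Quotient.eq, Ideal.mem_span_singleton]
  have hunit : ∀ {a b : PowerSeries A}, IsUnit a → IsUnit (a + w * b) := by
    intro a b ha
    obtain ⟨w₀, rfl⟩ := hXw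
    rw [PowerSeries.isUnit_iff_constantCoeff] at ha ⊢
    simpa using ha
  obtain ⟨θ, hθ⟩ := Ideal.Quotient.mk_surjective (I := J) (χ θQ)
  have heval : ∀ b : B[X], Ideal.Quotient.mk J (b.eval₂ f' θ) = χ (b.eval₂ fQ θQ) := by
    intro b
    rw [hom_eval₂, hom_eval₂, hθ]
    congr 1
    exact RingHom.ext hf'
  obtain ⟨v, hv⟩ := Ideal.Quotient.mk_surjective (I := J) (χ uQ)
  obtain ⟨v', hv'⟩ := Ideal.Quotient.mk_surjective (I := J) (χ ↑hu.unit⁻¹)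
  have hvu : IsUnit v := by
    have h1 : Ideal.Quotient.mk J (v * v') = Ideal.Quotient.mk J 1 := by
      rw [map_mul, hv, hv', ← map_mul, hu.mul_val_inv, map_one, map_one]
    obtain ⟨z, hz⟩ := hJ.mp h1
    have h2 : v * v' = 1 + w * (w * z) := by linear_combination hz
    exact isUnit_of_mul_isUnit_left (h2 ▸ hunit isUnit_one)
  let D := P.derivative.eval₂ f' θ * (PowerSeries.X * f' g)
  have hDw : ∃ ε, IsUnit ε ∧ D = w * ε := by
    have h1 : Ideal.Quotient.mk J D = Ideal.Quotient.mk J (w * v) := by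
      simp only [D, map_mul, heval]
      rw [hf', ← hx, ← hwQ, hv, ← map_mul, ← map_mul, ← map_mul, ← hD]
      ring_nf
    obtain ⟨z, hz⟩ := hJ.mp h1
    exact ⟨v + w * z, hunit hvu, by linear_combination hz⟩
  obtain ⟨ε, hε, hDε⟩ := hDw
  have hwD : w ∣ D := ⟨ε, hDε⟩
  have hDw : D ∣ w := by
    obtain ⟨ε, rfl⟩ := hε
    exact ⟨↑ε⁻¹, by rw [hDε, mul_assoc, Units.mul_inv, mul_one]⟩
  have hgD : f' g ∣ D := ⟨P.derivative.eval₂ f' θ * PowerSeries.X, by simp only [D]; ring⟩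
  have hD0 : D ≠ 0 := fun h => hw (zero_dvd_iff.mp (h ▸ hDw))
  have hroot : D ^ 2 ∣ P.eval₂ f' θ := by
    have h1 : Ideal.Quotient.mk J (P.eval₂ f' θ) = Ideal.Quotient.mk J 0 := by
      rw [heval, hP, map_zero, map_zero]
    simpa using (pow_dvd_pow_of_dvd hDw 2).trans (hJ.mp h1)
  obtain ⟨θ', hθ', hD'⟩ := IsAdicComplete.exists_root_of_sq_dvd
    (Ideal.span {(PowerSeries.X : PowerSeries A)}) (P.map f') θ (h := PowerSeries.X * f' g)
    (Ideal.mul_mem_right _ _ (Ideal.mem_span_singleton_self _))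
    (by simpa [derivative_map, eval_map, D] using hroot)
  rw [derivative_map, eval_map] at hD'
  refine ⟨θ', by rwa [eval_map] at hθ', fun h => hD0 (by simp [D, h]), fun i => ?_⟩
  obtain ⟨t, ht⟩ := Ideal.Quotient.mk_surjective (I := J) (χ (s i))
  have h1 : Ideal.Quotient.mk J ((G i).eval₂ f' θ) = Ideal.Quotient.mk J (f' g * t) := by
    rw [heval, ← hG, map_mul, map_mul, hf', ht]
  have h2 : f' g ∣ (G i).eval₂ f' θ - f' g * t :=
    ((hgD.trans hDw).trans (Dvd.intro_left _ (sq w).symm)).trans (hJ.mp h1)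
  have h3 : f' g ∣ (G i).eval₂ f' θ := (dvd_sub_left (Dvd.intro _ rfl)).mp h2
  have h4 : f' g ∣ (G i).eval₂ f' θ' - (G i).eval₂ f' θ := by
    rw [← eval_map, ← eval_map]
    exact (hgD.trans hD').trans (sub_dvd_eval_sub _ _ _)
  simpa using dvd_add h4 h3

open Polynomial in
theorem PowerSeries.exists_specialization_mod {A : Type v} [CommRing A] [IsDomain A]
    [IsLocalRing A] [IsAdicComplete (IsLocalRing.maximalIdeal A) A] {S : Set (PowerSeries A)}
    (hS : S.Finite) {D : PowerSeries A} (hD : D.map (IsLocalRing.residue A) ≠ 0) {Z : Set A}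
    (hZ : Z.Finite) :
    ∃ (S₁ : Set A) (hZS : Z ⊆ S₁) (Q : Subring (PowerSeries A)) (xQ wQ uQ : Q), S₁.Finite ∧
      S ⊆ Q ∧ (∀ z ∈ Z, PowerSeries.C z ∈ Q) ∧ (xQ : PowerSeries A) = PowerSeries.X ∧
      IsUnit uQ ∧ (xQ : PowerSeries A) * D = wQ * uQ ∧
      ∀ {A' : Type v} [CommRing A'] [IsDomain A'] (Ψ : Subring.closure S₁ →+* A'),
        ∃ w : PowerSeries A', w ≠ 0 ∧ PowerSeries.X ∣ w ∧
          ∃ χ : Q →+* PowerSeries A' ⧸ Ideal.span {w ^ 2},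
            χ xQ = Ideal.Quotient.mk _ PowerSeries.X ∧ χ wQ = Ideal.Quotient.mk _ w ∧
            ∀ z (hz : z ∈ Z) (h : PowerSeries.C z ∈ Q), χ ⟨_, h⟩ =
              Ideal.Quotient.mk _ (PowerSeries.C (Ψ ⟨z, Subring.subset_closure (hZS hz)⟩)) := by
  classical
  obtain ⟨w₁, u, H⟩ := PowerSeries.exists_isWeierstrassFactorization hD
  have hw₁ := H.isDistinguishedAt
  have hX : (Polynomial.X : A[X]).IsDistinguishedAt (IsLocalRing.maximalIdeal A) :=
    ⟨⟨fun {i} hi => by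
      rw [Polynomial.natDegree_X] at hi
      obtain rfl : i = 0 := by omega
      simp⟩, Polynomial.monic_X⟩
  have hw : (Polynomial.X * w₁).IsDistinguishedAt (IsLocalRing.maximalIdeal A) := hX.mul hw₁
  have hW : ((Polynomial.X * w₁) ^ 2).IsDistinguishedAt (IsLocalRing.maximalIdeal A) := by
    rw [sq]; exact hw.mul hw
  have hdiv : ∀ s : PowerSeries A, ∃ r : A[X],
      s - (r : PowerSeries A) ∈ Ideal.span {(((Polynomial.X * w₁) ^ 2 : A[X]) : PowerSeries A)} ∧
        ∀ q : A[X], s = q → r = q := by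
    intro s
    by_cases hs : ∃ q : A[X], s = q
    · obtain ⟨q, rfl⟩ := hs
      exact ⟨q, by simp, fun q' h => Polynomial.coe_injective A h⟩
    · obtain ⟨t, ht⟩ := hW.algEquivQuotient.surjective (Ideal.Quotient.mk _ s)
      obtain ⟨r, rfl⟩ := Ideal.Quotient.mk_surjective t
      exact ⟨r, Ideal.Quotient.eq.mp ht.symm, fun q h => (hs ⟨q, h⟩).elim⟩
  choose r hr hrq using hdiv
  obtain ⟨u, rfl⟩ := H.isUnit
  let S' : Set (PowerSeries A) := S ∪
    ({PowerSeries.X, (w₁ : PowerSeries A), ↑u, ↑u⁻¹} ∪ PowerSeries.C '' Z)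
  have hS' : S'.Finite := hS.union ((Set.toFinite _).union (hZ.image _))
  let S₁ : Set A := Z ∪ (⋃ s ∈ S', ((r s).coeffs : Set A)) ∪ (w₁.coeffs : Set A)
  have hS₁ : S₁.Finite := (hZ.union (hS'.biUnion fun s _ => Finset.finite_toSet _)).union
    (Finset.finite_toSet _)
  have hmem : ∀ {s}, s ∈ S' → s ∈ Subring.closure S' := fun h => Subring.subset_closure h
  have hX' : PowerSeries.X ∈ S' := by simp [S']
  have hw' : (w₁ : PowerSeries A) ∈ S' := by simp [S']
  have hu' : (u : PowerSeries A) ∈ S' := by simp [S']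
  have hv' : ((u⁻¹ : (PowerSeries A)ˣ) : PowerSeries A) ∈ S' := by simp [S']
  have hC' : ∀ z ∈ Z, PowerSeries.C z ∈ S' := fun z hz => Or.inr (Or.inr ⟨z, hz, rfl⟩)
  have hZS : Z ⊆ S₁ := fun z hz => Or.inl (Or.inl hz)
  refine ⟨S₁, hZS, Subring.closure S', ⟨_, hmem hX'⟩, ⟨_, hmem hX'⟩ * ⟨_, hmem hw'⟩, ⟨_, hmem hu'⟩,
    hS₁, fun s hs => hmem (Or.inl hs), fun z hz => hmem (hC' z hz), rfl, ?_, ?_, ?_⟩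
  · exact IsUnit.of_mul_eq_one ⟨_, hmem hv'⟩ (Subtype.ext u.mul_inv)
  · rw [H.eq_mul]; simp [mul_assoc]
  intro A' _ _ Ψ
  let j := (Subring.closure S₁).subtype
  have hj : Function.Injective j := Subtype.val_injective
  have hlift : ∀ q : A[X], (q.coeffs : Set A) ⊆ S₁ → ∃ q' : (Subring.closure S₁)[X], q'.map j = q := by
    intro q hq
    refine (Polynomial.mem_lifts q).mp ((Polynomial.lifts_iff_coeff_lifts q).mpr fun n => ?_)
    by_cases hn : q.coeff n = 0
    · exact ⟨0, by simp [hn]⟩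
    · exact ⟨⟨_, Subring.subset_closure (hq (Polynomial.coeff_mem_coeffs hn))⟩, rfl⟩
  obtain ⟨w₁', hw₁'⟩ := hlift w₁ fun a ha => Or.inr ha
  have hr' : ∀ s : S', ∃ q' : (Subring.closure S₁)[X], q'.map j = r s := fun s =>
    hlift _ fun a ha => Or.inl (Or.inr (Set.mem_biUnion s.2 ha))
  choose r' hr' using hr'
  have hw₁m : w₁'.Monic := Polynomial.monic_of_injective hj (by rw [hw₁']; exact hw₁.monic)
  have hWmap : ((Polynomial.X * w₁') ^ 2).map j = (Polynomial.X * w₁) ^ 2 := by simp [hw₁']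
  obtain ⟨χ, hχ⟩ := Polynomial.IsDistinguishedAt.exists_closure_ringHom
    (I := IsLocalRing.maximalIdeal A) j hj Ψ
    (W := (Polynomial.X * w₁') ^ 2) ((Polynomial.monic_X.mul hw₁m).pow 2) (by rw [hWmap]; exact hW)
    (S := S') r' (fun s => by rw [hr', hWmap]; exact hr s)
  have hval : ∀ (q : (Subring.closure S₁)[X]) (h : ((q.map j : A[X]) : PowerSeries A) ∈ S'),
      χ ⟨_, hmem h⟩ = Ideal.Quotient.mk _ ((q.map Ψ : A'[X]) : PowerSeries A') := by
    intro q h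
    rw [hχ ⟨_, h⟩]
    congr 3
    exact Polynomial.map_injective j hj ((hr' _).trans (hrq _ _ rfl))
  let w : PowerSeries A' := ((((Polynomial.X : (Subring.closure S₁)[X]) * w₁').map Ψ : A'[X]) :
    PowerSeries A')
  have hw2 : ((((Polynomial.X * w₁') ^ 2 : (Subring.closure S₁)[X]).map Ψ : A'[X]) : PowerSeries A')
      = w ^ 2 := by
    simp [w, mul_pow]
  have hwX : w = PowerSeries.X * ((w₁'.map Ψ : A'[X]) : PowerSeries A') := by simp [w]
  have hXval := hval Polynomial.X (by simpa using hX')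
  have hwval := hval w₁' (by rw [hw₁']; exact hw')
  have hCval : ∀ z (hz : z ∈ Z), _ := fun z hz =>
    hval (Polynomial.C ⟨z, Subring.subset_closure (hZS hz)⟩) (by simpa [j] using hC' z hz)
  revert χ
  rw [hw2]
  intro χ _ _ hXval hwval hCval
  refine ⟨w, ?_, ⟨_, hwX⟩, χ, ?_, ?_, ?_⟩
  · intro h
    exact ((Polynomial.monic_X.mul hw₁m).map Ψ).ne_zero
      (Polynomial.coe_injective A' (h.trans Polynomial.coe_zero.symm))
  · simpa using hXval
  · refine (map_mul χ _ _).trans ?_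
    refine Eq.trans ?_ ((map_mul _ _ _).symm.trans (congrArg _ hwX.symm))
    congr 1
    · simpa using hXval
    · rw [← hwval]; congr 2; rw [hw₁']
  · intro z hz h
    simpa [j] using hCval z hz

instance Int.isJacobsonRing : IsJacobsonRing ℤ := by
  refine isJacobsonRing_iff_prime_eq.mpr fun P hP => ?_
  by_cases h : P = ⊥
  · subst h
    refine le_antisymm (fun x hx => ?_) Ideal.le_jacobson
    have := Int.isUnit_iff.mp (Ideal.mem_jacobson_bot.mp hx x)
    rw [Ideal.mem_bot]
    rcases this with h | h <;> nlinarith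
  · have := IsPrime.to_maximal_ideal h
    exact Ideal.jacobson_eq_self_of_isMaximal

/-- A nontrivial ring of finite type over `ℤ` has a point in a perfect field of positive
characteristic. -/
theorem Algebra.FiniteType.exists_ringHom_perfectField (C : Type v) [CommRing C] [Nontrivial C]
    [alg : Algebra ℤ C] [Algebra.FiniteType ℤ C] : ∃ (F : Type v) (_ : Field F) (p : ℕ) (_ : Fact p.Prime)
      (_ : CharP F p) (_ : PerfectRing F p), Nonempty (C →+* F) := by
  obtain rfl : alg = Ring.toIntAlgebra C := Subsingleton.elim _ _
  obtain ⟨M, hM⟩ := Ideal.exists_maximal C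
  let := Ideal.Quotient.field M
  have : Module.Finite ℤ (C ⧸ M) := finite_of_finite_type_of_isJacobsonRing ℤ (C ⧸ M)
  obtain ⟨p, hp⟩ := CharP.exists (C ⧸ M)
  have hp0 : p ≠ 0 := by
    rintro rfl
    have : CharZero (C ⧸ M) := CharP.charP_to_charZero _
    have : Algebra.IsIntegral ℤ (C ⧸ M) := Algebra.IsIntegral.of_finite _ _
    exact Int.not_isField (isField_of_isIntegral_of_isField (R := ℤ) (S := C ⧸ M)
      (algebraMap ℤ (C ⧸ M)).injective_int (Field.toIsField _))
  have hpp : Fact p.Prime := ⟨(CharP.char_is_prime_or_zero (C ⧸ M) p).resolve_right hp0⟩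
  have : CharP (AlgebraicClosure (C ⧸ M)) p := charP_of_injective_algebraMap
    (algebraMap (C ⧸ M) (AlgebraicClosure (C ⧸ M))).injective p
  exact ⟨AlgebraicClosure (C ⧸ M), inferInstance, p, hpp, this, inferInstance,
    ⟨(algebraMap (C ⧸ M) (AlgebraicClosure (C ⧸ M))).comp (Ideal.Quotient.mk M)⟩⟩

namespace MvPowerSeries

/-- Every finite set of power series over `K` containing the variables can be specialised to a
perfect field of positive characteristic, fixing the variables. -/
def HasSpecializations (K : Type v) [Field K] (n : ℕ) : Prop :=
  ∀ (S : Set (MvPowerSeries (Fin n) K)) (_ : S.Finite) (hX : ∀ k, X k ∈ S),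
    ∃ (F : Type v) (_ : Field F) (p : ℕ) (_ : Fact p.Prime) (_ : CharP F p) (_ : PerfectRing F p)
      (Φ : Subring.closure S →+* MvPowerSeries (Fin n) F),
      ∀ k, Φ ⟨X k, Subring.subset_closure (hX k)⟩ = X k

theorem hasSpecializations_zero (K : Type v) [Field K] : HasSpecializations K 0 := by
  intro S hS _
  let C := Algebra.adjoin ℤ S
  have hft : Algebra.FiniteType ℤ C :=
    (Subalgebra.fg_iff_finiteType _).mp ⟨hS.toFinset, by simp [C]⟩
  obtain ⟨F, _, p, hp, _, hF, ⟨φ⟩⟩ := Algebra.FiniteType.exists_ringHom_perfectField C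
  have hle : Subring.closure S ≤ C.toSubring :=
    Subring.closure_le.mpr Algebra.subset_adjoin
  exact ⟨F, inferInstance, p, hp, inferInstance, hF,
    (MvPowerSeries.C.comp φ).comp (Subring.inclusion hle), fun k => k.elim0⟩

theorem algebraicIndepOn_range_X (n : ℕ) (K : Type v) [Field K] [CharZero K] :
    AlgebraicIndepOn ℤ id (Set.range (X : Fin n → MvPowerSeries (Fin n) K)) := by
  have h : AlgebraicIndependent ℤ (X : Fin n → MvPowerSeries (Fin n) K) := by
    rw [AlgebraicIndependent]
    have h1 : ∀ q : MvPolynomial (Fin n) ℤ, MvPolynomial.aeval (X : Fin n → MvPowerSeries (Fin n) K) q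
        = ((MvPolynomial.map (Int.castRingHom K) q : MvPolynomial (Fin n) K) :
          MvPowerSeries (Fin n) K) := by
      intro q
      change (MvPolynomial.aeval (R := ℤ) (X : Fin n → MvPowerSeries (Fin n) K)).toRingHom q =
        (MvPolynomial.coeToMvPowerSeries.ringHom.comp (MvPolynomial.map (Int.castRingHom K))) q
      congr 1
      refine MvPolynomial.ringHom_ext (fun r => ?_) fun i => ?_ <;> simp
    intro p q hpq
    rw [h1, h1] at hpq
    exact MvPolynomial.map_injective _ Int.cast_injective (MvPolynomial.coe_injective _ _ hpq)
  exact h.coe_range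

set_option maxHeartbeats 1000000 in
theorem hasSpecializations_succ {K : Type v} [Field K] [CharZero K] {n : ℕ}
    (IH : HasSpecializations K n) : HasSpecializations K (n + 1) := by
  classical
  intro S hS hXS
  have : IsDomain (MvPowerSeries (Fin (n + 1)) K) := NoZeroDivisors.to_isDomain _
  have : IsDomain (MvPowerSeries (Fin n) K) := NoZeroDivisors.to_isDomain _
  have hind : @AlgebraicIndepOn _ ℤ _ id _ _ (Ring.toIntAlgebra _)
      (Set.range (X : Fin (n + 1) → MvPowerSeries (Fin (n + 1)) K)) := by
    convert algebraicIndepOn_range_X (n + 1) K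
    exact Subsingleton.elim _ _
  have : CharZero (MvPowerSeries (Fin (n + 1)) K) := charZero_of_injective_algebraMap
    (FaithfulSMul.algebraMap_injective K (MvPowerSeries (Fin (n + 1)) K))
  have : IsAdicComplete (IsLocalRing.maximalIdeal (MvPowerSeries (Fin n) K))
      (MvPowerSeries (Fin n) K) := by
    rw [← span_range_X]; infer_instance
  obtain ⟨ι, c, f, θ, P, g, G, hι, hfX, hcS, hcX, hPθ, hP'θ, hfg, hG, hker⟩ :=
    Subring.exists_presentation hS (Set.range_subset_iff.mpr hXS) hind
  obtain ⟨l, h, hl⟩ := exists_isUnit_coeff_shear (mul_ne_zero hfg hP'θ)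
  let τ := shear K l
  have hD : (τ (f g * P.derivative.eval₂ f θ)).map (IsLocalRing.residue _) ≠ 0 := by
    intro h0
    have := congrArg (PowerSeries.coeff h) h0
    rw [PowerSeries.coeff_map, map_zero, IsLocalRing.residue_eq_zero_iff] at this
    exact this hl
  obtain ⟨S₁, hZS, Q, xQ, wQ, uQ, hS₁, hSQ, hCQ, hxQ, hu, hD, hspec⟩ :=
    PowerSeries.exists_specialization_mod (((hS.insert θ).image τ)) hD
      (Set.finite_range (X : Fin n → MvPowerSeries (Fin n) K))
  have hXS₁ : ∀ k, (X k : MvPowerSeries (Fin n) K) ∈ S₁ := fun k => hZS ⟨k, rfl⟩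
  obtain ⟨F, _, p, hp, _, hperf, Ψ, hΨ⟩ := IH S₁ hS₁ hXS₁
  have : IsDomain (MvPowerSeries (Fin n) F) := NoZeroDivisors.to_isDomain _
  obtain ⟨w, hw0, hXw, χ, hχx, hχw, hχC⟩ := hspec Ψ
  have hcQ : ∀ i, τ (c i) ∈ Q := fun i => hSQ ⟨_, Or.inr (hcS i), rfl⟩
  have hXQ : ∀ k, τ (X k) ∈ Q := fun k => hSQ ⟨_, Or.inr (hXS k), rfl⟩
  have hχX : ∀ k, χ ⟨τ (X k), hXQ k⟩ = Ideal.Quotient.mk _ (shear F l (X k)) := by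
    intro k
    refine Fin.cases ?_ (fun k => ?_) k
    · rw [shear_X_zero F l, ← hχx]
      congr 1
      exact Subtype.ext (by rw [hxQ]; exact shear_X_zero K l)
    · have h1 : (⟨τ (X k.succ), hXQ k.succ⟩ : Q) =
          ⟨PowerSeries.C (X k), hCQ _ ⟨k, rfl⟩⟩ + (l k : Q) * xQ :=
        Subtype.ext (by simp [hxQ, τ, shear_X_succ])
      rw [h1, map_add, map_mul, hχC _ ⟨k, rfl⟩, map_intCast, hχx, hΨ, shear_X_succ]
      simp
  have hc' : ∀ i, ∃ y, Ideal.Quotient.mk (Ideal.span {w ^ 2}) y = χ ⟨τ (c i), hcQ i⟩ ∧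
      ∀ k, c i = X k → y = shear F l (X k) := by
    intro i
    by_cases hi : ∃ k, c i = X k
    · obtain ⟨k, hk⟩ := hi
      refine ⟨shear F l (X k), ?_, fun k' hk' => ?_⟩
      · rw [← hχX]
        congr 2
        rw [hk]
      · rw [X_inj.mp (hk.symm.trans hk')]
    · obtain ⟨y, hy⟩ := Ideal.Quotient.mk_surjective (χ ⟨τ (c i), hcQ i⟩)
      exact ⟨y, hy, fun k hk => (hi ⟨k, hk⟩).elim⟩
  choose c' hc' hc'X using hc'
  let fQ : MvPolynomial ι ℤ →+* Q :=
    MvPolynomial.eval₂Hom (Int.castRingHom Q) fun i => ⟨τ (c i), hcQ i⟩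
  let f' : MvPolynomial ι ℤ →+* PowerSeries (MvPowerSeries (Fin n) F) :=
    MvPolynomial.eval₂Hom (Int.castRingHom _) c'
  have hfQ : Q.subtype.comp fQ = (τ : _ →+* _).comp f := by
    refine MvPolynomial.ringHom_ext (fun r => by simp) fun i => by simp [fQ, hfX]
  have hfQ' : ∀ b, (fQ b : PowerSeries (MvPowerSeries (Fin n) K)) = τ (f b) := fun b =>
    RingHom.congr_fun hfQ b
  have hf' : ∀ b, Ideal.Quotient.mk (Ideal.span {w ^ 2}) (f' b) = χ (fQ b) := by
    intro b
    change ((Ideal.Quotient.mk (Ideal.span {w ^ 2})).comp f') b = (χ.comp fQ) b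
    congr 1
    refine MvPolynomial.ringHom_ext (fun r => by simp) fun i => by simp [fQ, f', hc']
  let θQ : Q := ⟨τ θ, hSQ ⟨_, Or.inl rfl, rfl⟩⟩
  have heval : ∀ b : Polynomial (MvPolynomial ι ℤ),
      ((b.eval₂ fQ θQ : Q) : PowerSeries (MvPowerSeries (Fin n) K)) = τ (b.eval₂ f θ) := by
    intro b
    have h1 := Polynomial.hom_eval₂ b fQ Q.subtype θQ
    have h2 := Polynomial.hom_eval₂ b f τ.toRingHom θ
    rw [show τ.toRingHom.comp f = Q.subtype.comp fQ from hfQ.symm] at h2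
    exact h1.trans h2.symm
  obtain ⟨θ', hPθ', hg', hdvd⟩ := PowerSeries.exists_root_lift hw0 hXw χ fQ f' hf' hu hχx hχw
    (P := P) (g := g) (θQ := θQ) (Subtype.ext (by rw [heval, hPθ]; simp))
    (by
      apply Subtype.ext
      have := hD
      rw [map_mul, ← heval, ← hfQ', ← mul_assoc] at this
      exact this)
    G (fun s => ⟨τ s, hSQ ⟨_, Or.inr s.2, rfl⟩⟩)
    (fun s => Subtype.ext (by rw [heval, ← hG, map_mul, ← hfQ']; rfl))
  choose e he using hdvd
  obtain ⟨Φ, hΦ⟩ := Subring.exists_closure_ringHom_of_fractions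
    (Polynomial.eval₂RingHom f θ) (Polynomial.eval₂RingHom f' θ')
    (fun b hb => by
      obtain ⟨b', rfl⟩ := hker b hb
      simp [Polynomial.eval₂_mul, hPθ'])
    (g := Polynomial.C g) (by simpa using hg') (S := S) G (fun s => by simpa using hG s) e
    (fun s => by simpa using (he s).symm)
  refine ⟨F, inferInstance, p, hp, inferInstance, hperf,
    ((shear F l).symm : _ →+* _).comp Φ, fun k => ?_⟩
  rw [RingHom.comp_apply]
  refine (congrArg (shear F l).symm (hΦ ⟨X k, hXS k⟩)).trans ?_
  rw [RingEquiv.symm_apply_eq]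
  obtain ⟨i, hi⟩ := hcX _ ⟨k, rfl⟩
  rw [← hc'X i k hi]
  refine mul_left_cancel₀ hg' ((he _).symm.trans ?_)
  have h1 : Polynomial.eval₂ f θ (Polynomial.C (g * MvPolynomial.X i) - G ⟨X k, hXS k⟩) = 0 := by
    rw [Polynomial.eval₂_sub, Polynomial.eval₂_C, ← hG, map_mul, hfX, hi, sub_self]
  obtain ⟨b', hb'⟩ := hker _ h1
  have h2 := congrArg (Polynomial.eval₂ f' θ') hb'
  rw [Polynomial.eval₂_sub, Polynomial.eval₂_C, Polynomial.eval₂_mul, hPθ', zero_mul,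
    sub_eq_zero, map_mul] at h2
  rw [← h2]
  simp [f']

/-- Artin approximation for constants: power series over an arbitrary field specialise to power
series over a perfect field of positive characteristic. -/
theorem hasSpecializations (K : Type v) [Field K] (n : ℕ) : HasSpecializations K n := by
  obtain ⟨p, hp⟩ := CharP.exists K
  rcases CharP.char_is_prime_or_zero K p with hpp | rfl
  · intro S hS hXS
    have : Fact p.Prime := ⟨hpp⟩
    have : CharP (AlgebraicClosure K) p := charP_of_injective_algebraMap
      (algebraMap K (AlgebraicClosure K)).injective p
    exact ⟨AlgebraicClosure K, inferInstance, p, ⟨hpp⟩, this, inferInstance,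
      (map (algebraMap K (AlgebraicClosure K))).comp (Subring.closure S).subtype, fun k => by simp⟩
  · have : CharZero K := CharP.charP_to_charZero K
    induction n with
    | zero => exact hasSpecializations_zero K
    | succ n ih => exact hasSpecializations_succ ih

end MvPowerSeries

section

open IsLocalRing RingTheory.Sequence CategoryTheory Abelian Pointwise

theorem IsAssociatedPrime.length_le_ringKrullDim {A : Type v} [CommRing A] [IsLocalRing A]
    [IsNoetherianRing A] {P : Ideal A} (l : List A) :
    ∀ {M : Type v} [AddCommGroup M] [Module A M] [Module.Finite A M],
    (∀ r ∈ l, r ∈ maximalIdeal A) → IsWeaklyRegular M l → IsAssociatedPrime P M →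
    (l.length : WithBot ℕ∞) ≤ ringKrullDim (A ⧸ P) := by
  induction l generalizing P with
  | nil =>
    intro M _ _ _ _ _ hP
    have := hP.isPrime
    simpa using ringKrullDim_nonneg_of_nontrivial
  | cons x l ih =>
    intro M _ _ _ hl hreg hP
    rw [isWeaklyRegular_cons_iff] at hreg
    obtain ⟨hP', m₀, hm₀⟩ := (isAssociatedPrime_iff (M := M)).mp hP
    have hmem : ∀ a, a ∈ P ↔ a • m₀ = 0 := fun a => by
      rw [hm₀, Submodule.mem_colon_singleton, Submodule.mem_bot]
    have hm0 : m₀ ≠ 0 := by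
      rintro rfl
      exact hP'.ne_top ((Ideal.eq_top_iff_one _).mpr ((hmem 1).mpr (smul_zero _)))
    let N : Submodule A M :=
      { carrier := {m | ∀ a ∈ P, a • m = 0}
        add_mem' := fun h h' a ha => by rw [smul_add, h a ha, h' a ha, add_zero]
        zero_mem' := fun a _ => smul_zero a
        smul_mem' := fun c m h a ha => by rw [smul_comm, h a ha, smul_zero] }
    have hxm : x ∈ maximalIdeal A := hl x (List.mem_cons_self)
    have hxP : x ∉ P := fun h => hm0 (hreg.1.right_eq_zero_of_smul ((hmem x).mp h))
    obtain ⟨m, hmN, hmx⟩ : ∃ m ∈ N, m ∉ x • (⊤ : Submodule A M) := by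
      by_contra! hcon
      have hN : N = ⊥ := by
        refine Submodule.eq_bot_of_le_smul_of_le_jacobson_bot (Ideal.span {x}) N
          (IsNoetherian.noetherian N) (fun m hm => ?_) ?_
        · obtain ⟨m', -, rfl⟩ := Submodule.mem_smul_pointwise_iff_exists _ _ _ |>.mp (hcon m hm)
          refine Submodule.smul_mem_smul (Ideal.mem_span_singleton_self x) fun a ha => ?_
          apply hreg.1.right_eq_zero_of_smul
          rw [smul_comm]
          exact hm a ha
        · rw [Ideal.span_singleton_le_iff_mem, jacobson_eq_maximalIdeal _ bot_ne_top]
          exact hxm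
      exact hm0 ((Submodule.eq_bot_iff _).mp hN m₀ fun a ha => (hmem a).mp ha)
    let m' : QuotSMulTop x M := Submodule.Quotient.mk m
    have hm' : m' ≠ 0 := fun h => hmx ((Submodule.Quotient.mk_eq_zero _).mp h)
    obtain ⟨Q, hQ, hle⟩ := exists_le_isAssociatedPrime_of_isNoetherianRing A m' hm'
    have hPQ : P ≤ Q := fun a ha => hle (by
      rw [Submodule.mem_colon_singleton, Submodule.mem_bot, ← Submodule.Quotient.mk_smul,
        hmN a ha, Submodule.Quotient.mk_zero])
    have hxQ : x ∈ Q := hle (by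
      rw [Submodule.mem_colon_singleton, Submodule.mem_bot, ← Submodule.Quotient.mk_smul,
        Submodule.Quotient.mk_eq_zero]
      exact Submodule.smul_mem_pointwise_smul _ _ _ trivial)
    have h1 := ih (fun r hr => hl r (List.mem_cons_of_mem _ hr)) hreg.2 hQ
    have hx0 : Ideal.Quotient.mk P x ∈ nonZeroDivisors (A ⧸ P) :=
      mem_nonZeroDivisors_of_ne_zero fun h => hxP (Ideal.Quotient.eq_zero_iff_mem.mp h)
    have h2 := ringKrullDim_quotient_succ_le_of_nonZeroDivisor hx0
    have h3 : ringKrullDim (A ⧸ Q) ≤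
        ringKrullDim ((A ⧸ P) ⧸ Ideal.span {Ideal.Quotient.mk P x}) := by
      refine ringKrullDim_le_of_surjective (Ideal.Quotient.lift _ (Ideal.Quotient.factor hPQ) ?_) ?_
      · intro a ha
        obtain ⟨c, rfl⟩ := Ideal.mem_span_singleton'.mp ha
        rw [map_mul, Ideal.Quotient.factor_mk, Ideal.Quotient.eq_zero_iff_mem.mpr hxQ, mul_zero]
      · exact Ideal.Quotient.lift_surjective_of_surjective _ _ (Ideal.Quotient.factor_surjective hPQ)
    rw [List.length_cons]
    push_cast
    exact (add_le_add_left (h1.trans h3) 1).trans h2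

theorem IsLocalRing.ringKrullDim_le_length {B : Type v} [CommRing B] [IsLocalRing B]
    [IsNoetherianRing B] (l : List B) (hl : ∀ r ∈ l, r ∈ maximalIdeal B)
    (h : maximalIdeal B ≤ (Ideal.ofList l).radical) :
    ringKrullDim B ≤ l.length := by
  classical
  rw [← maximalIdeal_height_eq_ringKrullDim]
  have : maximalIdeal B ∈ (Ideal.span (l.toFinset : Set B)).minimalPrimes := by
    have e : Ideal.span (l.toFinset : Set B) = Ideal.ofList l := by
      rw [Ideal.ofList]; congr 1; ext; simp
    rw [e]
    refine ⟨⟨inferInstance, ?_⟩, fun Q hQ _ => h.trans (hQ.1.radical_le_iff.mpr hQ.2)⟩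
    exact Ideal.span_le.mpr fun r hr => hl r hr
  have h := Ideal.height_le_card_of_mem_minimalPrimes_span_finset this
  have : (l.toFinset.card : ℕ∞) ≤ l.length := by exact_mod_cast List.toFinset_card_le l
  exact_mod_cast h.trans this

theorem IsLocalRing.isWeaklyRegular_of_ext {A : Type v} [CommRing A] [IsLocalRing A]
    [IsNoetherianRing A] (k : ModuleCat.{v} A) [Module.Finite A k]
    (hk : Module.support A k = PrimeSpectrum.zeroLocus (maximalIdeal A : Set A)) (l : List A) :
    ∀ (M : ModuleCat.{v} A) [Module.Finite A M], (∀ r ∈ l, r ∈ maximalIdeal A) →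
      maximalIdeal A ≤ (Module.annihilator A M ⊔ Ideal.ofList l).radical →
      (∀ i < l.length, Subsingleton (Ext k M i)) → IsWeaklyRegular M l := by
  induction l with
  | nil => intro M _ _ _ _; exact IsWeaklyRegular.nil A M
  | cons x l ih =>
    intro M _ hl hrad hext
    rw [isWeaklyRegular_cons_iff]
    have hx : IsSMulRegular M x := by
      by_contra hx
      obtain ⟨m, hm, hm0⟩ : ∃ m : M, m ≠ 0 ∧ x • m = 0 := by
        rw [isSMulRegular_iff_right_eq_zero_of_smul] at hx
        push Not at hx
        obtain ⟨m, h, h'⟩ := hx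
        exact ⟨m, h', h⟩
      obtain ⟨P, hP, hle⟩ := exists_le_isAssociatedPrime_of_isNoetherianRing A m hm
      have hxP : x ∈ P := hle (by rwa [Submodule.mem_colon_singleton, Submodule.mem_bot])
      have hannP : Module.annihilator A M ≤ P := by
        rw [← Submodule.annihilator_top]; exact hP.annihilator_le
      have : Nontrivial M := ⟨m, 0, hm⟩
      obtain ⟨rs, hlen, hrs, hreg⟩ := ModuleCat.exists_isRegular_of_exists_subsingleton_ext
        (maximalIdeal A) (x :: l).length M
        (lt_top_iff_ne_top.mpr (Submodule.top_ne_ideal_smul_of_le_jacobson_annihilator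
          (maximalIdeal_le_jacobson _)).symm) k hk hext
      have h1 := hP.length_le_ringKrullDim rs hrs hreg.toIsWeaklyRegular
      have := hP.isPrime
      have : IsLocalRing (A ⧸ P) :=
        .of_surjective' _ Ideal.Quotient.mk_surjective
      have hloc : maximalIdeal (A ⧸ P) = (maximalIdeal A).map (Ideal.Quotient.mk P) := by
        rw [← Ideal.Quotient.algebraMap_eq]
        exact (map_maximalIdeal_of_surjective _ Ideal.Quotient.mk_surjective).symm
      have h2 := ringKrullDim_le_length (B := A ⧸ P) (l.map (Ideal.Quotient.mk P))
        (fun r hr => by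
          obtain ⟨a, ha, rfl⟩ := List.mem_map.mp hr
          rw [hloc]
          exact Ideal.mem_map_of_mem _ (hl a (List.mem_cons_of_mem _ ha)))
        (by
          rw [hloc, Ideal.map_le_iff_le_comap]
          refine hrad.trans ?_
          rw [Ideal.comap_radical, ]
          refine Ideal.radical_mono (sup_le ?_ ?_)
          · refine hannP.trans fun a ha => ?_
            rw [Ideal.mem_comap, Ideal.Quotient.eq_zero_iff_mem.mpr ha]
            exact zero_mem _
          · refine Ideal.span_le.mpr fun r hr => ?_
            rcases List.mem_cons.mp hr with rfl | hr
            · rw [SetLike.mem_coe, Ideal.mem_comap, Ideal.Quotient.eq_zero_iff_mem.mpr hxP]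
              exact zero_mem _
            · exact Ideal.subset_span (List.mem_map_of_mem hr))
      rw [hlen] at h1
      have := h1.trans h2
      simp only [List.length_cons, List.length_map] at this
      have : l.length + 1 ≤ l.length := by exact_mod_cast this
      omega
    refine ⟨hx, ih (ModuleCat.of A (QuotSMulTop x M)) (fun r hr => hl r (List.mem_cons_of_mem _ hr))
      (hrad.trans (Ideal.radical_mono ?_)) fun i hi => ?_⟩
    · rw [Ideal.ofList_cons, ← sup_assoc]
      refine sup_le_sup (sup_le ?_ ?_) le_rfl
      · intro a ha
        rw [Module.mem_annihilator] at ha ⊢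
        intro m
        obtain ⟨m, rfl⟩ := Submodule.Quotient.mk_surjective _ m
        rw [← Submodule.Quotient.mk_smul, ha, Submodule.Quotient.mk_zero]
      · rw [Ideal.span_singleton_le_iff_mem, Module.mem_annihilator]
        intro m
        obtain ⟨m, rfl⟩ := Submodule.Quotient.mk_surjective _ m
        rw [← Submodule.Quotient.mk_smul, Submodule.Quotient.mk_eq_zero]
        exact Submodule.smul_mem_pointwise_smul _ _ _ trivial
    · have zero1 := AddCommGrpCat.isZero_of_iff_subsingleton.mpr
        (hext i (by rw [List.length_cons]; omega))
      have zero2 := AddCommGrpCat.isZero_of_iff_subsingleton.mpr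
        (hext (i + 1) (by rw [List.length_cons]; omega))
      exact AddCommGrpCat.subsingleton_of_isZero <| ShortComplex.Exact.isZero_of_both_zeros
        ((Ext.covariant_sequence_exact₃' k hx.smulShortComplex_shortExact) i (i + 1) rfl)
        (zero1.eq_zero_of_src _) (zero2.eq_zero_of_tgt _)

/-- In a local ring of depth at least `n`, every system of `n` elements generating an ideal
primary to the maximal ideal is a regular sequence. -/
theorem IsLocalRing.isWeaklyRegular_of_le_radical {A : Type v} [CommRing A] [IsLocalRing A]
    [IsNoetherianRing A] {rs : List A} (hrs : ∀ r ∈ rs, r ∈ maximalIdeal A)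
    (hreg : IsWeaklyRegular A rs) (l : List A) (hlen : l.length = rs.length)
    (hl : ∀ r ∈ l, r ∈ maximalIdeal A) (h : maximalIdeal A ≤ (Ideal.ofList l).radical) :
    IsWeaklyRegular A l := by
  have hne : maximalIdeal A • (⊤ : Submodule A A) < ⊤ := by
    rw [lt_top_iff_ne_top, smul_eq_mul, Ideal.mul_top]
    exact Ideal.IsPrime.ne_top'
  have hk : Module.support A (ModuleCat.of A (A ⧸ maximalIdeal A)) =
      PrimeSpectrum.zeroLocus (maximalIdeal A : Set A) := by
    rw [Module.support_eq_zeroLocus]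
    congr 1
    exact congrArg _ (Ideal.annihilator_quotient)
  refine isWeaklyRegular_of_ext (ModuleCat.of A (A ⧸ maximalIdeal A)) hk l (ModuleCat.of A A) hl
    (h.trans (Ideal.radical_mono le_sup_right)) fun i hi => ?_
  exact ModuleCat.subsingleton_ext_of_exists_isRegular (maximalIdeal A) _ hk.le (ModuleCat.of A A)
    hne rs hrs ((isRegular_iff_isWeaklyRegular_of_subset_maximalIdeal hrs).mpr hreg) i
    (hlen ▸ hi)

end

section

open IsLocalRing RingTheory.Sequence Pointwise

namespace KProd
variable {A : Type v} [CommRing A]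

lemma initIdeal_eq_ofList (y : ℕ → A) (n : ℕ) :
    initIdeal y n = Ideal.ofList ((List.range n).map y) := by
  rw [initIdeal, Ideal.ofList]
  congr 1
  ext a
  simp

lemma isWeaklyRegular_map_range_iff (y : ℕ → A) (n : ℕ) :
    IsWeaklyRegular A ((List.range n).map y) ↔
      ∀ j < n, ∀ r, y j * r ∈ initIdeal y j → r ∈ initIdeal y j := by
  rw [isWeaklyRegular_iff]
  simp only [List.length_map, List.length_range]
  refine forall₂_congr fun j hj => ?_
  have e : (Ideal.ofList (((List.range n).map y).take j) • (⊤ : Submodule A A)) =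
      initIdeal y j := by
    rw [smul_eq_mul, Ideal.mul_top, initIdeal_eq_ofList, ← List.map_take, List.take_range,
      min_eq_left hj.le]
  rw [e]
  simp only [List.getElem_map, List.getElem_range]
  rw [isSMulRegular_iff_right_eq_zero_of_smul]
  constructor
  · intro h r hr
    refine (Submodule.Quotient.mk_eq_zero _).mp (h (Submodule.Quotient.mk r) ?_)
    rw [← Submodule.Quotient.mk_smul]
    exact (Submodule.Quotient.mk_eq_zero _).mpr hr
  · intro h m
    obtain ⟨r, rfl⟩ := Submodule.Quotient.mk_surjective _ m
    rw [← Submodule.Quotient.mk_smul, Submodule.Quotient.mk_eq_zero, Submodule.Quotient.mk_eq_zero]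
    exact h r

end KProd

namespace MvPowerSeries
variable {F : Type v} [Field F] {n : ℕ}

open KProd in
theorem mul_mem_initIdeal_of_X_pow_mem {s : ℕ → MvPowerSeries (Fin n) F}
    (hs : ∀ j < n, s j ∈ maximalIdeal (MvPowerSeries (Fin n) F)) {M : ℕ}
    (hM : ∀ k, (X k : MvPowerSeries (Fin n) F) ^ M ∈ initIdeal s n) :
    ∀ j < n, ∀ r, s j * r ∈ initIdeal s j → r ∈ initIdeal s j := by
  let x : ℕ → MvPowerSeries (Fin n) F := fun j =>
    if h : n - 1 - j < n then X ⟨n - 1 - j, h⟩ else 0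
  have hx (j : ℕ) (hj : j < n) : x j = X ⟨n - 1 - j, by omega⟩ := dif_pos (by omega)
  have key := (isWeaklyRegular_map_range_iff x n).mpr fun j hj r hr => by
    have e : initIdeal x j = Ideal.span ((fun k : Fin n => (X k : MvPowerSeries (Fin n) F) ^ 1) ''
        Set.Ioi ⟨n - 1 - j, by omega⟩) := by
      rw [initIdeal]
      congr 1
      ext a
      constructor
      · rintro ⟨i, hi, rfl⟩
        simp only [Set.mem_Iio] at hi
        refine ⟨⟨n - 1 - i, by omega⟩, ?_, ?_⟩
        · simp only [Set.mem_Ioi, Fin.mk_lt_mk]; omega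
        · rw [hx _ (by omega)]; exact pow_one _
      · rintro ⟨k, hk, rfl⟩
        simp only [Set.mem_Ioi, Fin.lt_def] at hk
        have := k.isLt
        refine ⟨n - 1 - k, ?_, ?_⟩
        · simp only [Set.mem_Iio]; omega
        · rw [hx _ (by omega)]
          simp only [pow_one]
          congr 1
          ext; simp only; omega
    rw [e] at hr ⊢
    refine revRegular_X_pow n 1 _ r ?_
    rwa [hx j hj, ← pow_one (X _)] at hr
  refine (isWeaklyRegular_map_range_iff s n).mp (isWeaklyRegular_of_le_radical
    (rs := (List.range n).map x) ?_ key _ (by simp) ?_ ?_)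
  · intro r hr
    obtain ⟨j, hj, rfl⟩ := List.mem_map.mp hr
    rw [hx j (List.mem_range.mp hj), ← span_range_X]
    exact Ideal.subset_span ⟨_, rfl⟩
  · intro r hr
    obtain ⟨j, hj, rfl⟩ := List.mem_map.mp hr
    exact hs j (List.mem_range.mp hj)
  · rw [← initIdeal_eq_ofList, ← span_range_X, Ideal.span_le]
    rintro _ ⟨k, rfl⟩
    exact ⟨M, hM k⟩

end MvPowerSeries

end

section

open Filter

namespace KProd
variable {A : Type v} [CommRing A]

/-- The coordinatewise pairing. -/
def pair : ∀ {n : ℕ}, KProd n A → KProd n A → A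
  | 0, a, b => (show A from a) * (show A from b)
  | n + 1, (a, b), (c, d) => pair (n := n) a c + pair (n := n) b d

lemma pair_add : ∀ {n : ℕ} (u c d : KProd n A), pair u (c + d) = pair u c + pair u d
  | 0, u, c, d => mul_add (show A from u) _ _
  | _ + 1, (a, b), (c, d), (c', d') => by
    change pair a (c + c') + pair b (d + d') = pair a c + pair b d + (pair a c' + pair b d')
    rw [pair_add, pair_add]; ring

lemma pair_smul (r : A) : ∀ {n : ℕ} (u c : KProd n A), pair u (r • c) = r * pair u c
  | 0, u, c => mul_left_comm (show A from u) r (show A from c)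
  | _ + 1, (a, b), (c, d) => by
    change pair a (r • c) + pair b (r • d) = r * (pair a c + pair b d)
    rw [pair_smul, pair_smul]; ring

lemma pair_comm : ∀ {n : ℕ} (u c : KProd n A), pair u c = pair c u
  | 0, u, c => mul_comm (show A from u) (show A from c)
  | _ + 1, (a, b), (c, d) => congrArg₂ (· + ·) (pair_comm a c) (pair_comm b d)

lemma add_pair {n : ℕ} (u u' c : KProd n A) : pair (u + u') c = pair u c + pair u' c := by
  rw [pair_comm, pair_add, pair_comm c, pair_comm c]

lemma smul_pair {n : ℕ} (r : A) (u c : KProd n A) : pair (r • u) c = r * pair u c := by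
  rw [pair_comm, pair_smul, pair_comm c]

lemma pair_sub {n : ℕ} (u c d : KProd n A) : pair u (c - d) = pair u c - pair u d := by
  rw [sub_eq_add_neg, ← neg_one_smul A d, pair_add, pair_smul]; ring

lemma pair_zero {n : ℕ} (u : KProd n A) : pair u 0 = 0 := by
  rw [← zero_smul A (0 : KProd n A), pair_smul, zero_mul]

lemma sum_pair {ι : Type*} (s : Finset ι) {n : ℕ} (u : ι → KProd n A) (c : KProd n A) :
    pair (∑ i ∈ s, u i) c = ∑ i ∈ s, pair (u i) c := by
  classical
  induction s using Finset.induction_on with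
  | empty => rw [Finset.sum_empty, Finset.sum_empty, pair_comm, pair_zero]
  | insert i s hi ih => rw [Finset.sum_insert hi, Finset.sum_insert hi, add_pair, ih]

lemma pair_del : ∀ {n : ℕ} (x : Fin n → A) (u c : KProd n A), pair u (del x c) = pair (wedge x u) c
  | 0, x, u, c => (mul_zero (show A from u)).trans (zero_mul (show A from c)).symm
  | _ + 1, x, (u, w), (a, b) => by
    rw [del_succ, wedge_succ]
    change pair u (del (Fin.tail x) a + x 0 • b) + pair w (-del (Fin.tail x) b) =
      pair (wedge (Fin.tail x) u) a + pair (x 0 • u - wedge (Fin.tail x) w) b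
    rw [pair_add, pair_smul, pair_del, ← neg_one_smul A (del _ b), pair_smul, pair_del,
      pair_comm (_ - _), pair_sub, pair_smul, pair_comm b, pair_comm b]
    ring

lemma pair_mem_of_right {I : Ideal A} : ∀ {n : ℕ} (u : KProd n A) {c : KProd n A}, c ∈ coef I n →
    pair u c ∈ I
  | 0, u, _, h => I.mul_mem_left (show A from u) h
  | _ + 1, (u, w), (_, _), h => add_mem (pair_mem_of_right u h.1) (pair_mem_of_right w h.2)

lemma pair_mem_of_left {I : Ideal A} {n : ℕ} {u : KProd n A} (c : KProd n A) (h : u ∈ coef I n) :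
    pair u c ∈ I := pair_comm c u ▸ pair_mem_of_right c h

lemma mem_coef_of_forall_pair {I : Ideal A} : ∀ {n : ℕ} {u : KProd n A}, (∀ c, pair u c ∈ I) →
    u ∈ coef I n
  | 0, u, h => by
    have : (show A from u) * 1 ∈ I := h (1 : A)
    rwa [mul_one] at this
  | n + 1, (u, w), h => by
    refine ⟨mem_coef_of_forall_pair fun c => ?_, mem_coef_of_forall_pair fun c => ?_⟩
    · have : pair u c + pair w 0 ∈ I := h ((c, 0) : KProd n A × KProd n A)
      rwa [pair_zero, add_zero] at this
    · have : pair u 0 + pair w c ∈ I := h ((0, c) : KProd n A × KProd n A)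
      rwa [pair_zero, zero_add] at this

lemma exists_mul_eq_of_linearMap {I : Ideal A} (f : A →ₗ[A] A ⧸ I) :
    ∃ u, ∀ c, f c = Ideal.Quotient.mk I (u * c) := by
  obtain ⟨u, hu⟩ := Ideal.Quotient.mk_surjective (f 1)
  refine ⟨u, fun c => ?_⟩
  have := map_smul f c 1
  rw [← hu, smul_eq_mul, mul_one, Algebra.smul_def, Ideal.Quotient.algebraMap_eq] at this
  rw [this, ← map_mul, mul_comm]

/-- Every linear map to a cyclic module is given by a pairing. -/
lemma exists_pair_eq {I : Ideal A} : ∀ {n : ℕ} (f : KProd n A →ₗ[A] A ⧸ I),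
    ∃ u, ∀ c, f c = Ideal.Quotient.mk I (pair u c)
  | 0, f => exists_mul_eq_of_linearMap f
  | n + 1, f => by
    obtain ⟨u, hu⟩ := exists_pair_eq (f.comp (LinearMap.inl A (KProd n A) (KProd n A)))
    obtain ⟨w, hw⟩ := exists_pair_eq (f.comp (LinearMap.inr A (KProd n A) (KProd n A)))
    refine ⟨(u, w), fun (c, d) => ?_⟩
    change _ = Ideal.Quotient.mk I (pair u c + pair w d)
    rw [map_add, ← hu, ← hw]
    have e : ((c, d) : KProd n A × KProd n A) = LinearMap.inl A (KProd n A) (KProd n A) c +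
      LinearMap.inr A (KProd n A) (KProd n A) d := by simp
    exact (congrArg f e).trans (map_add f (LinearMap.inl A (KProd n A) (KProd n A) c) _)

section map
variable {B : Type v} [CommRing B] (f : A →+* B)

/-- Coordinatewise application of a ring homomorphism. -/
noncomputable def mapR (n : ℕ) : KProd n A →+ KProd n B := map (f : A →+ B) n

lemma mapR_smul {n : ℕ} (r : A) (c : KProd n A) : mapR f n (r • c) = f r • mapR f n c :=
  map_smul_of _ (fun m => map_mul f r m) c

lemma mapR_del {n : ℕ} (x : Fin n → A) (c : KProd n A) :
    mapR f n (del x c) = del (fun k => f (x k)) (mapR f n c) :=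
  map_del _ (fun k m => map_mul f (x k) m) c

lemma mapR_wedge {n : ℕ} (x : Fin n → A) (c : KProd n A) :
    mapR f n (wedge x c) = wedge (fun k => f (x k)) (mapR f n c) :=
  map_wedge _ (fun k m => map_mul f (x k) m) c

lemma mapR_wedges {n : ℕ} (v : ℕ → Fin n → A) :
    ∀ j, mapR f n (wedges v j) = wedges (fun j k => f (v j k)) j
  | 0 => by
    rw [wedges, wedges, mapR, map_incl (B := B)]
    exact congrArg _ (map_one f)
  | j + 1 => by rw [wedges, wedges, mapR_wedge, mapR_wedges]

lemma map_pair : ∀ {n : ℕ} (u c : KProd n A), f (pair u c) = pair (mapR f n u) (mapR f n c)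
  | 0, u, c => map_mul f (show A from u) (show A from c)
  | n + 1, (a, b), (c, d) => by
    change f (pair a c + pair b d) = pair (mapR f n a) (mapR f n c) + pair (mapR f n b) (mapR f n d)
    rw [map_add, map_pair, map_pair]

lemma mapR_mem_coef {I : Ideal A} {J : Ideal B} (h : I ≤ J.comap f) {n : ℕ} {c : KProd n A}
    (hc : c ∈ coef I n) : mapR f n c ∈ coef J n :=
  map_mem_coef _ h hc

lemma initIdeal_le_comap (s : ℕ → A) (j : ℕ) :
    initIdeal s j ≤ (initIdeal (fun i => f (s i)) j).comap f := by
  refine Ideal.span_le.mpr ?_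
  rintro _ ⟨i, hi, rfl⟩
  exact mem_initIdeal (fun i => f (s i)) hi

end map

/-- Equational data over `A` obstructing `wedges v d` from being a boundary modulo the ideal
`(s 0, …, s (d-1)) : (b i)`. -/
structure Obstruction (n d N M : ℕ) {r : ℕ} (x : Fin n → A) (s : ℕ → A) (v : ℕ → Fin n → A)
    (b : Fin r → A) (a ρ : A) (μ : Fin r → KProd n A) : Prop where
  sum_eq : ∀ j < n, ∑ k, v j k * x k = s j
  pow_mem : ∀ k, x k ^ M ∈ initIdeal s n
  mul_mem : ∀ i, a * b i ∈ initIdeal s d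
  rho_mul_mem : ∀ j < d, ρ * s j ∈ Ideal.span (Set.range fun k => x k ^ (N + 1))
  rho_mul_sub : ρ * a - ∏ k, x k ^ N ∈ Ideal.span (Set.range fun k => x k ^ (N + 1))
  pair_sub : ∑ i, pair (μ i) (b i • wedges v d) - ∏ k, x k ^ N ∈
    Ideal.span (Set.range fun k => x k ^ (N + 1))
  wedge_mem : ∑ i, b i • wedge x (μ i) ∈ coef (Ideal.span (Set.range fun k => x k ^ (N + 1))) n
  smul_mem : ∀ j < d, ∀ i, s j • μ i ∈ coef (Ideal.span (Set.range fun k => x k ^ (N + 1))) n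

variable {n d N M r : ℕ} {x : Fin n → A} {s : ℕ → A} {v : ℕ → Fin n → A}
  {b : Fin r → A} {a ρ : A} {μ : Fin r → KProd n A}

lemma Obstruction.map {B : Type v} [CommRing B] (f : A →+* B)
    (h : Obstruction n d N M x s v b a ρ μ) :
    Obstruction n d N M (fun k => f (x k)) (fun j => f (s j)) (fun j k => f (v j k))
      (fun i => f (b i)) (f a) (f ρ) (fun i => mapR f n (μ i)) := by
  have hq : Ideal.span (Set.range fun k => x k ^ (N + 1)) ≤
      (Ideal.span (Set.range fun k => f (x k) ^ (N + 1))).comap f := by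
    rw [Ideal.span_le]
    rintro _ ⟨k, rfl⟩
    rw [SetLike.mem_coe, Ideal.mem_comap, map_pow]
    exact Ideal.subset_span ⟨k, rfl⟩
  constructor
  · intro j hj
    rw [← h.sum_eq j hj, map_sum]
    simp only [map_mul]
  · intro k
    have := initIdeal_le_comap f s n (h.pow_mem k)
    rwa [Ideal.mem_comap, map_pow] at this
  · intro i
    have := initIdeal_le_comap f s d (h.mul_mem i)
    rwa [Ideal.mem_comap, map_mul] at this
  · intro j hj
    have := hq (h.rho_mul_mem j hj)
    rwa [Ideal.mem_comap, map_mul] at this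
  · have := hq h.rho_mul_sub
    simpa only [Ideal.mem_comap, map_sub, map_mul, map_prod, map_pow] using this
  · have := hq h.pair_sub
    simpa only [Ideal.mem_comap, map_sub, map_sum, map_mul, map_prod, map_pow, map_pair, mapR_smul,
      mapR_wedges] using this
  · have := mapR_mem_coef f hq h.wedge_mem
    simpa only [map_sum, mapR_smul, mapR_wedge] using this
  · intro j hj i
    have := mapR_mem_coef f hq (h.smul_mem j hj i)
    rwa [mapR_smul] at this

end KProd

namespace MvPowerSeries
open KProd
variable {n d N M r : ℕ}

theorem not_obstruction_of_charP {p : ℕ} {F : Type v} [Field F] [Fact p.Prime]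
    [CharP F p] [PerfectRing F p] (hd : d ≤ n) {s : ℕ → MvPowerSeries (Fin n) F}
    {v : ℕ → Fin n → MvPowerSeries (Fin n) F} {b : Fin r → MvPowerSeries (Fin n) F}
    {a ρ : MvPowerSeries (Fin n) F} {μ : Fin r → KProd n (MvPowerSeries (Fin n) F)} :
    ¬ Obstruction n d N M X s v b a ρ μ := by
  intro h
  have hσ : (∏ k : Fin n, (X k : MvPowerSeries (Fin n) F) ^ N) ∉ powIdeal n F N := by
    rw [mem_powIdeal]
    intro h
    have e : (∏ k : Fin n, (X k : MvPowerSeries (Fin n) F) ^ N) = monomial (topExp n N) 1 := by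
      rw [monomial_one_eq, Finsupp.prod_fintype _ _ (fun i => pow_zero _)]
      simp [topExp]
    have := h (topExp n N) le_rfl
    rw [e, coeff_monomial_same] at this
    exact one_ne_zero this
  have hs : ∀ j < n, s j ∈ IsLocalRing.maximalIdeal (MvPowerSeries (Fin n) F) := fun j hj => by
    rw [← h.sum_eq j hj, ← span_range_X]
    exact sum_mem fun k _ => Ideal.mul_mem_left _ _ (Ideal.subset_span ⟨k, rfl⟩)
  have hy := mul_mem_initIdeal_of_X_pow_mem hs h.pow_mem
  let 𝔞 : Ideal (MvPowerSeries (Fin n) F) :=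
    ⨅ i, Submodule.comap (LinearMap.mulRight (MvPowerSeries (Fin n) F) (b i)) (initIdeal s d)
  have mem𝔞 : ∀ a, a ∈ 𝔞 ↔ ∀ i, a * b i ∈ initIdeal s d := fun a => by
    simp only [𝔞, Submodule.mem_iInf]; rfl
  have ha' : a ∉ initIdeal s d := fun ha' => hσ (by
    have h1 : ρ * a ∈ powIdeal n F N := by
      have : initIdeal s d ≤
          Submodule.comap (LinearMap.mulLeft (MvPowerSeries (Fin n) F) ρ) (powIdeal n F N) := by
        refine Ideal.span_le.mpr ?_
        rintro _ ⟨j, hj, rfl⟩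
        exact h.rho_mul_mem j hj
      exact this ha'
    have := sub_mem h1 h.rho_mul_sub
    rwa [sub_sub_cancel] at this)
  obtain ⟨c, hc⟩ := mem_bdry.mp (wedges_mem_bdry_of_charP (fun j hj => h.sum_eq j (by omega))
    (fun j hj => hy j (by omega)) mem𝔞 ((mem𝔞 a).mpr h.mul_mem) ha')
  refine hσ ?_
  have e : ∑ i, pair (μ i) (b i • wedges v d) =
      ∑ i, pair (μ i) (b i • (wedges v d - del (X : Fin n → MvPowerSeries (Fin n) F) c)) +
      pair (∑ i, b i • wedge (X : Fin n → MvPowerSeries (Fin n) F) (μ i)) c := by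
    rw [sum_pair, ← Finset.sum_add_distrib]
    refine Finset.sum_congr rfl fun i _ => ?_
    rw [smul_pair, ← pair_del X, pair_smul, pair_smul, KProd.pair_sub]
    ring
  have h1 : ∀ i, pair (μ i) (b i • (wedges v d - del (X : Fin n → MvPowerSeries (Fin n) F) c)) ∈
      powIdeal n F N := fun i => by
    have h2 : b i • (wedges v d - del (X : Fin n → MvPowerSeries (Fin n) F) c) ∈ coef (initIdeal s d) n :=
      smul_mem_coef (N := 𝔞) (b i) (fun m hm => by
        rw [smul_eq_mul, mul_comm]; exact (mem𝔞 m).mp hm i) hc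
    generalize b i • (wedges v d - del (X : Fin n → MvPowerSeries (Fin n) F) c) = w at h2
    have : ∀ j ≤ d, ∀ w, w ∈ coef (initIdeal s j) n → pair (μ i) w ∈ powIdeal n F N := by
      intro j
      induction j with
      | zero =>
        intro _ w hw
        rw [initIdeal_zero] at hw
        rw [coef_bot hw, pair_zero]
        exact zero_mem _
      | succ j ih =>
        intro hj w hw
        rw [initIdeal_succ] at hw
        obtain ⟨w₁, hw₁, w₂, hw₂, rfl⟩ := exists_of_coef_sup hw
        obtain ⟨w₀, rfl⟩ := exists_of_coef_span hw₁
        rw [pair_add, pair_smul, ← smul_pair]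
        exact add_mem (pair_mem_of_left _ (h.smul_mem j (by omega) i)) (ih (by omega) w₂ hw₂)
    exact this d le_rfl w h2
  have h3 := h.pair_sub
  rw [e] at h3
  have h4 := sub_mem (add_mem (sum_mem fun i (_ : i ∈ Finset.univ) => h1 i)
    (pair_mem_of_left c h.wedge_mem)) h3
  rwa [sub_sub_cancel] at h4

end MvPowerSeries

end

section

open Filter

namespace KProd

lemma wedges_congr {A : Type v} [CommRing A] {n : ℕ} {v v' : ℕ → Fin n → A} :
    ∀ {d : ℕ}, (∀ j < d, v j = v' j) → (wedges v d : KProd n A) = wedges v' d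
  | 0, _ => rfl
  | d + 1, h => by
    rw [wedges, wedges, h d d.lt_succ_self, wedges_congr fun j hj => h j (hj.trans d.lt_succ_self)]

lemma initIdeal_eq_span_range {A : Type v} [CommRing A] (s : ℕ → A) (j : ℕ) :
    initIdeal s j = Ideal.span (Set.range fun i : Set.Iio j => s i) := by
  rw [initIdeal, Set.image_eq_range]

variable {T : Type v} [CommRing T]

lemma eventually_mem_closure (t : T) :
    ∀ᶠ S : Finset T in atTop, t ∈ Subring.closure (S : Set T) := by
  filter_upwards [eventually_ge_atTop {t}] with S hS
  exact Subring.subset_closure (hS (Finset.mem_singleton_self t))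

lemma eventually_exists_mapR_eq : ∀ {n : ℕ} (c : KProd n T),
    ∀ᶠ S : Finset T in atTop, ∃ c' : KProd n (Subring.closure (S : Set T)),
      mapR (Subring.closure (S : Set T)).subtype n c' = c
  | 0, c => by
    filter_upwards [eventually_mem_closure (show T from c)] with S hS
    exact ⟨(⟨c, hS⟩ : Subring.closure (S : Set T)), rfl⟩
  | n + 1, (a, b) => by
    filter_upwards [eventually_exists_mapR_eq a, eventually_exists_mapR_eq b] with S ⟨a', ha⟩ ⟨b', hb⟩
    exact ⟨(a', b'), ext_succ ha hb⟩

lemma eventually_mem_span {ι : Type*} {q : ι → T} {t : T} (ht : t ∈ Ideal.span (Set.range q)) :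
    ∀ᶠ S : Finset T in atTop, ∀ q' : ι → Subring.closure (S : Set T), (∀ i, (q' i : T) = q i) →
      ∀ t' : Subring.closure (S : Set T), (t' : T) = t → t' ∈ Ideal.span (Set.range q') := by
  obtain ⟨c, rfl⟩ := Finsupp.mem_ideal_span_range_iff_exists_finsupp.mp ht
  have := (c.support.eventually_all (l := atTop)
    (p := fun i (S : Finset T) => c i ∈ Subring.closure (S : Set T))).mpr
      fun i _ => eventually_mem_closure (c i)
  filter_upwards [this] with S hS q' hq t' ht'
  have e : t' = ∑ i ∈ c.support.attach, ⟨c i, hS i i.2⟩ * q' i := by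
    apply Subtype.ext
    rw [ht', Finsupp.sum, ← Finset.sum_attach]
    push_cast
    exact Finset.sum_congr rfl fun i _ => by rw [hq]
  rw [e]
  exact sum_mem fun i _ => Ideal.mul_mem_left _ _ (Ideal.subset_span ⟨i, rfl⟩)

lemma eventually_mem_coef {ι : Type*} {q : ι → T} : ∀ {n : ℕ} {c : KProd n T},
    c ∈ coef (Ideal.span (Set.range q)) n →
    ∀ᶠ S : Finset T in atTop, ∀ q' : ι → Subring.closure (S : Set T), (∀ i, (q' i : T) = q i) →
      ∀ c' : KProd n (Subring.closure (S : Set T)),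
        mapR (Subring.closure (S : Set T)).subtype n c' = c → c' ∈ coef (Ideal.span (Set.range q')) n
  | 0, _, hc => eventually_mem_span hc
  | n + 1, (a, b), hc => by
    filter_upwards [eventually_mem_coef hc.1, eventually_mem_coef hc.2] with S h1 h2 q' hq c' hc'
    exact ⟨h1 q' hq c'.1 (congrArg Prod.fst hc'), h2 q' hq c'.2 (congrArg Prod.snd hc')⟩

variable {n d N M r : ℕ} {x : Fin n → T} {s : ℕ → T} {v : ℕ → Fin n → T}
  {b : Fin r → T} {a ρ : T} {μ : Fin r → KProd n T}

lemma eventually_mem_initIdeal {j : ℕ} {t : T} (ht : t ∈ initIdeal s j) :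
    ∀ᶠ S : Finset T in atTop, ∀ s' : ℕ → Subring.closure (S : Set T),
      (∀ i < j, (s' i : T) = s i) →
      ∀ t' : Subring.closure (S : Set T), (t' : T) = t → t' ∈ initIdeal s' j := by
  rw [initIdeal_eq_span_range] at ht
  filter_upwards [eventually_mem_span ht] with S hS s' hs t' ht'
  rw [initIdeal_eq_span_range]
  exact hS (fun i => s' i) (fun i => hs i i.2) t' ht'

/-- An obstruction descends to all large enough finitely generated subrings. -/
theorem Obstruction.eventually_closure (hd : d ≤ n) (h : Obstruction n d N M x s v b a ρ μ) :
    ∀ᶠ S : Finset T in atTop, (∀ k, x k ∈ S) ∧ ∀ x' : Fin n → Subring.closure (S : Set T),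
      (∀ k, (x' k : T) = x k) → ∃ s' v' b' a' ρ' μ', Obstruction n d N M x' s' v' b' a' ρ'
        (μ' : Fin r → KProd n (Subring.closure (S : Set T))) := by
  have e1 := ((Finset.range n).eventually_all (l := atTop)
    (p := fun j (S : Finset T) => s j ∈ Subring.closure (S : Set T))).mpr
      fun j _ => eventually_mem_closure (s j)
  have e2 := ((Finset.range n).eventually_all (l := atTop)
    (p := fun j (S : Finset T) => ∀ k, v j k ∈ Subring.closure (S : Set T))).mpr
      fun j _ => eventually_all.mpr fun k => eventually_mem_closure (v j k)
  have e3 := eventually_all.mpr fun i => eventually_mem_closure (b i)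
  have e4 := eventually_all.mpr fun i => eventually_exists_mapR_eq (μ i)
  have f1 := eventually_all.mpr fun k => eventually_mem_initIdeal (h.pow_mem k)
  have f2 := eventually_all.mpr fun i => eventually_mem_initIdeal (h.mul_mem i)
  have f3 := ((Finset.range d).eventually_all (l := atTop)).mpr fun j hj =>
    eventually_mem_span (h.rho_mul_mem j (Finset.mem_range.mp hj))
  have f4 := ((Finset.range d).eventually_all (l := atTop)).mpr fun j hj => eventually_all.mpr fun i =>
    eventually_mem_coef (h.smul_mem j (Finset.mem_range.mp hj) i)
  have e5 : ∀ᶠ S : Finset T in atTop, ∀ k, x k ∈ S := eventually_all.mpr fun k => by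
    filter_upwards [eventually_ge_atTop {x k}] with S hS using hS (Finset.mem_singleton_self _)
  filter_upwards [e1, e2, e3, e4, e5, eventually_mem_closure a, eventually_mem_closure ρ, f1, f2, f3,
    f4, eventually_mem_span h.rho_mul_sub, eventually_mem_span h.pair_sub,
    eventually_mem_coef h.wedge_mem] with S hs hv hb hμ hxS ha hρ g1 g2 g3 g4 g5 g6 g7
  refine ⟨hxS, fun x' hx => ?_⟩
  choose μ' hμ' using hμ
  choose! s' hs' using fun j (hj : j ∈ Finset.range n) =>
    (⟨⟨s j, hs j hj⟩, rfl⟩ : ∃ t : Subring.closure (S : Set T), (t : T) = s j)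
  choose! v' hv' using fun j (hj : j ∈ Finset.range n) =>
    (⟨fun k => ⟨v j k, hv j hj k⟩, rfl⟩ : ∃ t : Fin n → Subring.closure (S : Set T),
      (fun k => (t k : T)) = v j)
  replace hs' : ∀ j < n, (s' j : T) = s j := fun j hj => hs' j (Finset.mem_range.mpr hj)
  replace hv' : ∀ j < n, (fun k => (v' j k : T)) = v j := fun j hj => hv' j (Finset.mem_range.mpr hj)
  have hxf : (fun k => (Subring.closure (S : Set T)).subtype (x' k)) = x := funext hx
  have hq : ∀ k, ((x' k ^ (N + 1) : Subring.closure (S : Set T)) : T) = x k ^ (N + 1) := fun k => by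
    rw [SubmonoidClass.coe_pow, hx]
  have hw : mapR (Subring.closure (S : Set T)).subtype n (wedges v' d) = wedges v d := by
    rw [mapR_wedges]
    exact wedges_congr fun j hj => hv' j (by omega)
  refine ⟨s', v', fun i => ⟨b i, hb i⟩, ⟨a, ha⟩, ⟨ρ, hρ⟩, μ', ?_⟩
  constructor
  · intro j hj
    apply Subtype.ext
    rw [hs' j hj, ← h.sum_eq j hj]
    push_cast
    exact Finset.sum_congr rfl fun k _ => by rw [hx, ← hv' j hj]
  · exact fun k => g1 k s' hs' _ (by rw [SubmonoidClass.coe_pow, hx])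
  · exact fun i => g2 i s' (fun j hj => hs' j (by omega)) _ rfl
  · refine fun j hj => g3 j (Finset.mem_range.mpr hj) _ hq _ ?_
    rw [MulMemClass.coe_mul, hs' j (by omega)]
  · refine g5 _ hq _ ?_
    push_cast
    simp only [hx]
  · refine g6 _ hq _ ?_
    push_cast
    congr 1
    · refine Finset.sum_congr rfl fun i _ => ?_
      rw [← hμ', ← hw]
      have := map_pair (Subring.closure (S : Set T)).subtype (μ' i)
        ((⟨b i, hb i⟩ : Subring.closure (S : Set T)) • wedges v' d)
      rw [mapR_smul] at this
      exact this
    · simp only [hx]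
  · refine g7 _ hq _ ?_
    rw [map_sum]
    refine Finset.sum_congr rfl fun i _ => ?_
    rw [mapR_smul, mapR_wedge, hμ', hxf]
    rfl
  · refine fun j hj i => g4 j (Finset.mem_range.mpr hj) i _ hq _ ?_
    rw [mapR_smul, hμ', ← hs' j (by omega)]
    rfl

end KProd

namespace MvPowerSeries
open KProd

theorem not_obstruction {n d N M r : ℕ} {K : Type v} [Field K] (hd : d ≤ n)
    {s : ℕ → MvPowerSeries (Fin n) K}
    {v : ℕ → Fin n → MvPowerSeries (Fin n) K} {b : Fin r → MvPowerSeries (Fin n) K}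
    {a ρ : MvPowerSeries (Fin n) K} {μ : Fin r → KProd n (MvPowerSeries (Fin n) K)} :
    ¬ Obstruction n d N M X s v b a ρ μ := by
  intro h
  obtain ⟨S, hS, hx⟩ := (h.eventually_closure hd).exists
  obtain ⟨F, _, p, _, _, _, Φ, hΦ⟩ := hasSpecializations K n S S.finite_toSet hS
  obtain ⟨s', v', b', a', ρ', μ', h'⟩ := hx (fun k => ⟨X k, Subring.subset_closure (hS k)⟩)
    fun _ => rfl
  have h2 := h'.map Φ
  rw [show (fun k => Φ ⟨X k, Subring.subset_closure (hS k)⟩) = X from funext hΦ] at h2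
  exact not_obstruction_of_charP (p := p) hd h2

end MvPowerSeries

end

namespace KProd

section
variable {A : Type v} [CommRing A]

lemma module_finite : ∀ n, Module.Finite A (KProd n A)
  | 0 => inferInstanceAs (Module.Finite A A)
  | n + 1 => by
    have : Module.Finite A (KProd n A) := module_finite n
    exact inferInstanceAs (Module.Finite A (KProd n A × KProd n A))

lemma mem_smul_top {I : Ideal A} {a : A} (ha : a ∈ I) : a ∈ I • (⊤ : Submodule A A) := by
  rwa [smul_eq_mul, Ideal.mul_top]

lemma coef_le_smul_top (I : Ideal A) : ∀ n, coef I n ≤ I • (⊤ : Submodule A (KProd n A))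
  | 0 => fun _ ha => mem_smul_top (A := A) ha
  | n + 1 => by
    rintro ⟨a, b⟩ ⟨ha, hb⟩
    have e : ((a, b) : KProd n A × KProd n A) = LinearMap.inl A (KProd n A) (KProd n A) a +
      LinearMap.inr A (KProd n A) (KProd n A) b := by simp
    have h (f : KProd n A →ₗ[A] KProd n A × KProd n A) {c} (hc : c ∈ coef I n) :
        f c ∈ I • (⊤ : Submodule A (KProd n A × KProd n A)) := by
      have := Submodule.mem_map_of_mem (f := f) (coef_le_smul_top I n hc)
      rw [Submodule.map_smul''] at this
      exact Submodule.smul_mono le_rfl le_top this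
    have key : ((a, b) : KProd n A × KProd n A) ∈ I • (⊤ : Submodule A (KProd n A × KProd n A)) := by
      rw [e]
      exact add_mem (h _ ha) (h _ hb)
    exact key

end

variable {R T : Type v} [CommRing R] [CommRing T] (φ : R →+* T) {𝔮 : Ideal T}

lemma exists_sub_mapR_mem {I : Ideal R} {J : Ideal T} (h : ∀ t ∈ J, ∃ r ∈ I, t - φ r ∈ 𝔮) :
    ∀ {n : ℕ} {c : KProd n T}, c ∈ coef J n → ∃ c' ∈ coef I n, c - mapR φ n c' ∈ coef 𝔮 n
  | 0, _, hc => h _ hc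
  | n + 1, (a, b), hc => by
    obtain ⟨a', ha, ha'⟩ := exists_sub_mapR_mem h hc.1
    obtain ⟨b', hb, hb'⟩ := exists_sub_mapR_mem h hc.2
    exact ⟨(a', b'), ⟨ha, hb⟩, ⟨ha', hb'⟩⟩

lemma exists_sub_mem_of_mem_initIdeal (h : ∀ t, ∃ r, t - φ r ∈ 𝔮) (s : ℕ → R) (d : ℕ) (t : T)
    (ht : t ∈ initIdeal (fun j => φ (s j)) d) : ∃ r ∈ initIdeal s d, t - φ r ∈ 𝔮 := by
  induction ht using Submodule.span_induction with
  | mem t ht =>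
    obtain ⟨j, hj, rfl⟩ := ht
    exact ⟨s j, mem_initIdeal s hj, by simp⟩
  | zero => exact ⟨0, zero_mem _, by simp⟩
  | add t t' _ _ ht ht' =>
    obtain ⟨r, hr, hr'⟩ := ht
    obtain ⟨r', hr₁, hr₁'⟩ := ht'
    refine ⟨r + r', add_mem hr hr₁, ?_⟩
    rw [map_add, add_sub_add_comm]
    exact add_mem hr' hr₁'
  | smul c t _ ht =>
    obtain ⟨r, hr, hr'⟩ := ht
    obtain ⟨c', hc⟩ := h c
    refine ⟨c' * r, Ideal.mul_mem_left _ _ hr, ?_⟩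
    have : c • t - φ (c' * r) = c * (t - φ r) + φ r * (c - φ c') := by
      rw [map_mul, smul_eq_mul]; ring
    rw [this]
    exact add_mem (Ideal.mul_mem_left _ _ hr') (Ideal.mul_mem_left _ _ hc)

/-- The submodule of tuples with entries having coefficients in `I`. -/
noncomputable def coefs {A : Type v} [CommRing A] (I : Ideal A) (n r : ℕ) :
    Submodule A (Fin r → KProd n A) :=
  Submodule.pi Set.univ fun _ => coef I n

lemma mem_coefs {A : Type v} [CommRing A] {I : Ideal A} {n r : ℕ} {w : Fin r → KProd n A} :
    w ∈ coefs I n r ↔ ∀ i, w i ∈ coef I n := by simp [coefs, Submodule.mem_pi]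

lemma coefs_le_smul_top {A : Type v} [CommRing A] (I : Ideal A) (n r : ℕ) :
    coefs I n r ≤ I • (⊤ : Submodule A (Fin r → KProd n A)) := by
  intro w hw
  rw [← Finset.univ_sum_single w]
  refine sum_mem fun i _ => ?_
  have := Submodule.mem_map_of_mem (f := LinearMap.single A (fun _ : Fin r => KProd n A) i)
    (coef_le_smul_top I n (mem_coefs.mp hw i))
  rw [Submodule.map_smul''] at this
  exact Submodule.smul_mono le_rfl le_top this

/-- The multiples of boundaries, modulo an ideal. -/
noncomputable def bdrys {A : Type v} [CommRing A] {n r : ℕ} (x : Fin n → A) (b : Fin r → A)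
    (I : Ideal A) : Submodule A (Fin r → KProd n A) :=
  LinearMap.range (LinearMap.pi fun i => b i • del (M := A) x) ⊔ coefs I n r

lemma mem_bdrys {A : Type v} [CommRing A] {n r : ℕ} {x : Fin n → A} {b : Fin r → A}
    {I J : Ideal A} {w : Fin r → KProd n A} :
    w ∈ bdrys x b I ⊔ coefs J n r ↔ ∃ c, ∃ u ∈ coefs I n r,
      ∀ i, w i - b i • del x c - u i ∈ coef J n := by
  constructor
  · intro h
    obtain ⟨w₁, hw₁, q, hq, rfl⟩ := Submodule.mem_sup.mp h
    obtain ⟨_, ⟨c, rfl⟩, u, hu, rfl⟩ := Submodule.mem_sup.mp hw₁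
    refine ⟨c, u, hu, fun i => ?_⟩
    convert mem_coefs.mp hq i using 1
    simp only [Pi.add_apply, LinearMap.pi_apply, LinearMap.smul_apply]
    abel
  · rintro ⟨c, u, hu, h⟩
    have e : w = (LinearMap.pi fun i => b i • del (M := A) x) c + u +
        fun i => w i - b i • del x c - u i := by
      ext i
      simp only [Pi.add_apply, LinearMap.pi_apply, LinearMap.smul_apply]
      abel
    rw [e]
    exact add_mem (Submodule.mem_sup_left (add_mem (Submodule.mem_sup_left ⟨c, rfl⟩)
      (Submodule.mem_sup_right hu))) (Submodule.mem_sup_right (mem_coefs.mpr h))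

end KProd

namespace MvPowerSeries
open KProd

/-- `φ` presents `R` as a dense subring of a power series ring, compatibly with the powers of the
parameters `x`. -/
structure IsChart {n : ℕ} {R K : Type v} [CommRing R] [Field K]
    (φ : R →+* MvPowerSeries (Fin n) K) (x : Fin n → R) : Prop where
  map_x : ∀ k, φ (x k) = X k
  mem_of_map_mem : ∀ N r, φ r ∈ powIdeal n K N → r ∈ Ideal.span (Set.range fun k => x k ^ (N + 1))
  exists_sub_mem : ∀ N t, ∃ r, t - φ r ∈ powIdeal n K N

variable {n d r : ℕ} {R K : Type v} [CommRing R] [Field K]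

/-- Failure of the boundary condition over `T` yields an obstruction. -/
theorem exists_obstruction {N M : ℕ} {s : ℕ → MvPowerSeries (Fin n) K}
    {v : ℕ → Fin n → MvPowerSeries (Fin n) K}
    (hv : ∀ j < n, ∑ k, v j k * X k = s j)
    (hM : ∀ k, (X k : MvPowerSeries (Fin n) K) ^ M ∈ initIdeal s n)
    {b : Fin r → MvPowerSeries (Fin n) K} {a : MvPowerSeries (Fin n) K}
    (ha : ∀ i, a * b i ∈ initIdeal s d) (ha' : a ∉ initIdeal s d ⊔ powIdeal n K N)
    (hz : (fun i => b i • wedges v d) ∉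
      bdrys (X : Fin n → MvPowerSeries (Fin n) K) b (initIdeal s d) ⊔ coefs (powIdeal n K N) n r) :
    ∃ ρ μ, Obstruction n d N M X s v b a ρ μ := by
  have e : (∏ k : Fin n, (X k : MvPowerSeries (Fin n) K) ^ N) = monomial (topExp n N) 1 := by
    rw [monomial_one_eq, Finsupp.prod_fintype _ _ (fun i => pow_zero _)]
    simp [topExp]
  obtain ⟨ρ, hρ, hρ'⟩ : ∃ ρ, (∀ t ∈ initIdeal s d, t * ρ ∈ powIdeal n K N) ∧
      a * ρ ∉ powIdeal n K N := by
    by_contra! h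
    exact ha' (mem_of_forall_mul_mem N h)
  obtain ⟨t, ht⟩ := exists_mul_sub_mem_powIdeal N hρ'
  set W := bdrys (X : Fin n → MvPowerSeries (Fin n) K) b (initIdeal s d) ⊔
    coefs (powIdeal n K N) n r with hW
  obtain ⟨f, hf⟩ := exists_linearMap_eq_top (n := n) (K := K) N
    (M := (Fin r → KProd n (MvPowerSeries (Fin n) K)) ⧸ W)
    (fun t ht m => by
      obtain ⟨w, rfl⟩ := Submodule.Quotient.mk_surjective _ m
      rw [← Submodule.Quotient.mk_smul, Submodule.Quotient.mk_eq_zero]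
      exact Submodule.mem_sup_right (mem_coefs.mpr fun i => smul_mem_coef_of_mem ht _))
    (v := Submodule.Quotient.mk fun i => b i • wedges v d)
    (fun h => hz ((Submodule.Quotient.mk_eq_zero _).mp h))
  choose μ hμ using fun i => exists_pair_eq ((f.comp W.mkQ).comp
    (LinearMap.single _ (fun _ : Fin r => KProd n (MvPowerSeries (Fin n) K)) i))
  have hfμ : ∀ w, f (Submodule.Quotient.mk w) = Ideal.Quotient.mk _ (∑ i, pair (μ i) (w i)) := by
    intro w
    rw [map_sum]
    conv_lhs => rw [← Finset.univ_sum_single w]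
    change (f.comp W.mkQ) _ = _
    rw [map_sum]
    exact Finset.sum_congr rfl fun i _ => hμ i (w i)
  have hfW : ∀ w ∈ W, ∑ i, pair (μ i) (w i) ∈ powIdeal n K N := fun w hw => by
    rw [← Ideal.Quotient.eq_zero_iff_mem, ← hfμ, (Submodule.Quotient.mk_eq_zero _).mpr hw, map_zero]
  refine ⟨t * ρ, μ, hv, hM, ha, fun j hj => ?_, ?_, ?_, ?_, fun j hj i => ?_⟩
  · rw [mul_assoc, mul_comm ρ]
    exact Ideal.mul_mem_left _ _ (hρ _ (mem_initIdeal s hj))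
  · rw [e, mul_assoc, mul_comm ρ]
    exact ht
  · rw [e, ← Ideal.Quotient.eq_zero_iff_mem (I := Ideal.span _), map_sub, sub_eq_zero]
    exact (hfμ _).symm.trans hf
  · refine mem_coef_of_forall_pair fun c => ?_
    have := hfW _ (Submodule.mem_sup_left (Submodule.mem_sup_left ⟨c, rfl⟩))
    change _ ∈ powIdeal n K N
    rw [sum_pair]
    have e' : ∑ i, pair (b i • wedge X (μ i)) c =
        ∑ i, pair (μ i) (b i • del (M := MvPowerSeries (Fin n) K) X c) :=
      Finset.sum_congr rfl fun i _ => by rw [smul_pair, ← pair_del, ← pair_smul]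
    rw [e']
    exact this
  · refine mem_coef_of_forall_pair fun c => ?_
    have := hfW (Pi.single i (s j • c)) (Submodule.mem_sup_left (Submodule.mem_sup_right
      (mem_coefs.mpr fun l => by
        rcases eq_or_ne l i with rfl | h
        · rw [Pi.single_eq_same]; exact smul_mem_coef_of_mem (mem_initIdeal s hj) _
        · rw [Pi.single_eq_of_ne h]; exact zero_mem _)))
    rw [Finset.sum_eq_single i (fun l _ h => by rw [Pi.single_eq_of_ne h, pair_zero]) (by simp),
      Pi.single_eq_same, pair_smul, ← smul_pair] at this
    exact this

/-- The fundamental cycle of a sequence that extends to a system of parameters is a boundary modulo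
any proper colon ideal `(s 0, …, s (d-1)) : (b i)`. -/
theorem IsChart.wedges_mem_bdry [IsLocalRing R] [IsNoetherianRing R]
    {φ : R →+* MvPowerSeries (Fin n) K} {x : Fin n → R} (hφ : IsChart φ x)
    (hx : ∀ k, x k ∈ IsLocalRing.maximalIdeal R) (hd : d ≤ n) {s : ℕ → R} {v : ℕ → Fin n → R}
    (hv : ∀ j < n, ∑ k, v j k * x k = s j) {M : ℕ} (hM : ∀ k, x k ^ M ∈ initIdeal s n)
    {b : Fin r → R} {𝔞 : Ideal R} (mem𝔞 : ∀ a, a ∈ 𝔞 ↔ ∀ i, a * b i ∈ initIdeal s d)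
    (hne : ¬ 𝔞 ≤ initIdeal s d) : wedges v d ∈ bdry x 𝔞 := by
  obtain ⟨a, ha, ha'⟩ := Set.not_subset.mp hne
  by_contra hz
  let q (N : ℕ) : Ideal R := Ideal.span (Set.range fun k => x k ^ (N + 1))
  have hq (N : ℕ) : q N ≤ IsLocalRing.maximalIdeal R ^ N := by
    refine Ideal.span_le.mpr ?_
    rintro _ ⟨k, rfl⟩
    exact Ideal.pow_le_pow_right (Nat.le_succ N) (Ideal.pow_mem_pow (hx k) _)
  have hm {N N' : ℕ} (h : N ≤ N') : q N' ≤ q N := by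
    refine Ideal.span_le.mpr ?_
    rintro _ ⟨k, rfl⟩
    exact Ideal.mem_of_dvd _ (pow_dvd_pow _ (by omega)) (Ideal.subset_span ⟨k, rfl⟩)
  obtain ⟨N₁, hN₁⟩ : ∃ N, a ∉ initIdeal s d ⊔ q N := by
    by_contra! h
    exact ha' (Ideal.mem_of_forall_mem_sup_pow' fun k => sup_le_sup le_rfl (hq k) (h k))
  obtain ⟨N₂, hN₂⟩ : ∃ N, (fun i => b i • wedges v d) ∉ bdrys x b (initIdeal s d) ⊔
      coefs (q N) n r := by
    by_contra! h
    have : Module.Finite R (KProd n R) := module_finite n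
    have h0 := Ideal.mem_of_forall_mem_sup_pow fun k => sup_le_sup le_rfl
      ((coefs_le_smul_top (q k) n r).trans (Submodule.smul_mono_left (hq k))) (h k)
    obtain ⟨c, u, hu, hc⟩ := mem_bdrys (J := ⊥).mp (Submodule.mem_sup_left h0)
    refine hz (mem_bdry.mpr ⟨c, mem_coef_of_forall b (fun m hm => (mem𝔞 m).mpr fun i => ?_)
      (N' := initIdeal s d) fun i => ?_⟩)
    · rw [mul_comm]; exact hm i
    · have := mem_coefs.mp hu i
      rw [← sub_eq_zero.mp (coef_bot (hc i)), ← smul_sub] at this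
      exact this
  obtain ⟨N, h1, h2⟩ : ∃ N, N₁ ≤ N ∧ N₂ ≤ N := ⟨max N₁ N₂, le_max_left _ _, le_max_right _ _⟩
  have key : ∃ ρ μ, Obstruction n d N M X (fun j => φ (s j)) (fun j k => φ (v j k))
      (fun i => φ (b i)) (φ a) ρ μ := by
    have approx := exists_sub_mem_of_mem_initIdeal φ (hφ.exists_sub_mem N) s d
    refine exists_obstruction (fun j hj => ?_) (fun k => ?_) (fun i => ?_) (fun h => hN₁ ?_)
      (fun h => hN₂ ?_)
    · rw [← hv j hj, map_sum]
      simp only [map_mul, hφ.map_x]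
    · have := initIdeal_le_comap φ s n (hM k)
      rwa [Ideal.mem_comap, map_pow, hφ.map_x] at this
    · have := initIdeal_le_comap φ s d ((mem𝔞 a).mp ha i)
      rwa [Ideal.mem_comap, map_mul] at this
    · obtain ⟨t, ht, t', ht', h⟩ := Submodule.mem_sup.mp h
      obtain ⟨r, hr, hr'⟩ := approx t ht
      have h3 : φ (a - r) ∈ powIdeal n K N := by
        rw [map_sub, ← h, add_sub_right_comm]
        exact add_mem hr' ht'
      have := add_mem (Submodule.mem_sup_left hr)
        (Submodule.mem_sup_right (hm h1 (hφ.mem_of_map_mem N _ h3)))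
      rwa [add_sub_cancel] at this
    · obtain ⟨c, u, hu, h⟩ := mem_bdrys.mp h
      obtain ⟨c', -, hc'⟩ := exists_sub_mapR_mem φ (I := ⊤) (J := ⊤) (fun t _ => by
        obtain ⟨r, hr⟩ := hφ.exists_sub_mem N t
        exact ⟨r, trivial, hr⟩) (mem_coef_top c)
      choose u' hu' hu'' using fun i => exists_sub_mapR_mem φ approx (mem_coefs.mp hu i)
      refine mem_bdrys.mpr ⟨c', u', mem_coefs.mpr hu', fun i => coef_mono (hm h2) ?_⟩
      refine mem_coef_of_map_mem (φ : R →+ MvPowerSeries (Fin n) K) (hφ.mem_of_map_mem N) ?_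
      change mapR φ n _ ∈ coef (powIdeal n K N) n
      have hX : (fun k => φ (x k)) = X := funext hφ.map_x
      rw [map_sub, map_sub, mapR_smul, mapR_smul, mapR_wedges, mapR_del, hX]
      have e : φ (b i) • wedges (fun j k => φ (v j k)) d -
          φ (b i) • del (X : Fin n → MvPowerSeries (Fin n) K) (mapR φ n c') - mapR φ n (u' i) =
            (φ (b i) • wedges (fun j k => φ (v j k)) d -
              φ (b i) • del (X : Fin n → MvPowerSeries (Fin n) K) c - u i) +
          φ (b i) • del (X : Fin n → MvPowerSeries (Fin n) K) (c - mapR φ n c') + (u i - mapR φ n (u' i)) := by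
        rw [map_sub, smul_sub]
        abel
      rw [e]
      exact add_mem (add_mem (h i) (Submodule.smul_mem _ _ (del_mem_coef _ hc'))) (hu'' i)
  obtain ⟨ρ, μ, h⟩ := key
  exact not_obstruction hd h

end MvPowerSeries

/-- A field of characteristic `p` is formally smooth over its prime field. -/
theorem Field.exists_lift_of_charP {p : ℕ} [Fact p.Prime] {K S : Type v} [Field K] [CommRing S]
    [CharP K p] [CharP S p] {N : Ideal S} (hN : N ^ 2 = ⊥) (g : K →+* S ⧸ N) :
    ∃ f : K →+* S, (Ideal.Quotient.mk N).comp f = g := by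
  have hN0 {l : S} (hl : l ∈ N) : l ^ p = 0 := by
    have : l ^ 2 ∈ N ^ 2 := Ideal.pow_mem_pow hl 2
    rw [hN] at this
    exact pow_eq_zero_of_le (Fact.out : p.Prime).two_le this
  rcases subsingleton_or_nontrivial S with hS | hS
  · exact ⟨⟨⟨⟨fun _ => 0, Subsingleton.elim _ _⟩, fun _ _ => Subsingleton.elim _ _⟩,
      Subsingleton.elim _ _, fun _ _ => Subsingleton.elim _ _⟩,
      RingHom.ext fun _ => (Ideal.Quotient.mk_surjective.subsingleton).elim _ _⟩
  have hNt : N ≠ ⊤ := fun h => by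
    have := hN0 (h ▸ Submodule.mem_top : (1 : S) ∈ N)
    simp at this
  have : Nontrivial (S ⧸ N) := Ideal.Quotient.nontrivial_iff.mpr hNt
  have hg := g.injective
  let P : Set (Subring S) := {L | (∀ l ∈ L, ∃ a, g a = Ideal.Quotient.mk N l) ∧
    (∀ l ∈ L, l ∈ N → l = 0) ∧ ∀ l a, g a = Ideal.Quotient.mk N l → l ^ p ∈ L}
  let L₀ : Subring S := (g.range.comap (Ideal.Quotient.mk N)).map (frobenius S p)
  have hL₀ : L₀ ∈ P := by
    refine ⟨?_, ?_, ?_⟩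
    · rintro _ ⟨l, ⟨a, ha⟩, rfl⟩
      exact ⟨a ^ p, by rw [map_pow, ha, frobenius_def, map_pow]⟩
    · rintro _ ⟨l, ⟨a, ha⟩, rfl⟩ hl
      rw [frobenius_def] at hl ⊢
      refine hN0 (Ideal.Quotient.eq_zero_iff_mem.mp ?_)
      rw [← ha]
      have : g (a ^ p) = 0 := by rw [map_pow, ha, ← map_pow, Ideal.Quotient.eq_zero_iff_mem.mpr hl]
      rw [pow_eq_zero_iff (Fact.out : p.Prime).ne_zero |>.mp ((map_eq_zero_iff g hg).mp this),
        map_zero]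
    · intro l a h
      exact ⟨l, ⟨a, h⟩, rfl⟩
  obtain ⟨L, -, hL⟩ := zorn_le_nonempty₀ P (fun c hc hc' L₁ hL₁ => by
    have mem {l : S} : l ∈ sSup c ↔ ∃ L ∈ c, l ∈ L :=
      Subring.mem_sSup_of_directedOn ⟨L₁, hL₁⟩ hc'.directedOn
    refine ⟨sSup c, ⟨?_, ?_, fun l a h => mem.mpr ⟨L₁, hL₁, (hc hL₁).2.2 l a h⟩⟩,
      fun L hL => le_sSup hL⟩
    · intro l hl
      obtain ⟨L, hL, hl⟩ := mem.mp hl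
      exact (hc hL).1 l hl
    · intro l hl
      obtain ⟨L, hL, hl⟩ := mem.mp hl
      exact (hc hL).2.1 l hl) L₀ hL₀
  have hLP := hL.prop
  choose ι hι using fun l : L => hLP.1 l.1 l.2
  let φ : L →+* K :=
    { toFun := ι
      map_one' := hg (by rw [hι, map_one]; rfl)
      map_mul' := fun a b => hg (by rw [hι, map_mul, hι, hι]; rfl)
      map_zero' := hg (by rw [hι, map_zero]; rfl)
      map_add' := fun a b => hg (by rw [hι, map_add, hι, hι]; rfl) }
  have hφ (l : L) : g (φ l) = Ideal.Quotient.mk N l := hι l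
  have hφi : Function.Injective φ := (injective_iff_map_eq_zero _).mpr fun l hl => by
    have := hφ l
    rw [hl, map_zero, eq_comm, Ideal.Quotient.eq_zero_iff_mem] at this
    exact Subtype.ext (hLP.2.1 l l.2 this)
  have hp : 1 ≤ p := (Fact.out : p.Prime).one_le
  have hfield : IsField L := by
    refine ⟨⟨0, 1, zero_ne_one⟩, mul_comm, fun {l} hl => ?_⟩
    obtain ⟨β, hβ⟩ := Ideal.Quotient.mk_surjective (g (φ l)⁻¹)
    refine ⟨l ^ (p - 1) * ⟨β ^ p, hLP.2.2 β _ hβ.symm⟩, hφi ?_⟩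
    have e : φ ⟨β ^ p, hLP.2.2 β _ hβ.symm⟩ = (φ l)⁻¹ ^ p := hg (by rw [hφ, map_pow, map_pow, hβ])
    have hl' : φ l ≠ 0 := (map_ne_zero_iff φ hφi).mpr hl
    rw [map_mul, map_mul, e, map_pow, ← mul_assoc, ← pow_succ', Nat.sub_add_cancel hp,
      ← mul_pow, mul_inv_cancel₀ hl', one_pow, map_one]
  let _ : Field L := hfield.toField
  let _ : Algebra L K := φ.toAlgebra
  have hsurj : Function.Surjective φ := by
    intro a
    obtain ⟨α, hα⟩ := Ideal.Quotient.mk_surjective (g a)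
    let c : L := ⟨α ^ p, hLP.2.2 α a hα.symm⟩
    have hc : φ c = a ^ p := hg (by rw [hφ, map_pow, map_pow, hα])
    by_cases hb : ∃ b : L, b ^ p = c
    · obtain ⟨b, hb⟩ := hb
      refine ⟨b, frobenius_inj K p ?_⟩
      rw [frobenius_def, frobenius_def, ← map_pow, hb, hc]
    push Not at hb
    have hirr := (X_pow_sub_C_irreducible_iff_of_prime (Fact.out : p.Prime)).mpr hb
    have hmin : Polynomial.X ^ p - Polynomial.C c = minpoly L a :=
      minpoly.eq_of_irreducible_of_monic hirr (by
        rw [map_sub, map_pow, Polynomial.aeval_X, Polynomial.aeval_C]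
        exact sub_eq_zero.mpr hc.symm) (Polynomial.monic_X_pow_sub_C c (by omega))
    let ev : Polynomial L →+* S := Polynomial.eval₂RingHom L.subtype α
    have hev (q : Polynomial L) : Ideal.Quotient.mk N (ev q) = g (Polynomial.aeval a q) := by
      have : (Ideal.Quotient.mk N).comp ev = g.comp (Polynomial.aeval (R := L) a).toRingHom := by
        refine Polynomial.ringHom_ext (fun l => ?_) ?_
        · simp only [ev, RingHom.comp_apply, Polynomial.coe_eval₂RingHom, Polynomial.eval₂_C,
            AlgHom.toRingHom_eq_coe, RingHom.coe_coe, Polynomial.aeval_C]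
          exact (hφ l).symm
        · simpa [ev] using hα
      exact congr($this q)
    have hLle : L ≤ ev.range := fun l hl => ⟨Polynomial.C ⟨l, hl⟩, by simp [ev]⟩
    have h' : ev.range ∈ P := by
      refine ⟨?_, ?_, fun l a h => hLle (hLP.2.2 l a h)⟩
      · rintro _ ⟨q, rfl⟩
        exact ⟨_, (hev q).symm⟩
      · rintro _ ⟨q, rfl⟩ hq
        rw [← Ideal.Quotient.eq_zero_iff_mem, hev, map_eq_zero_iff g hg] at hq
        obtain ⟨r, rfl⟩ := minpoly.dvd L a hq
        rw [← hmin, map_mul, map_sub, map_pow]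
        simp [ev, c]
    have hα' : α ∈ L := hL.le_of_ge h' hLle ⟨Polynomial.X, by simp [ev]⟩
    exact ⟨⟨α, hα'⟩, hg ((hφ _).trans hα)⟩
  let e : L ≃+* K := RingEquiv.ofBijective φ ⟨hφi, hsurj⟩
  refine ⟨L.subtype.comp e.symm.toRingHom, RingHom.ext fun a => ?_⟩
  obtain ⟨l, rfl⟩ := e.surjective a
  have : e.symm (e l) = l := e.symm_apply_apply l
  simp only [RingHom.comp_apply, RingEquiv.toRingHom_eq_coe, RingHom.coe_coe, this]
  exact (hφ l).symm

/-- A map from a field to the quotient of an equicharacteristic ring by a square-zero ideal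
lifts. -/
theorem Field.exists_lift {k K S : Type v} [Field k] [Field K] [CommRing S] (i : k →+* S)
    {N : Ideal S} (hN : N ^ 2 = ⊥) (g : K →+* S ⧸ N) :
    ∃ f : K →+* S, (Ideal.Quotient.mk N).comp f = g := by
  rcases subsingleton_or_nontrivial (S ⧸ N) with hS | hS
  · rw [Ideal.Quotient.subsingleton_iff] at hS
    subst hS
    have : (1 : S) ∈ (⊤ : Ideal S) ^ 2 := by rw [Ideal.top_pow]; trivial
    rw [hN] at this
    have hS : Subsingleton S := subsingleton_of_zero_eq_one this.symm
    exact ⟨⟨⟨⟨fun _ => 0, Subsingleton.elim _ _⟩, fun _ _ => Subsingleton.elim _ _⟩,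
      Subsingleton.elim _ _, fun _ _ => Subsingleton.elim _ _⟩,
      RingHom.ext fun _ => (Ideal.Quotient.mk_surjective.subsingleton).elim _ _⟩
  have : Nontrivial S := (Ideal.Quotient.mk N).domain_nontrivial
  have hi := i.injective
  obtain ⟨p, hp⟩ := CharP.exists K
  have hp1 : CharP (S ⧸ N) p := charP_of_injective_ringHom g.injective p
  have hp2 : CharP k p := (RingHom.charP_iff ((Ideal.Quotient.mk N).comp i)
    ((Ideal.Quotient.mk N).comp i).injective p).mpr hp1
  have hp3 : CharP S p := charP_of_injective_ringHom hi p
  rcases CharP.char_is_prime_or_zero K p with h | rfl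
  · have : Fact p.Prime := ⟨h⟩
    exact exists_lift_of_charP hN g
  · have : CharZero k := CharP.charP_to_charZero k
    have : CharZero K := CharP.charP_to_charZero K
    let _ : Algebra ℚ S := (i.comp (algebraMap ℚ k)).toAlgebra
    have : Algebra.FormallySmooth ℚ K := by
      obtain ⟨s, hs⟩ := exists_isTranscendenceBasis ℚ K
      have := hs.isAlgebraic_field
      exact .of_algebraicIndependent_of_isSeparable hs.1
    obtain ⟨f, hf⟩ := Algebra.FormallySmooth.exists_lift (R := ℚ) N ⟨2, hN⟩
      (⟨g, fun r => congr($(Subsingleton.elim (g.comp (algebraMap ℚ K)) (algebraMap ℚ _)) r)⟩ :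
        K →ₐ[ℚ] S ⧸ N)
    exact ⟨f, RingHom.ext fun a => congr($hf a)⟩

/-- A map from a field lifts along any surjection from an equicharacteristic ring with square-zero
kernel. -/
theorem Field.exists_lift_of_surjective {k K S Q : Type v} [Field k] [Field K] [CommRing S]
    [CommRing Q] (i : k →+* S) {q : S →+* Q} (hq : Function.Surjective q)
    (hN : RingHom.ker q ^ 2 = ⊥) (g : K →+* Q) : ∃ f : K →+* S, q.comp f = g := by
  obtain ⟨f, hf⟩ := Field.exists_lift i hN
    ((RingHom.quotientKerEquivOfSurjective hq).symm.toRingHom.comp g)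
  refine ⟨f, RingHom.ext fun a => ?_⟩
  have h := congr(RingHom.quotientKerEquivOfSurjective hq ($hf a))
  simpa using h

namespace IsLocalRing

/-- A compatible system of maps from `T` to the quotients of `R` by the powers of its maximal
ideal, generated by `x`. -/
structure IsTower {ι : Type*} {R T : Type*} [CommRing R] [IsLocalRing R] [CommRing T]
    (x : ι → R) (X : ι → T) (π : ∀ j, T →+* R ⧸ maximalIdeal R ^ (j + 1)) : Prop where
  map_X : ∀ j k, π j (X k) = Ideal.Quotient.mk _ (x k)
  compat : ∀ j t r, π (j + 1) t = Ideal.Quotient.mk _ r → π j t = Ideal.Quotient.mk _ r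
  surjective : Function.Surjective (π 0)

namespace IsTower
variable {ι : Type*} {R T : Type*} [CommRing R] [IsLocalRing R] [CommRing T]
  [IsLocalRing T] {x : ι → R} {X : ι → T} {π : ∀ j, T →+* R ⧸ maximalIdeal R ^ (j + 1)}
  (hπ : IsTower x X π)
  (hx : Ideal.span (Set.range x) = maximalIdeal R) (hX : Ideal.span (Set.range X) = maximalIdeal T)
include hπ hx

omit [IsLocalRing T] in
lemma exists_mem_pow_eq (j : ℕ) {r : R} (hr : r ∈ maximalIdeal R ^ j) :
    ∃ e ∈ Ideal.span (Set.range X) ^ j, π j e = Ideal.Quotient.mk _ r := by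
  induction j generalizing r with
  | zero =>
    obtain ⟨t, ht⟩ := hπ.surjective (Ideal.Quotient.mk _ r)
    exact ⟨t, by simp, ht⟩
  | succ j ih =>
    rw [pow_succ'] at hr
    refine Submodule.mul_induction_on hr (fun a ha b hb => ?_) fun a b ha hb => ?_
    · rw [← hx] at ha
      induction ha using Submodule.span_induction generalizing b with
      | mem a ha =>
        obtain ⟨k, rfl⟩ := ha
        obtain ⟨e, he, he'⟩ := ih hb
        obtain ⟨ρ, hρ⟩ := Ideal.Quotient.mk_surjective (π (j + 1) e)
        have h1 := (hπ.compat j e ρ hρ.symm).symm.trans he'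
        rw [Ideal.Quotient.mk_eq_mk_iff_sub_mem] at h1
        refine ⟨X k * e, pow_succ' (Ideal.span (Set.range X)) j ▸
          Ideal.mul_mem_mul (Ideal.subset_span ⟨k, rfl⟩) he, ?_⟩
        rw [map_mul, hπ.map_X, ← hρ, ← map_mul, Ideal.Quotient.mk_eq_mk_iff_sub_mem, ← mul_sub,
          pow_succ']
        refine Ideal.mul_mem_mul ?_ h1
        rw [← hx]
        exact Ideal.subset_span ⟨k, rfl⟩
      | zero => exact ⟨0, zero_mem _, by simp⟩
      | add a a' _ _ h h' =>
        obtain ⟨e, he, he'⟩ := h b hb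
        obtain ⟨e₁, he₁, he₁'⟩ := h' b hb
        exact ⟨e + e₁, add_mem he he₁, by rw [map_add, he', he₁', ← map_add, add_mul]⟩
      | smul c a _ h =>
        obtain ⟨e, he, he'⟩ := h (c * b) (Ideal.mul_mem_left _ _ hb)
        exact ⟨e, he, by rw [he', smul_eq_mul, mul_left_comm, mul_assoc]⟩
    · obtain ⟨e, he, he'⟩ := ha
      obtain ⟨e₁, he₁, he₁'⟩ := hb
      exact ⟨e + e₁, add_mem he he₁, by rw [map_add, he', he₁', map_add]⟩

include hX

lemma maximalIdeal_le_comap (j : ℕ) : maximalIdeal T ≤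
    ((maximalIdeal R).map (Ideal.Quotient.mk (maximalIdeal R ^ (j + 1)))).comap (π j) := by
  rw [← hX, Ideal.span_le]
  rintro _ ⟨k, rfl⟩
  rw [SetLike.mem_coe, Ideal.mem_comap, hπ.map_X]
  refine Ideal.mem_map_of_mem _ ?_
  rw [← hx]
  exact Ideal.subset_span ⟨k, rfl⟩

lemma eq_zero_of_mem_pow {j : ℕ} {e : T} (he : e ∈ maximalIdeal T ^ (j + 1)) : π j e = 0 := by
  have h1 := hπ.maximalIdeal_le_comap hx hX j
  have h2 := Ideal.le_comap_pow (π j) (j + 1) (Ideal.pow_right_mono h1 (j + 1) he)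
  rwa [Ideal.mem_comap, ← Ideal.map_pow, Ideal.map_quotient_self, Ideal.mem_bot] at h2

lemma exists_eq_of_forall_lt [IsAdicComplete (maximalIdeal T) T] (r : R) (j₀ : ℕ) (t₀ : T)
    (h₀ : ∀ j < j₀, π j t₀ = Ideal.Quotient.mk _ r) :
    ∃ t, t - t₀ ∈ maximalIdeal T ^ j₀ ∧ ∀ j, π j t = Ideal.Quotient.mk _ r := by
  have step (J : ℕ) (u : T) (hu : ∀ j < J, π j u = Ideal.Quotient.mk _ r) :
      ∃ u', u' - u ∈ maximalIdeal T ^ J ∧ ∀ j < J + 1, π j u' = Ideal.Quotient.mk _ r := by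
    obtain ⟨ρ, hρ⟩ := Ideal.Quotient.mk_surjective (π J u)
    have h1 : r - ρ ∈ maximalIdeal R ^ J := by
      rcases J with _ | J
      · simp
      · rw [← Ideal.Quotient.mk_eq_mk_iff_sub_mem, ← hu J (Nat.lt_succ_self J),
          hπ.compat J u ρ hρ.symm]
    obtain ⟨e, he, he'⟩ := hπ.exists_mem_pow_eq hx J h1
    rw [hX] at he
    refine ⟨u + e, by simpa using he, fun j hj => ?_⟩
    rcases Nat.lt_succ_iff_lt_or_eq.mp hj with hj | rfl
    · rw [map_add, hu j hj, hπ.eq_zero_of_mem_pow hx hX (Ideal.pow_le_pow_right hj he), add_zero]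
    · rw [map_add, he', ← hρ, ← map_add, add_sub_cancel]
  choose! nxt hnxt hnxt' using step
  let u : ℕ → T := fun i => Nat.rec t₀ (fun i u => nxt (j₀ + i) u) i
  have hu (i : ℕ) : ∀ j < j₀ + i, π j (u i) = Ideal.Quotient.mk _ r := by
    induction i with
    | zero => exact h₀
    | succ i ih => exact hnxt' _ _ ih
  have hu' (i : ℕ) : u (i + 1) - u i ∈ maximalIdeal T ^ (j₀ + i) := hnxt _ _ (hu i)
  have hu₀ (i : ℕ) : u i - t₀ ∈ maximalIdeal T ^ j₀ := by
    induction i with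
    | zero => simp [u]
    | succ i ih =>
      rw [← sub_add_sub_cancel _ (u i)]
      exact add_mem (Ideal.pow_le_pow_right (Nat.le_add_right _ _) (hu' i)) ih
  obtain ⟨t, ht⟩ := IsPrecomplete.prec (I := maximalIdeal T) inferInstance (f := u)
    (fun {i i'} h => by
      induction i', h using Nat.le_induction with
      | base => rfl
      | succ i' hi ih =>
        refine ih.trans (SModEq.symm (SModEq.sub_mem.mpr ?_))
        rw [smul_eq_mul, Ideal.mul_top]
        exact Ideal.pow_le_pow_right (by omega) (hu' i'))
  have ht' (i : ℕ) : t - u i ∈ maximalIdeal T ^ i := by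
    have := SModEq.sub_mem.mp (ht i).symm
    rwa [smul_eq_mul, Ideal.mul_top] at this
  refine ⟨t, ?_, fun j => ?_⟩
  · rw [← sub_add_sub_cancel _ (u j₀)]
    exact add_mem (ht' j₀) (hu₀ j₀)
  · rw [← sub_add_cancel t (u (j + 1)), map_add, hπ.eq_zero_of_mem_pow hx hX (ht' (j + 1)),
      zero_add, hu (j + 1) j (by omega)]

/-- A tower is injective if the dimension of `R` is as large as possible. -/
theorem eq_zero_of_forall [IsNoetherianRing R] [IsNoetherianRing T] [IsDomain T] {n : ℕ}
    (hR : ringKrullDim R = n) (hT : ringKrullDim T ≤ n) {f : T} (hf : ∀ j, π j f = 0) :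
    f = 0 := by
  by_contra hf0
  have hfm : f ∈ maximalIdeal T := by
    rw [mem_maximalIdeal, mem_nonunits_iff]
    intro h
    have h1 := h.map (π 0)
    rw [hf 0] at h1
    have h2 : Subsingleton (R ⧸ maximalIdeal R ^ (0 + 1)) := isUnit_zero_iff.mp h1 |>.symm |>
      fun h => subsingleton_of_zero_eq_one h.symm
    rw [Ideal.Quotient.subsingleton_iff, zero_add, pow_one] at h2
    exact (maximalIdeal.isMaximal R).ne_top h2
  have : Nontrivial (T ⧸ Ideal.span {f}) := Ideal.Quotient.nontrivial_iff.mpr fun h =>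
    (maximalIdeal.isMaximal T).ne_top (top_le_iff.mp (h ▸ (Ideal.span_singleton_le_iff_mem _).mpr hfm))
  have : IsLocalRing (T ⧸ Ideal.span {f}) :=
    IsLocalRing.of_surjective' (Ideal.Quotient.mk _) Ideal.Quotient.mk_surjective
  have hdim := (ringKrullDim_quotient_succ_le_of_nonZeroDivisor
    (mem_nonZeroDivisors_of_ne_zero hf0)).trans hT
  obtain ⟨S, hS, hcard⟩ := Ideal.exists_finset_card_eq_height_of_isNoetherianRing
    (maximalIdeal (T ⧸ Ideal.span {f}))
  rw [← maximalIdeal_height_eq_ringKrullDim, ← hcard] at hdim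
  have hdim' : S.card + 1 ≤ n := by exact_mod_cast hdim
  obtain ⟨J, hJ⟩ : ∃ J, maximalIdeal (T ⧸ Ideal.span {f}) ^ J ≤ Ideal.span S := by
    refine Ideal.exists_pow_le_of_le_radical_of_fg ?_ (IsNoetherian.noetherian _)
    rw [Ideal.radical_eq_sInf]
    refine le_sInf fun P ⟨hP, hP'⟩ => hS.2 ⟨hP', hP⟩ (le_maximalIdeal hP'.ne_top)
  classical
  choose l hl using Ideal.Quotient.mk_surjective (I := Ideal.span {f})
  choose ρ hρ using fun z => Ideal.Quotient.mk_surjective (π J (l z))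
  have h1 : maximalIdeal T ^ J ≤ Ideal.span (l '' S) ⊔ Ideal.span {f} := by
    intro e he
    have h2 : Ideal.Quotient.mk (Ideal.span {f}) e ∈ (Ideal.span (l '' S)).map
        (Ideal.Quotient.mk (Ideal.span {f})) := by
      rw [Ideal.map_span, ← Set.image_comp]
      have : (Ideal.Quotient.mk (Ideal.span {f})) ∘ l = id := funext hl
      rw [this, Set.image_id]
      refine hJ ?_
      have h3 : (maximalIdeal T).map (Ideal.Quotient.mk (Ideal.span {f})) ≤ maximalIdeal _ :=
        (map_maximalIdeal_of_surjective _ Ideal.Quotient.mk_surjective).le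
      refine Ideal.pow_right_mono h3 J ?_
      rw [← Ideal.map_pow]
      exact Ideal.mem_map_of_mem _ he
    rwa [← Ideal.mem_comap, Ideal.comap_map_of_surjective _ Ideal.Quotient.mk_surjective,
      ← RingHom.ker_eq_comap_bot, Ideal.mk_ker] at h2
  have h2 : maximalIdeal R ^ J ≤ Ideal.span (ρ '' S) ⊔ maximalIdeal R • maximalIdeal R ^ J := by
    intro r hr
    obtain ⟨e, he, he'⟩ := hπ.exists_mem_pow_eq hx J hr
    rw [hX] at he
    have h3 : Ideal.span (l '' S) ⊔ Ideal.span {f} ≤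
        ((Ideal.span (ρ '' S)).map (Ideal.Quotient.mk _)).comap (π J) := by
      refine sup_le (Ideal.span_le.mpr ?_) ((Ideal.span_singleton_le_iff_mem _).mpr ?_)
      · rintro _ ⟨z, hz, rfl⟩
        rw [SetLike.mem_coe, Ideal.mem_comap, ← hρ]
        exact Ideal.mem_map_of_mem _ (Ideal.subset_span ⟨z, hz, rfl⟩)
      · rw [Ideal.mem_comap, hf]; exact zero_mem _
    have h4 := h3 (h1 he)
    rw [Ideal.mem_comap, he', ← Ideal.mem_comap,
      Ideal.comap_map_of_surjective _ Ideal.Quotient.mk_surjective,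
      ← RingHom.ker_eq_comap_bot, Ideal.mk_ker, pow_succ'] at h4
    exact h4
  have h3 : maximalIdeal R ^ J ≤ Ideal.span (ρ '' S) :=
    Submodule.le_of_le_smul_of_le_jacobson_bot (IsNoetherian.noetherian _)
      (maximalIdeal_le_jacobson _) h2
  have h4 : Ideal.span (ρ '' S) ≤ maximalIdeal R := by
    refine Ideal.span_le.mpr ?_
    rintro _ ⟨z, hz, rfl⟩
    have h5 : l z ∈ maximalIdeal T := fun h => by
      have h6 := h.map (Ideal.Quotient.mk (Ideal.span {f}))
      rw [hl] at h6
      exact hS.1.2 (Ideal.subset_span hz) h6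
    have h6 := hπ.maximalIdeal_le_comap hx hX J h5
    rw [Ideal.mem_comap, ← hρ, ← Ideal.mem_comap,
      Ideal.comap_map_of_surjective _ Ideal.Quotient.mk_surjective,
      ← RingHom.ker_eq_comap_bot, Ideal.mk_ker] at h6
    have h7 : maximalIdeal R ⊔ maximalIdeal R ^ (J + 1) ≤ maximalIdeal R :=
      sup_le le_rfl (Ideal.pow_le_self J.succ_ne_zero)
    exact h7 h6
  have h5 : maximalIdeal R ∈ (Ideal.span ((S.image ρ : Finset R) : Set R)).minimalPrimes := by
    rw [Finset.coe_image]
    refine ⟨⟨inferInstance, h4⟩, fun P ⟨hP, hP'⟩ _ => ?_⟩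
    exact Ideal.IsPrime.le_of_pow_le (h3.trans hP')
  have h6 := Ideal.height_le_card_of_mem_minimalPrimes_span_finset h5
  have h7 : ringKrullDim R ≤ S.card := by
    rw [← maximalIdeal_height_eq_ringKrullDim]
    exact_mod_cast h6.trans (by exact_mod_cast Finset.card_image_le)
  rw [hR] at h7
  have : n ≤ S.card := by exact_mod_cast h7
  omega

end IsTower

theorem exists_factor_comp_eq {k K R : Type v} [Field k] [Field K] [CommRing R] (i : k →+* R)
    {I J : Ideal R} (hIJ : I ≤ J) (hJ : J ^ 2 ≤ I) (g : K →+* R ⧸ J) :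
    ∃ f : K →+* R ⧸ I, (Ideal.Quotient.factor hIJ).comp f = g := by
  refine Field.exists_lift_of_surjective ((Ideal.Quotient.mk I).comp i)
    (Ideal.Quotient.factor_surjective hIJ) ?_ g
  have h1 : RingHom.ker (Ideal.Quotient.factor hIJ) ≤ J.map (Ideal.Quotient.mk I) := by
    intro l hl
    obtain ⟨r, rfl⟩ := Ideal.Quotient.mk_surjective l
    exact Ideal.mem_map_of_mem _ (Ideal.Quotient.eq_zero_iff_mem.mp hl)
  refine le_bot_iff.mp ((Ideal.pow_right_mono h1 2).trans ?_)
  rw [← Ideal.map_pow]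
  exact (Ideal.map_mono hJ).trans (Ideal.map_quotient_self I).le

/-- Ring maps from a field to the residue field lift compatibly to the quotients by powers of the
maximal ideal, if the ring contains a field. -/
theorem exists_compatible_lifts {k K R : Type v} [Field k] [Field K] [CommRing R] [IsLocalRing R]
    (i : k →+* R) (g : K →+* R ⧸ maximalIdeal R ^ (0 + 1)) :
    ∃ σ : ∀ j, K →+* R ⧸ maximalIdeal R ^ (j + 1), σ 0 = g ∧
      ∀ j a r, σ (j + 1) a = Ideal.Quotient.mk _ r → σ j a = Ideal.Quotient.mk _ r := by
  have step (j : ℕ) (g : K →+* R ⧸ maximalIdeal R ^ (j + 1)) :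
      ∃ f : K →+* R ⧸ maximalIdeal R ^ (j + 1 + 1),
        ∀ a r, f a = Ideal.Quotient.mk _ r → g a = Ideal.Quotient.mk _ r := by
    have h1 : maximalIdeal R ^ (j + 1 + 1) ≤ maximalIdeal R ^ (j + 1) :=
      Ideal.pow_le_pow_right (by omega)
    have h2 : (maximalIdeal R ^ (j + 1)) ^ 2 ≤ maximalIdeal R ^ (j + 1 + 1) := by
      rw [← pow_mul]
      exact Ideal.pow_le_pow_right (by omega)
    obtain ⟨f, hf⟩ := exists_factor_comp_eq i h1 h2 g
    refine ⟨f, fun a r h => ?_⟩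
    rw [← hf, RingHom.comp_apply, h, Ideal.Quotient.factor_mk]
  choose nxt hnxt using step
  exact ⟨fun j => Nat.rec g (fun j f => nxt j f) j, rfl, fun j => hnxt j _⟩

end IsLocalRing

namespace MvPowerSeries
open IsLocalRing

/-- Evaluation of truncated polynomials modulo powers of the maximal ideal. -/
noncomputable def evalTrunc {n : ℕ} {R K : Type v} [Field K] [CommRing R] [IsLocalRing R]
    (x : Fin n → R) (hx : ∀ k, x k ∈ maximalIdeal R) {j : ℕ}
    (σ : K →+* R ⧸ maximalIdeal R ^ j) :
    MvPolynomial (Fin n) K ⧸ MvPolynomial.idealOfVars (Fin n) K ^ j →+* R ⧸ maximalIdeal R ^ j :=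
  Ideal.Quotient.lift (MvPolynomial.idealOfVars (Fin n) K ^ j)
    (MvPolynomial.eval₂Hom σ fun k => Ideal.Quotient.mk _ (x k)) (by
      have h1 : MvPolynomial.idealOfVars (Fin n) K ≤
          ((maximalIdeal R).map (Ideal.Quotient.mk (maximalIdeal R ^ j))).comap
            (MvPolynomial.eval₂Hom σ fun k => Ideal.Quotient.mk _ (x k)) := by
        refine Ideal.span_le.mpr ?_
        rintro _ ⟨k, rfl⟩
        rw [SetLike.mem_coe, Ideal.mem_comap, MvPolynomial.eval₂Hom_X']
        exact Ideal.mem_map_of_mem _ (hx k)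
      intro a ha
      have h2 := Ideal.le_comap_pow _ j (Ideal.pow_right_mono h1 j ha)
      rwa [Ideal.mem_comap, ← Ideal.map_pow, Ideal.map_quotient_self, Ideal.mem_bot] at h2)

/-- Evaluation of power series modulo powers of the maximal ideal. -/
noncomputable def evalQuot {n : ℕ} {R K : Type v} [Field K] [CommRing R] [IsLocalRing R]
    (x : Fin n → R) (hx : ∀ k, x k ∈ maximalIdeal R) {j : ℕ}
    (σ : K →+* R ⧸ maximalIdeal R ^ j) : MvPowerSeries (Fin n) K →+* R ⧸ maximalIdeal R ^ j :=
  (evalTrunc x hx σ).comp (truncTotalAlgHom (Fin n) K j).toRingHom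

section evalQuot
variable {n : ℕ} {R K : Type v} [Field K] [CommRing R] [IsLocalRing R] {x : Fin n → R}
  (hx : ∀ k, x k ∈ maximalIdeal R)

lemma evalQuot_coe {j : ℕ} (σ : K →+* R ⧸ maximalIdeal R ^ j) (p : MvPolynomial (Fin n) K) :
    evalQuot x hx σ p = MvPolynomial.eval₂Hom σ (fun k => Ideal.Quotient.mk _ (x k)) p :=
  congrArg (evalTrunc x hx σ)
    ((truncTotalAlgHom (Fin n) K j).commutes p)

lemma evalQuot_eq_of_sub_mem {j : ℕ} (σ : K →+* R ⧸ maximalIdeal R ^ j)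
    {f : MvPowerSeries (Fin n) K} {p : MvPolynomial (Fin n) K}
    (h : f.truncTotal j - p ∈ MvPolynomial.idealOfVars (Fin n) K ^ j) :
    evalQuot x hx σ f = MvPolynomial.eval₂Hom σ (fun k => Ideal.Quotient.mk _ (x k)) p :=
  congrArg (evalTrunc x hx σ)
    ((Ideal.Quotient.mk_eq_mk_iff_sub_mem _ _).mpr h)

lemma isTower_evalQuot {σ : ∀ j, K →+* R ⧸ maximalIdeal R ^ (j + 1)}
    (h₀ : Function.Surjective (σ 0))
    (hσ : ∀ j a r, σ (j + 1) a = Ideal.Quotient.mk _ r → σ j a = Ideal.Quotient.mk _ r) :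
    IsTower x (X : Fin n → MvPowerSeries (Fin n) K) fun j => evalQuot x hx (σ j) where
  map_X j k := by
    rw [← MvPolynomial.coe_X, evalQuot_coe, MvPolynomial.eval₂Hom_X']
  compat j t r h := by
    have h1 : maximalIdeal R ^ (j + 1 + 1) ≤ maximalIdeal R ^ (j + 1) :=
      Ideal.pow_le_pow_right (by omega)
    rw [evalQuot_eq_of_sub_mem hx (σ (j + 1)) (p := t.truncTotal (j + 1 + 1)) (by simp)] at h
    rw [evalQuot_eq_of_sub_mem hx (σ j) (p := t.truncTotal (j + 1 + 1))
      (truncTotal_sub_truncTotal_mem_pow_idealOfVars le_rfl (by omega) t)]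
    have h2 : (Ideal.Quotient.factor h1).comp
        (MvPolynomial.eval₂Hom (σ (j + 1)) fun k => Ideal.Quotient.mk _ (x k)) =
        MvPolynomial.eval₂Hom (σ j) fun k => Ideal.Quotient.mk _ (x k) := by
      refine MvPolynomial.ringHom_ext (fun a => ?_) fun k => ?_
      · obtain ⟨ρ, hρ⟩ := Ideal.Quotient.mk_surjective (σ (j + 1) a)
        rw [RingHom.comp_apply, MvPolynomial.eval₂Hom_C, MvPolynomial.eval₂Hom_C, ← hρ,
          Ideal.Quotient.factor_mk, hσ j a ρ hρ.symm]
      · rw [RingHom.comp_apply, MvPolynomial.eval₂Hom_X', MvPolynomial.eval₂Hom_X',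
          Ideal.Quotient.factor_mk]
    rw [← h2, RingHom.comp_apply, h, Ideal.Quotient.factor_mk]
  surjective a := by
    obtain ⟨c, rfl⟩ := h₀ a
    exact ⟨C c, by rw [← MvPolynomial.coe_C, evalQuot_coe, MvPolynomial.eval₂Hom_C]⟩

end evalQuot

theorem exists_isChart {n : ℕ} {k R : Type v} [Field k] [CommRing R] [IsLocalRing R]
    [IsNoetherianRing R] (i : k →+* R) {x : Fin n → R}
    (hx : Ideal.span (Set.range x) = maximalIdeal R) (hR : ringKrullDim R = n) :
    ∃ φ : R →+* MvPowerSeries (Fin n) (ResidueField R), IsChart φ x := by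
  have hxm (k : Fin n) : x k ∈ maximalIdeal R := hx ▸ Ideal.subset_span ⟨k, rfl⟩
  have e : maximalIdeal R = maximalIdeal R ^ (0 + 1) := by rw [zero_add, pow_one]
  obtain ⟨σ, hσ, hσ'⟩ := exists_compatible_lifts (K := ResidueField R) i
    (Ideal.quotEquivOfEq e).toRingHom
  let π (j : ℕ) := evalQuot x hxm (σ j)
  have hπ : IsTower x (X : Fin n → MvPowerSeries (Fin n) (ResidueField R)) π :=
    isTower_evalQuot hxm (by rw [hσ]; exact (Ideal.quotEquivOfEq e).surjective) hσ'
  have : IsDomain (MvPowerSeries (Fin n) (ResidueField R)) := NoZeroDivisors.to_isDomain _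
  have : IsAdicComplete (maximalIdeal (MvPowerSeries (Fin n) (ResidueField R)))
      (MvPowerSeries (Fin n) (ResidueField R)) := by
    rw [← span_range_X]; infer_instance
  have hT : ringKrullDim (MvPowerSeries (Fin n) (ResidueField R)) ≤ n := by
    refine (ringKrullDim_le_spanFinrank_maximalIdeal _).trans ?_
    have h1 := Submodule.spanFinrank_span_le_ncard_of_finite (R := MvPowerSeries (Fin n)
      (ResidueField R)) (Set.finite_range (X : Fin n → MvPowerSeries (Fin n) (ResidueField R)))
    have h2 : (Set.range (X : Fin n → MvPowerSeries (Fin n) (ResidueField R))).ncard ≤ n := by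
      rw [← Set.image_univ]
      exact (Set.ncard_image_le Set.finite_univ).trans (by simp [Set.ncard_univ])
    have h3 := h1.trans h2
    have h4 := span_range_X (F := ResidueField R) n
    rw [Ideal.span] at h4
    rw [h4] at h3
    exact_mod_cast h3
  have hinj {f} (hf : ∀ j, π j f = 0) : f = 0 :=
    hπ.eq_zero_of_forall hx (span_range_X n) hR hT hf
  have hex (r : R) := hπ.exists_eq_of_forall_lt hx (span_range_X n) r 0 0 (by simp)
  choose ψ _ hψ using hex
  have uniq {t : MvPowerSeries (Fin n) (ResidueField R)} {r : R}
      (h : ∀ j, π j t = Ideal.Quotient.mk _ r) : ψ r = t :=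
    sub_eq_zero.mp (hinj fun j => by rw [map_sub, hψ, h, sub_self])
  let φ : R →+* MvPowerSeries (Fin n) (ResidueField R) :=
    { toFun := ψ
      map_one' := uniq fun j => by rw [map_one, map_one]
      map_mul' := fun a b => uniq fun j => by rw [map_mul, map_mul, hψ, hψ]
      map_zero' := uniq fun j => by rw [map_zero, map_zero]
      map_add' := fun a b => uniq fun j => by rw [map_add, map_add, hψ, hψ] }
  refine ⟨φ, fun k => uniq fun j => hπ.map_X j k, fun N r hr => ?_, fun N t => ?_⟩
  · refine Ideal.mem_of_forall_mem_sup_pow' fun j => ?_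
    have h1 : powIdeal n (ResidueField R) N ≤
        ((Ideal.span (Set.range fun k => x k ^ (N + 1))).map (Ideal.Quotient.mk _)).comap (π j) := by
      refine Ideal.span_le.mpr ?_
      rintro _ ⟨k, rfl⟩
      rw [SetLike.mem_coe, Ideal.mem_comap, map_pow, hπ.map_X, ← map_pow]
      exact Ideal.mem_map_of_mem _ (Ideal.subset_span ⟨k, rfl⟩)
    have h2 := h1 hr
    rw [Ideal.mem_comap, show φ r = ψ r from rfl, hψ, ← Ideal.mem_comap,
      Ideal.comap_map_of_surjective _ Ideal.Quotient.mk_surjective,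
      ← RingHom.ker_eq_comap_bot, Ideal.mk_ker] at h2
    have h3 : maximalIdeal R ^ (j + 1) ≤ maximalIdeal R ^ j :=
      Ideal.pow_le_pow_right (Nat.le_succ j)
    have h4 := sup_le_sup_left h3 (Ideal.span (Set.range fun k => x k ^ (N + 1)))
    exact h4 h2
  · obtain ⟨J, hJ⟩ : ∃ J, maximalIdeal (MvPowerSeries (Fin n) (ResidueField R)) ^ J ≤
        powIdeal n (ResidueField R) N := by
      refine Ideal.exists_pow_le_of_le_radical_of_fg ?_ (IsNoetherian.noetherian _)
      rw [← span_range_X, Ideal.span_le]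
      rintro _ ⟨k, rfl⟩
      exact ⟨N + 1, Ideal.subset_span ⟨k, rfl⟩⟩
    obtain ⟨r, hr⟩ := Ideal.Quotient.mk_surjective (π J t)
    have hc {j : ℕ} (hj : j ≤ J) : π j t = Ideal.Quotient.mk _ r := by
      induction hj using Nat.decreasingInduction with
      | self => exact hr.symm
      | of_succ j _ ih => exact hπ.compat j t r ih
    obtain ⟨t', ht', ht''⟩ := hπ.exists_eq_of_forall_lt hx (span_range_X n) 0 J (t - φ r)
      (fun j hj => by rw [map_sub, hc hj.le, show φ r = ψ r from rfl, hψ, sub_self, map_zero])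
    rw [hinj fun j => (ht'' j).trans (map_zero _), zero_sub, neg_mem_iff] at ht'
    exact ⟨r, hJ ht'⟩

end MvPowerSeries

namespace KProd
open IsLocalRing RingTheory.Sequence

lemma initIdeal_congr {A : Type v} [CommRing A] {s s' : ℕ → A} {d : ℕ}
    (h : ∀ j < d, s j = s' j) : initIdeal s d = initIdeal s' d :=
  congrArg Ideal.span (Set.image_congr h)

/-- A regular sequence extends to a system of parameters. -/
theorem exists_parameters {n d : ℕ} {R : Type v} [CommRing R] [IsLocalRing R] [IsNoetherianRing R]
    (hR : ringKrullDim R = n) {s : ℕ → R} (hs : ∀ j < d, s j ∈ maximalIdeal R)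
    (hreg : IsWeaklyRegular R ((List.range d).map s)) :
    d ≤ n ∧ ∃ s' : ℕ → R, (∀ j < d, s' j = s j) ∧ (∀ j, d ≤ j → s' j ∈ maximalIdeal R) ∧
      maximalIdeal R ≤ (initIdeal s' n).radical := by
  have hsm : ∀ r ∈ (List.range d).map s, r ∈ maximalIdeal R := by
    intro r hr
    obtain ⟨j, hj, rfl⟩ := List.mem_map.mp hr
    exact hs j (List.mem_range.mp hj)
  have h1 := ringKrullDim_add_length_eq_ringKrullDim_of_isRegular _
    ((IsLocalRing.isRegular_iff_isWeaklyRegular_of_subset_maximalIdeal hsm).mpr hreg)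
  rw [← initIdeal_eq_ofList, List.length_map, List.length_range, hR] at h1
  have hle : initIdeal s d ≤ maximalIdeal R := by
    refine Ideal.span_le.mpr ?_
    rintro _ ⟨j, hj, rfl⟩
    exact hs j hj
  have : Nontrivial (R ⧸ initIdeal s d) := Ideal.Quotient.nontrivial_iff.mpr fun h =>
    (maximalIdeal.isMaximal R).ne_top (top_le_iff.mp (h ▸ hle))
  have : IsLocalRing (R ⧸ initIdeal s d) :=
    IsLocalRing.of_surjective' (Ideal.Quotient.mk _) Ideal.Quotient.mk_surjective
  obtain ⟨S, hS, hcard⟩ := Ideal.exists_finset_card_eq_height_of_isNoetherianRing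
    (maximalIdeal (R ⧸ initIdeal s d))
  rw [← maximalIdeal_height_eq_ringKrullDim, ← hcard] at h1
  have hcard' : S.card + d = n := by exact_mod_cast h1
  refine ⟨by omega, ?_⟩
  choose l hl using Ideal.Quotient.mk_surjective (I := initIdeal s d)
  let e : Fin S.card ≃ S := S.equivFin.symm
  let s' (j : ℕ) : R := if j < d then s j else
    if h : j - d < S.card then l (e ⟨j - d, h⟩) else 0
  have hs' {j : ℕ} (hj : j < d) : s' j = s j := if_pos hj
  refine ⟨s', fun j hj => hs' hj, fun j hj => ?_, ?_⟩
  · have e1 : s' j = if h : j - d < S.card then l (e ⟨j - d, h⟩) else 0 := if_neg (not_lt.mpr hj)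
    rw [e1]
    split_ifs with h
    · intro h2
      have h3 := h2.map (Ideal.Quotient.mk (initIdeal s d))
      rw [hl] at h3
      exact hS.1.2 (Ideal.subset_span (e ⟨j - d, h⟩).2) h3
    · exact zero_mem _
  · rw [Ideal.radical_eq_sInf]
    refine le_sInf fun P ⟨hP, hP'⟩ => ?_
    have h2 : initIdeal s d ≤ P := by
      rw [← initIdeal_congr fun j hj => hs' hj]
      exact (initIdeal_mono _ (by omega)).trans hP
    have h3 : Ideal.span (S : Set (R ⧸ initIdeal s d)) ≤ P.map (Ideal.Quotient.mk _) := by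
      refine Ideal.span_le.mpr fun z hz => ?_
      rw [SetLike.mem_coe, ← hl z]
      refine Ideal.mem_map_of_mem _ (hP ?_)
      have e1 : s' (d + e.symm ⟨z, hz⟩) = l z := by
        have e2 : ¬ d + (e.symm ⟨z, hz⟩ : ℕ) < d := by omega
        have e3 : d + (e.symm ⟨z, hz⟩ : ℕ) - d < S.card := by
          rw [Nat.add_sub_cancel_left]; exact (e.symm ⟨z, hz⟩).2
        have e4 : (⟨d + (e.symm ⟨z, hz⟩ : ℕ) - d, e3⟩ : Fin S.card) = e.symm ⟨z, hz⟩ :=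
          Fin.ext (Nat.add_sub_cancel_left _ _)
        simp only [s', if_neg e2, dif_pos e3, e4, Equiv.apply_symm_apply]
      rw [← e1]
      exact mem_initIdeal _ (by have := (e.symm ⟨z, hz⟩).2; omega)
    have h4 : (P.map (Ideal.Quotient.mk (initIdeal s d))).IsPrime :=
      Ideal.map_isPrime_of_surjective Ideal.Quotient.mk_surjective (by rwa [Ideal.mk_ker])
    have h5 := hS.2 ⟨h4, h3⟩ (le_maximalIdeal h4.ne_top)
    have h6 := Ideal.comap_mono (f := Ideal.Quotient.mk (initIdeal s d)) h5
    rw [Ideal.comap_map_of_surjective _ Ideal.Quotient.mk_surjective, ← RingHom.ker_eq_comap_bot,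
      Ideal.mk_ker, sup_eq_left.mpr h2] at h6
    refine le_trans (fun r hr => ?_) h6
    rw [Ideal.mem_comap]
    exact (map_maximalIdeal_of_surjective (Ideal.Quotient.mk (initIdeal s d))
      Ideal.Quotient.mk_surjective).le (Ideal.mem_map_of_mem _ hr)

theorem wedges_mem_bdry {n d r : ℕ} {k R : Type v} [Field k] [CommRing R] [IsLocalRing R]
    [IsNoetherianRing R] (i : k →+* R) {x : Fin n → R}
    (hx : Ideal.span (Set.range x) = maximalIdeal R) (hR : ringKrullDim R = n)
    {s : ℕ → R} (hs : ∀ j < d, s j ∈ maximalIdeal R)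
    (hreg : IsWeaklyRegular R ((List.range d).map s)) {v : ℕ → Fin n → R}
    (hv : ∀ j < d, ∑ k, v j k * x k = s j) {b : Fin r → R} {𝔞 : Ideal R}
    (mem𝔞 : ∀ a, a ∈ 𝔞 ↔ ∀ i, a * b i ∈ initIdeal s d) (hne : ¬ 𝔞 ≤ initIdeal s d) :
    wedges v d ∈ bdry x 𝔞 := by
  obtain ⟨hd, s', hs', hs'm, hrad⟩ := exists_parameters hR hs hreg
  obtain ⟨φ, hφ⟩ := MvPowerSeries.exists_isChart i hx hR
  have hxm (k : Fin n) : x k ∈ maximalIdeal R := hx ▸ Ideal.subset_span ⟨k, rfl⟩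
  have hex (j : ℕ) : ∃ w : Fin n → R, ∑ k, w k * x k = s' j := by
    refine Ideal.mem_span_range_iff_exists_fun.mp ?_
    rw [hx]
    rcases lt_or_ge j d with h | h
    · rw [hs' j h]; exact hs j h
    · exact hs'm j h
  choose w hw using hex
  have e1 : initIdeal s d = initIdeal s' d := initIdeal_congr fun j hj => (hs' j hj).symm
  have e2 : wedges v d = wedges (fun j => if j < d then v j else w j) d :=
    wedges_congr fun j hj => (if_pos hj).symm
  obtain ⟨M, hM⟩ := Ideal.exists_pow_le_of_le_radical_of_fg hrad (IsNoetherian.noetherian _)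
  rw [e2]
  refine hφ.wedges_mem_bdry hxm hd (s := s') (fun j _ => ?_) (M := M)
    (fun k => hM (Ideal.pow_mem_pow (hxm k) M)) (b := b) (by simpa only [e1] using mem𝔞)
    (by rwa [← e1])
  split_ifs with h
  · rw [hv j h, hs' j h]
  · exact hw j

end KProd

section

open RingTheory.Sequence

/-- Coset avoidance of zero divisors. -/
theorem exists_add_mul_mem_nonZeroDivisors {B : Type v} [CommRing B] [IsNoetherianRing B] {x : B}
    (hx : x ∈ nonZeroDivisors B) (y : B) : ∃ c, y + c * x ∈ nonZeroDivisors B := by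
  classical
  have hfin := associatedPrimes.finite B B
  let S : Set (Ideal B) := {P | Maximal (· ∈ associatedPrimes B B) P}
  have hS : S.Finite := hfin.subset fun P hP => hP.prop
  have hprime {P : Ideal B} (hP : P ∈ S) : P.IsPrime := IsAssociatedPrime.isPrime hP.prop
  let S₁ : Set (Ideal B) := {P ∈ S | y ∈ P}
  have hS₁ : S₁.Finite := hS.subset fun P hP => hP.1
  let S₂ : Finset (Ideal B) := (hS.subset (fun P hP => hP.1 : {P ∈ S | y ∉ P} ⊆ S)).toFinset
  have mem₂ {P : Ideal B} : P ∈ S₂ ↔ P ∈ S ∧ y ∉ P := by simp [S₂]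
  obtain ⟨c, hc, hc'⟩ : ∃ c ∈ S₂.inf id, ∀ P ∈ S₁, c ∉ P := by
    by_contra! h
    have h1 : ((S₂.inf id : Ideal B) : Set B) ⊆ ⋃ P ∈ S₁, id P := fun c hc => by
      obtain ⟨P, hP, hcP⟩ := h c hc
      exact Set.mem_biUnion hP hcP
    obtain ⟨P, hP, hle⟩ := (Ideal.subset_union_prime_finite hS₁ (f := id) 0 0
      fun P hP _ _ => hprime hP.1).mp h1
    obtain ⟨Q, hQ, hQP⟩ := (hprime hP.1).inf_le'.mp hle
    have h2 := (mem₂.mp hQ).1.eq_of_le hP.1.prop hQP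
    exact (mem₂.mp hQ).2 (h2 ▸ hP.2)
  refine ⟨c, ?_⟩
  by_contra hz
  obtain ⟨Q, hQ, hQz⟩ : ∃ Q ∈ associatedPrimes B B, y + c * x ∈ Q := by
    have h1 : y + c * x ∈ ⋃ P ∈ associatedPrimes B B, (P : Set B) := by
      rw [biUnion_associatedPrimes_eq_compl_nonZeroDivisors]
      exact hz
    simpa using h1
  obtain ⟨P, hQP, hP⟩ := hfin.exists_le_maximal hQ
  have hxP : x ∉ P := fun h => by
    have h1 : x ∈ ⋃ P ∈ associatedPrimes B B, (P : Set B) := Set.mem_biUnion hP.prop h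
    rw [biUnion_associatedPrimes_eq_compl_nonZeroDivisors] at h1
    exact h1 hx
  by_cases hy : y ∈ P
  · exact ((hprime hP).mem_or_mem ((Ideal.add_mem_iff_right _ hy).mp (hQP hQz))).elim
      (hc' P ⟨hP, hy⟩) hxP
  · refine hy ((Ideal.add_mem_iff_left _ (Ideal.mul_mem_right _ _ ?_)).mp (hQP hQz))
    exact Finset.inf_le (f := id) (mem₂.mpr ⟨hP, hy⟩) hc

theorem Ideal.exists_add_mul_regular {R : Type v} [CommRing R] [IsNoetherianRing R] {L : Ideal R}
    {x : R} (hx : ∀ a, x * a ∈ L → a ∈ L) (y : R) :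
    ∃ c, ∀ a, (y + c * x) * a ∈ L → a ∈ L := by
  have h1 : Ideal.Quotient.mk L x ∈ nonZeroDivisors (R ⧸ L) := by
    rw [mem_nonZeroDivisors_iff_left]
    intro a ha
    obtain ⟨a, rfl⟩ := Ideal.Quotient.mk_surjective a
    rw [← map_mul, Ideal.Quotient.eq_zero_iff_mem] at ha
    exact Ideal.Quotient.eq_zero_iff_mem.mpr (hx a ha)
  obtain ⟨c, hc⟩ := exists_add_mul_mem_nonZeroDivisors h1 (Ideal.Quotient.mk L y)
  obtain ⟨c, rfl⟩ := Ideal.Quotient.mk_surjective c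
  refine ⟨c, fun a ha => ?_⟩
  rw [mem_nonZeroDivisors_iff_left] at hc
  refine Ideal.Quotient.eq_zero_iff_mem.mp (hc _ ?_)
  rw [← map_mul, ← map_add, ← map_mul]
  exact Ideal.Quotient.eq_zero_iff_mem.mpr ha

lemma RingTheory.Sequence.isWeaklyRegular_append_singleton_iff {R : Type v} [CommRing R]
    (l : List R) (r : R) : IsWeaklyRegular R (l ++ [r]) ↔
      IsWeaklyRegular R l ∧ ∀ a, r * a ∈ Ideal.ofList l → a ∈ Ideal.ofList l := by
  rw [isWeaklyRegular_append_iff, isWeaklyRegular_singleton_iff]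
  have e : (Ideal.ofList l • (⊤ : Submodule R R)) = Ideal.ofList l := by
    rw [smul_eq_mul, Ideal.mul_top]
  rw [e, isSMulRegular_iff_right_eq_zero_of_smul]
  refine and_congr_right fun _ => ⟨fun h a ha => ?_, fun h a ha => ?_⟩
  · exact (Submodule.Quotient.mk_eq_zero _).mp (h (Submodule.Quotient.mk a)
      ((Submodule.Quotient.mk_eq_zero _).mpr ha))
  · obtain ⟨a, rfl⟩ := Submodule.Quotient.mk_surjective _ a
    exact (Submodule.Quotient.mk_eq_zero _).mpr (h a ((Submodule.Quotient.mk_eq_zero _).mp ha))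

namespace Ideal

/-- `J ≤ 𝔞` and `𝔞` equals its double annihilator modulo `J`. -/
structure IsLinked {R : Type v} [CommRing R] (J 𝔞 : Ideal R) : Prop where
  le : J ≤ 𝔞
  mem_of_forall : ∀ w, (∀ u, (∀ a ∈ 𝔞, u * a ∈ J) → w * u ∈ J) → w ∈ 𝔞

/-- Linkage does not depend on the last element of a regular sequence. -/
theorem IsLinked.exchange {R : Type v} [CommRing R] {L 𝔞 : Ideal R} {x z : R}
    (h : IsLinked (L ⊔ span {x}) 𝔞) (hx : ∀ a, x * a ∈ L → a ∈ L) (hz : ∀ a, z * a ∈ L → a ∈ L)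
    (hz𝔞 : z ∈ 𝔞) : IsLinked (L ⊔ span {z}) 𝔞 := by
  have mem {x b : R} : b ∈ L ⊔ span {x} ↔ ∃ c, b - x * c ∈ L := by
    rw [sup_comm, mem_span_singleton_sup]
    constructor
    · rintro ⟨c, l, hl, rfl⟩
      exact ⟨c, by rwa [mul_comm x, add_sub_cancel_left]⟩
    · rintro ⟨c, hc⟩
      exact ⟨c, _, hc, by ring⟩
  have hx𝔞 : x ∈ 𝔞 := h.le (mem_sup_right (mem_span_singleton_self x))
  refine ⟨sup_le (le_sup_left.trans h.le) ((span_singleton_le_iff_mem _).mpr hz𝔞), fun w hw => ?_⟩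
  refine h.mem_of_forall w fun u hu => ?_
  obtain ⟨u', hu'⟩ := mem.mp (hu z hz𝔞)
  have h1 : w * u' ∈ L ⊔ span {z} := hw u' fun a ha => by
    obtain ⟨c, hc⟩ := mem.mp (hu a ha)
    refine mem.mpr ⟨c, hx _ ?_⟩
    have := sub_mem (mul_mem_left L z hc) (mul_mem_left L a hu')
    convert this using 1
    ring
  obtain ⟨e, he⟩ := mem.mp h1
  refine mem.mpr ⟨e, hz _ ?_⟩
  have := add_mem (mul_mem_left L w hu') (mul_mem_left L x he)
  convert this using 1
  ring

/-- A regular sequence linking `𝔞` can be replaced by a regular sequence with prescribed residues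
in `𝔞 / 𝔪𝔞`. -/
theorem exists_linked_of_forall_mem {R : Type v} [CommRing R] [IsLocalRing R] [IsNoetherianRing R]
    {𝔞 : Ideal R} (h𝔞 : 𝔞 ≤ IsLocalRing.maximalIdeal R) :
    ∀ (ys l xs : List R), (∀ y ∈ ys, y ∈ 𝔞) → xs.length = ys.length →
      IsWeaklyRegular R (l ++ xs) → IsLinked (ofList (l ++ xs)) 𝔞 →
      ∃ zs : List R, List.Forall₂ (fun y z => z - y ∈ IsLocalRing.maximalIdeal R * 𝔞) ys zs ∧
        IsWeaklyRegular R (l ++ zs) ∧ IsLinked (ofList (l ++ zs)) 𝔞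
  | [], l, xs, _, hlen, hreg, hlink => by
    obtain rfl := List.eq_nil_of_length_eq_zero hlen
    exact ⟨[], .nil, hreg, hlink⟩
  | y :: ys, l, [], _, hlen, _, _ => by simp at hlen
  | y :: ys, l, x :: xs, hys, hlen, hreg, hlink => by
    have mem_of {l : List R} (h : IsLinked (ofList l) 𝔞) : ∀ r ∈ l, r ∈ IsLocalRing.maximalIdeal R :=
      fun r hr => h𝔞 (h.le (subset_span hr))
    have ofList_perm {l l' : List R} (h : l.Perm l') : ofList l = ofList l' :=
      congrArg span (Set.ext fun _ => h.mem_iff)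
    have hp (r : R) : (l ++ r :: xs).Perm (l ++ xs ++ [r]) := by
      rw [List.append_assoc]
      exact List.Perm.append_left l (List.perm_append_singleton r xs).symm
    have h1 := IsLocalRing.isWeaklyRegular_of_perm_of_subset_maximalIdeal hreg (hp x) (mem_of hlink)
    rw [isWeaklyRegular_append_singleton_iff] at h1
    have hx𝔞 : x ∈ 𝔞 := hlink.le (subset_span (by simp))
    have hy𝔞 : y ∈ 𝔞 := hys y (by simp)
    obtain ⟨c, hc⟩ := exists_add_mul_regular (x := x * x)
      (fun a ha => h1.2 _ (h1.2 _ (by rwa [← mul_assoc]))) y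
    have hxx : x * x ∈ IsLocalRing.maximalIdeal R * 𝔞 := mul_mem_mul (h𝔞 hx𝔞) hx𝔞
    have hz𝔞 : y + c * (x * x) ∈ 𝔞 :=
      add_mem hy𝔞 (mul_mem_left _ _ (mul_mem_left _ _ hx𝔞))
    have h2 : IsWeaklyRegular R (l ++ xs ++ [y + c * (x * x)]) :=
      (isWeaklyRegular_append_singleton_iff _ _).mpr ⟨h1.1, hc⟩
    have h3 : IsLinked (ofList (l ++ xs ++ [y + c * (x * x)])) 𝔞 := by
      rw [ofList_append, ofList_singleton]
      refine IsLinked.exchange ?_ h1.2 hc hz𝔞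
      rwa [← ofList_singleton, ← ofList_append, ← ofList_perm (hp x)]
    have e : l ++ [y + c * (x * x)] ++ xs = l ++ (y + c * (x * x)) :: xs := by simp
    obtain ⟨zs, h4, h5, h6⟩ := exists_linked_of_forall_mem h𝔞 ys (l ++ [y + c * (x * x)]) xs
      (fun y hy => hys y (by simp [hy])) (by simpa using hlen)
      (e ▸ IsLocalRing.isWeaklyRegular_of_perm_of_subset_maximalIdeal h2 (hp _).symm (mem_of h3))
      (by rwa [e, ofList_perm (hp _)])
    refine ⟨(y + c * (x * x)) :: zs, .cons ?_ h4, by simpa using h5, by simpa using h6⟩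
    rw [add_sub_cancel_left]
    exact mul_mem_left _ _ hxx

end Ideal

end

namespace KProd
open IsLocalRing RingTheory.Sequence

section
variable {A : Type v} [CommRing A] {𝔞 : Ideal A}

lemma wedge_sub_wedge_mem_coef : ∀ {n : ℕ} {v v' : Fin n → A} (_ : ∀ k, v k - v' k ∈ 𝔞)
    (c : KProd n A), wedge v c - wedge v' c ∈ coef 𝔞 n
  | 0, v, v', _, c => by
    have : wedge v c - wedge v' c = 0 := sub_self (0 : KProd 0 A)
    rw [this]; exact zero_mem _
  | n + 1, v, v', h, (a, b) => by
    rw [wedge_succ, wedge_succ]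
    refine ⟨wedge_sub_wedge_mem_coef (fun k => h k.succ) a, ?_⟩
    have h1 := sub_mem (smul_mem_coef_of_mem (h 0) a)
      (wedge_sub_wedge_mem_coef (fun k => h k.succ) b)
    change v 0 • a - wedge (Fin.tail v) b - (v' 0 • a - wedge (Fin.tail v') b) ∈ coef 𝔞 n
    convert h1 using 1
    rw [sub_smul]
    change _ = _ - (wedge (Fin.tail v) b - wedge (Fin.tail v') b)
    abel

lemma wedges_sub_wedges_mem_coef {n : ℕ} {v v' : ℕ → Fin n → A} {d : ℕ}
    (h : ∀ j < d, ∀ k, v j k - v' j k ∈ 𝔞) :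
    (wedges v d - wedges v' d : KProd n A) ∈ coef 𝔞 n := by
  induction d with
  | zero => rw [wedges, wedges, sub_self]; exact zero_mem _
  | succ d ih =>
    have h1 := add_mem (wedge_mem_coef (v d) (ih fun j hj => h j (by omega)))
      (wedge_sub_wedge_mem_coef (h d (by omega)) (wedges v' d))
    rw [wedges, wedges]
    rwa [map_sub, sub_add_sub_cancel] at h1

end

lemma isLinked_colon {R : Type v} [CommRing R] {J I : Ideal R} :
    Ideal.IsLinked J (J.colon (I : Set R)) where
  le a ha := Submodule.mem_colon.mpr fun b _ => Ideal.mul_mem_right b J ha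
  mem_of_forall w hw := Submodule.mem_colon.mpr fun b hb => hw b fun a ha => by
    rw [mul_comm]
    exact Submodule.mem_colon.mp ha b hb

theorem wedges_mem_bdry_colon {n d : ℕ} {k R : Type v} [Field k] [CommRing R] [IsLocalRing R]
    [IsNoetherianRing R] (i : k →+* R) {x : Fin n → R}
    (hx : Ideal.span (Set.range x) = maximalIdeal R) (hR : ringKrullDim R = n)
    {𝔞 : Ideal R} (h𝔞 : 𝔞 ≤ maximalIdeal R) {xs : List R} (hlen : xs.length = d)
    (hxs : IsWeaklyRegular R xs) (hlink : Ideal.IsLinked (Ideal.ofList xs) 𝔞)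
    (hnot : ¬ ∃ z : Fin d → R, Ideal.span (Set.range z) = 𝔞)
    {y : ℕ → R} (hy : ∀ j < d, y j ∈ 𝔞) {v : ℕ → Fin n → R}
    (hv : ∀ j < d, ∑ k, v j k * x k = y j) : wedges v d ∈ bdry x 𝔞 := by
  obtain ⟨zs, h1, h2, h3⟩ := Ideal.exists_linked_of_forall_mem h𝔞 ((List.range d).map y) [] xs
    (by simpa using hy) (by simpa using hlen) hxs hlink
  rw [List.nil_append] at h2 h3
  have hzlen : zs.length = d := by simpa using h1.length_eq.symm
  let z (j : ℕ) : R := zs.getD j 0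
  have hz : (List.range d).map z = zs := by
    refine List.ext_getElem (by simp [hzlen]) fun j h h' => ?_
    simp [z, h']
  have hsub (j : ℕ) (hj : j < d) : z j - y j ∈ maximalIdeal R * 𝔞 := by
    have h4 := (List.forall₂_iff_get.mp h1).2 j (by simpa using hj) (by omega)
    simpa [z, hzlen, hj] using h4
  rw [← hz] at h2 h3
  rw [← initIdeal_eq_ofList] at h3
  have hex (j : ℕ) : ∃ e : Fin n → R, j < d → (∀ k, e k ∈ 𝔞) ∧ ∑ k, e k * x k = z j - y j := by
    by_cases hj : j < d
    · have h4 := hsub j hj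
      rw [mul_comm, ← smul_eq_mul, ← hx, Submodule.mem_ideal_smul_span_iff_exists_sum] at h4
      obtain ⟨a, ha, ha'⟩ := h4
      refine ⟨a, fun _ => ⟨ha, ?_⟩⟩
      rw [← ha', Finsupp.sum_fintype _ _ (by simp)]
      rfl
    · exact ⟨0, fun h => absurd h hj⟩
  choose e he using hex
  obtain ⟨r, b, hb⟩ := Submodule.fg_iff_exists_fin_generating_family.mp
    (IsNoetherian.noetherian ((initIdeal z d).colon (𝔞 : Set R)))
  have h5 : wedges (fun j => v j + e j) d ∈ bdry x 𝔞 := by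
    refine wedges_mem_bdry i hx hR (fun j hj => h𝔞 (h3.le (mem_initIdeal z hj))) h2
      (fun j hj => ?_) (b := b) (fun a => ⟨fun ha l => ?_, fun ha => ?_⟩) fun hle => ?_
    · simp only [Pi.add_apply, add_mul, Finset.sum_add_distrib, hv j hj, (he j hj).2]
      ring
    · have h6 : b l ∈ (initIdeal z d).colon (𝔞 : Set R) := hb ▸ Submodule.subset_span ⟨l, rfl⟩
      rw [mul_comm]
      exact Submodule.mem_colon.mp h6 a ha
    · refine h3.mem_of_forall a fun u hu => ?_
      have h6 : Submodule.span R (Set.range b) ≤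
          Submodule.comap (LinearMap.mulLeft R a) (initIdeal z d) := by
        refine Submodule.span_le.mpr ?_
        rintro _ ⟨l, rfl⟩
        exact ha l
      exact h6 (hb ▸ Submodule.mem_colon.mpr hu)
    · refine hnot ⟨fun j => z j, (le_antisymm h3.le hle).symm ▸ ?_⟩
      rw [initIdeal]
      congr 1
      ext w
      constructor
      · rintro ⟨j, rfl⟩; exact ⟨j, j.2, rfl⟩
      · rintro ⟨j, hj, rfl⟩; exact ⟨⟨j, hj⟩, rfl⟩
  have h6 := wedges_sub_wedges_mem_coef (𝔞 := 𝔞) (v := v) (v' := fun j => v j + e j) (d := d)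
    fun j hj k => by
      simp only [Pi.add_apply, sub_add_cancel_left, neg_mem_iff]
      exact (he j hj).1 k
  rw [← sub_add_cancel (wedges v d) (wedges (fun j => v j + e j) d)]
  exact add_mem (coef_le_bdry h6) h5

end KProd

namespace KProd

section
variable {A M P : Type v} [CommRing A] [AddCommGroup M] [Module A M] [AddCommGroup P] [Module A P]

lemma zeroth_del_mem_smul {I : Ideal A} : ∀ {n : ℕ} (x : Fin n → A) (_ : ∀ k, x k ∈ I)
    (c : KProd n M), zeroth (A := A) n (del x c) ∈ I • (⊤ : Submodule A M)
  | 0, _, _, _ => zero_mem (I • (⊤ : Submodule A M))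
  | n + 1, x, hx, (a, b) => by
    change zeroth (A := A) n (del (Fin.tail x) a + x 0 • b) ∈ _
    rw [map_add, map_smul]
    exact add_mem (zeroth_del_mem_smul (Fin.tail x) (fun k => hx k.succ) a)
      (Submodule.smul_mem_smul (hx 0) trivial)

lemma zeroth_map (f : M →ₗ[A] P) : ∀ {n : ℕ} (c : KProd n M),
    zeroth (A := A) n (map f.toAddMonoidHom n c) = f (zeroth (A := A) n c)
  | 0, _ => rfl
  | n + 1, (a, _) => zeroth_map f (n := n) a

lemma exists_map_eq_of_mem_coef (f : M →ₗ[A] P) : ∀ {n : ℕ} {c : KProd n P}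
    (_ : c ∈ coef (LinearMap.range f) n), ∃ c' : KProd n M, map f.toAddMonoidHom n c' = c
  | 0, _, hc => hc
  | _ + 1, (_, _), hc => by
    obtain ⟨a', ha⟩ := exists_map_eq_of_mem_coef f hc.1
    obtain ⟨b', hb⟩ := exists_map_eq_of_mem_coef f hc.2
    exact ⟨(a', b'), ext_succ ha hb⟩

lemma mem_coef_ker (f : M →ₗ[A] P) {n : ℕ} {c : KProd n M} (h : map f.toAddMonoidHom n c = 0) :
    c ∈ coef (LinearMap.ker f) n :=
  mem_coef_of_map_mem (N' := (⊥ : Submodule A P)) f.toAddMonoidHom (fun _ hm => hm)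
    (h ▸ zero_mem _)

lemma map_linear_del (f : M →ₗ[A] P) {n : ℕ} (x : Fin n → A) (c : KProd n M) :
    map f.toAddMonoidHom n (del x c) = del x (map f.toAddMonoidHom n c) :=
  map_del _ (fun _ _ => f.map_smul _ _) c

end

/-- Propagation of a decomposition of a total cycle along an acyclic complex. -/
theorem exists_eq_del_add_map {A : Type v} [CommRing A] {n : ℕ} (x : Fin n → A)
    (F : ℕ → Type v) [∀ i, AddCommGroup (F i)] [∀ i, Module A (F i)]
    (D : ∀ i, F (i + 1) →ₗ[A] F i)
    (hD : ∀ i, LinearMap.ker (D i) = LinearMap.range (D (i + 1))) (τ : ∀ i, KProd n (F i))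
    (hτ : ∀ i, del x (τ i) = map (D i).toAddMonoidHom n (τ (i + 1)))
    (h₀ : ∃ σ σ', τ 0 = del x σ + map (D 0).toAddMonoidHom n σ') (i : ℕ) :
    ∃ σ σ', τ i = del x σ + map (D i).toAddMonoidHom n σ' := by
  induction i with
  | zero => exact h₀
  | succ i ih =>
    obtain ⟨σ, σ', h⟩ := ih
    have h1 : map (D i).toAddMonoidHom n (τ (i + 1) - del x σ') = 0 := by
      rw [map_sub, ← hτ, h, map_add, del_del, zero_add, map_linear_del, sub_self]
    have h2 := mem_coef_ker (D i) h1
    rw [hD] at h2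
    obtain ⟨σ₁, h3⟩ := exists_map_eq_of_mem_coef _ h2
    exact ⟨σ', σ₁, by rw [h3, add_sub_cancel]⟩

section Total

variable {A : Type v} {M P : Type v} [CommRing A] [AddCommGroup M] [Module A M] [AddCommGroup P]
  [Module A P] {n : ℕ} {ι : Type*} [LinearOrder ι] (a : ι → Fin n → A)

/-- The element `∑ ± a_{T ∖ U} ⊗ p U`, summed over `U ⊆ T`. -/
noncomputable def total : List ι → (Finset ι → M) → KProd n M
  | [], p => incl (A := A) n (p ∅)
  | t :: T, p => wedge (a t) (total T fun U => (-1 : A) ^ U.card • p U) +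
      total T fun U => p (insert t U)

lemma total_sub : ∀ (T : List ι) (p q : Finset ι → M),
    total a T (fun U => p U - q U) = total a T p - total a T q
  | [], p, q => map_sub _ _ _
  | t :: T, p, q => by
    rw [total, total, total]
    simp only [smul_sub]
    rw [total_sub T, total_sub T, map_sub]
    abel

lemma total_smul (r : A) : ∀ (T : List ι) (p : Finset ι → M),
    total a T (fun U => r • p U) = r • total a T p
  | [], p => map_smul _ _ _
  | t :: T, p => by
    rw [total, total]
    simp only [smul_comm _ r]
    rw [total_smul r T, total_smul r T, map_smul, smul_add]

lemma map_total (f : M →ₗ[A] P) : ∀ (T : List ι) (p : Finset ι → M),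
    map f.toAddMonoidHom n (total a T p) = total a T fun U => f (p U)
  | [], p => map_incl _ _
  | t :: T, p => by
    rw [total, total, map_add, map_wedge (x' := a t) _ (fun _ _ => f.map_smul _ _), map_total f T,
      map_total f T]
    congr 3
    funext U
    exact f.map_smul _ _

lemma del_total (x : Fin n → A) {y : ι → A} (ha : ∀ t, ∑ k, a t k * x k = y t) :
    ∀ {T : List ι} (_ : T.Pairwise (· > ·)) {p q : Finset ι → M}
      (_ : ∀ U ⊆ T.toFinset, q U =
        ∑ j ∈ U, ((-1 : A) ^ (U.filter (· < j)).card * y j) • p (U.erase j)),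
      del x (total a T p) = total a T q
  | [], _, p, q, h => by
    rw [total, total, del_incl, h ∅ (by simp), Finset.sum_empty, map_zero]
  | t :: T, hT, p, q, h => by
    rw [List.pairwise_cons] at hT
    have hlt {U : Finset ι} (hU : U ⊆ T.toFinset) {j : ι} (hj : j ∈ U) : j < t :=
      hT.1 j (List.mem_toFinset.mp (hU hj))
    have htU {U : Finset ι} (hU : U ⊆ T.toFinset) : t ∉ U := fun ht => lt_irrefl _ (hlt hU ht)
    have h1 := del_total x ha hT.2 (p := fun U => (-1 : A) ^ U.card • p U)
      (q := fun U => (-1 : A) • ((-1 : A) ^ U.card • q U)) fun U hU => by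
        rw [h U (hU.trans (by simp)), Finset.smul_sum, Finset.smul_sum]
        refine Finset.sum_congr rfl fun j hj => ?_
        have : U.card = (U.erase j).card + 1 := (Finset.card_erase_add_one hj).symm
        rw [this, smul_smul, smul_smul, smul_smul]
        congr 1
        ring
    have h2 := del_total x ha hT.2 (p := fun U => p (insert t U))
      (q := fun U => q (insert t U) - y t • ((-1 : A) ^ U.card • p U)) fun U hU => by
        have ht := htU hU
        rw [h (insert t U) (by simpa using Finset.insert_subset_insert t hU),
          Finset.sum_insert ht, Finset.erase_insert ht]
        have h3 : (insert t U).filter (· < t) = U := by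
          ext j
          simp only [Finset.mem_filter, Finset.mem_insert]
          constructor
          · rintro ⟨rfl | h, h'⟩
            · exact absurd h' (lt_irrefl _)
            · exact h
          · exact fun h => ⟨Or.inr h, hlt hU h⟩
        rw [h3, smul_smul, mul_comm, add_sub_cancel_left]
        refine Finset.sum_congr rfl fun j hj => ?_
        have h4 : (insert t U).filter (· < j) = U.filter (· < j) := by
          rw [Finset.filter_insert, if_neg (not_lt.mpr (hlt hU hj).le)]
        rw [h4, Finset.erase_insert_of_ne (hlt hU hj).ne']
    rw [total, total, map_add, del_wedge, ha, h1, h2, total_sub, total_smul, total_smul, map_smul]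
    module

lemma total_eq_zero : ∀ {T : List ι} {p : Finset ι → M}
    (_ : ∀ U : Finset ι, U.card ≤ T.length → p U = 0), total a T p = 0
  | [], p, h => by rw [total, h ∅ (by simp), map_zero]
  | t :: T, p, h => by
    rw [total, total_eq_zero, total_eq_zero, map_zero, add_zero]
    · exact fun U hU => h _ ((Finset.card_insert_le _ _).trans (Nat.succ_le_succ hU))
    · exact fun U hU => by rw [h U (hU.trans (Nat.le_succ _)), smul_zero]

lemma total_eq_incl : ∀ {T : List ι} {p : Finset ι → M}
    (_ : ∀ U : Finset ι, U.card < T.length → p U = 0),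
    total a T p = incl (A := A) n (p T.toFinset)
  | [], p, _ => rfl
  | t :: T, p, h => by
    rw [total, total_eq_zero, total_eq_incl, map_zero, zero_add, List.toFinset_cons]
    · exact fun U hU => h _ ((Finset.card_insert_le _ _).trans_lt (Nat.succ_lt_succ hU))
    · exact fun U hU => by rw [h U (Nat.lt_succ_of_le hU), smul_zero]

lemma exists_total_eq : ∀ (T : List ι), ∃ v : ℕ → Fin n → A,
    (∀ j < T.length, ∃ t, v j = a t) ∧ ∀ p : Finset ι → M, (∀ U, U ≠ ∅ → p U = 0) →
      total a T p = map (LinearMap.toSpanSingleton A M (p ∅)).toAddMonoidHom n (wedges v T.length)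
  | [] => ⟨0, by simp, fun p _ => by
      rw [total, List.length_nil, wedges, map_incl (B := A)]
      congr 1
      exact (one_smul A _).symm⟩
  | t :: T => by
    obtain ⟨v, hv, h⟩ := exists_total_eq T
    refine ⟨Function.update v T.length (a t), fun j hj => ?_, fun p hp => ?_⟩
    · rcases Nat.lt_succ_iff_lt_or_eq.mp hj with hj | rfl
      · rw [Function.update_of_ne hj.ne]; exact hv j hj
      · exact ⟨t, Function.update_self ..⟩
    · rw [total, h, total_eq_zero, add_zero, List.length_cons, wedges, Function.update_self,
        map_wedge (x' := a t) _ (fun _ _ => map_smul (LinearMap.toSpanSingleton A M (p ∅)) _ _),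
        wedges_congr (v := Function.update v T.length (a t)) (v' := v)
          (fun j hj => Function.update_of_ne hj.ne _ _), Finset.card_empty, pow_zero, one_smul]
      · exact fun U _ => hp _ (Finset.insert_ne_empty _ _)
      · exact fun U hU => by rw [hp U hU, smul_zero]

end Total

end KProd

section

variable {A : Type u} [CommRing A]

lemma koszulD_single {s : ℕ} (y : Fin s → A) (i : ℕ) (U : KIdx s (i + 1)) :
    koszulD A y i (Finsupp.single U 1) = ∑ j ∈ U.1.attach,
      ((-1 : A) ^ (U.1.filter (fun i => i < j.1)).card * y j.1) •
        Finsupp.single ⟨U.1.erase j.1, by simp [Finset.card_erase_of_mem j.2, U.2]⟩ (1 : A) := by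
  simp [koszulD]

namespace KoszulLift

variable {s : ℕ} {y : Fin s → A} {𝔞 : Ideal A} {P : ProjRes A (A ⧸ 𝔞)} (L : KoszulLift A y 𝔞 P)

/-- The value of a lift on the basis vector of `U`, extended by zero to all finite sets. -/
noncomputable def onBasis (i : ℕ) (U : Finset (Fin s)) : P.F i :=
  if h : U.card = i then L.ψ i (Finsupp.single ⟨U, h⟩ 1) else 0

lemma d_onBasis (i : ℕ) (U : Finset (Fin s)) :
    P.d i (L.onBasis (i + 1) U) =
      ∑ j ∈ U, ((-1 : A) ^ (U.filter (· < j)).card * y j) • L.onBasis i (U.erase j) := by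
  by_cases h : U.card = i + 1
  · rw [onBasis, dif_pos h]
    have := LinearMap.congr_fun (L.comm i) (Finsupp.single ⟨U, h⟩ 1)
    rw [LinearMap.comp_apply, LinearMap.comp_apply, koszulD_single, map_sum] at this
    rw [← this, ← Finset.sum_attach U]
    refine Finset.sum_congr rfl fun j _ => ?_
    rw [map_smul, onBasis, dif_pos (by simp [Finset.card_erase_of_mem j.2, h])]
  · rw [onBasis, dif_neg h, map_zero]
    refine (Finset.sum_eq_zero fun j hj => ?_).symm
    rw [onBasis, dif_neg, smul_zero]
    rintro rfl
    exact h (Finset.card_erase_add_one hj).symm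

theorem ψ_mem [IsLocalRing A] [IsNoetherianRing A] {K : Type u} [Field K]
    (i : K →+* A) {n : ℕ} {x : Fin n → A}
    (hx : Ideal.span (Set.range x) = maximalIdeal A) (hA : ringKrullDim A = n)
    (h𝔞 : 𝔞 ≤ maximalIdeal A) {d : ℕ} {xs : List A} (hlen : xs.length = d)
    (hxs : RingTheory.Sequence.IsWeaklyRegular A xs) (hlink : Ideal.IsLinked (Ideal.ofList xs) 𝔞)
    (hnot : ¬ ∃ z : Fin d → A, Ideal.span (Set.range z) = 𝔞) (hy : ∀ j, y j ∈ 𝔞)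
    (v : KMod A s d) :
    L.ψ d v ∈ LinearMap.range (P.d d) ⊔ maximalIdeal A • (⊤ : Submodule A (P.F d)) := by
  induction v using Finsupp.induction_linear with
  | zero => rw [map_zero]; exact zero_mem _
  | add v w hv hw => rw [map_add]; exact add_mem hv hw
  | single T r =>
  rw [← mul_one r, ← smul_eq_mul, ← Finsupp.smul_single, map_smul]
  refine Submodule.smul_mem _ _ ?_
  have hyx (t : Fin s) : ∃ a : Fin n → A, ∑ k, a k * x k = y t := by
    have := h𝔞 (hy t)
    rw [← hx] at this
    exact Ideal.mem_span_range_iff_exists_fun.mp this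
  choose a ha using hyx
  set Tl : List (Fin s) := T.1.sort (· ≥ ·) with hTl
  have hTlen : Tl.length = d := by rw [hTl, Finset.length_sort, T.2]
  have hTset : Tl.toFinset = T.1 := Finset.sort_toFinset _ _
  have hTpair : Tl.Pairwise (· > ·) := (Finset.sortedGT_sort _).pairwise
  obtain ⟨v, hva, hv⟩ := KProd.exists_total_eq (M := P.F 0) a Tl
  rw [hTlen] at hva hv
  have hw : KProd.wedges v d ∈ KProd.bdry x 𝔞 := by
    refine KProd.wedges_mem_bdry_colon i hx hA h𝔞 hlen hxs hlink hnot
      (y := fun j => ∑ k, v j k * x k) (fun j hj => ?_) fun _ _ => rfl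
    obtain ⟨t, ht⟩ := hva j hj
    simp only [ht, ha, hy]
  obtain ⟨b, hb⟩ := KProd.mem_bdry.mp hw
  obtain ⟨σ, σ', h⟩ := KProd.exists_eq_del_add_map x (fun i => P.F i) P.d P.exact
    (fun i => KProd.total a Tl (L.onBasis i)) (fun i => by
      rw [KProd.map_total, KProd.del_total a x ha hTpair fun U _ => L.d_onBasis i U]) (by
      set f := LinearMap.toSpanSingleton A (P.F 0) (L.onBasis 0 ∅)
      have he : KProd.map f.toAddMonoidHom n (KProd.wedges v d - KProd.del x b) ∈
          KProd.coef (LinearMap.range (P.d 0)) n := by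
        rw [← P.exact0]
        refine KProd.map_mem_coef _ (fun r hr => ?_) hb
        have : P.ε (L.onBasis 0 ∅) = Ideal.Quotient.mk 𝔞 1 := by
          rw [onBasis, dif_pos Finset.card_empty, L.aug, Finsupp.single_eq_same]
        change P.ε (r • L.onBasis 0 ∅) = 0
        rw [map_smul, this]
        exact Ideal.Quotient.eq_zero_iff_mem.mpr (by simpa using hr)
      obtain ⟨σ', hσ'⟩ := KProd.exists_map_eq_of_mem_coef _ he
      refine ⟨KProd.map f.toAddMonoidHom n b, σ', ?_⟩
      rw [hσ', map_sub, KProd.map_linear_del, add_sub_cancel, hv]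
      exact fun U hU => dif_neg (Finset.card_ne_zero.mpr (Finset.nonempty_iff_ne_empty.mpr hU))) d
  have h' := congr_arg (KProd.zeroth (A := A) n) h
  rw [KProd.total_eq_incl _ (fun U hU => dif_neg (hTlen ▸ hU).ne), KProd.zeroth_incl, hTset, onBasis,
    dif_pos T.2, map_add, KProd.zeroth_map] at h'
  rw [h']
  exact add_mem (Submodule.mem_sup_right
    (KProd.zeroth_del_mem_smul x (fun k => hx ▸ Ideal.subset_span ⟨k, rfl⟩) σ))
    (Submodule.mem_sup_left ⟨_, rfl⟩)

end KoszulLift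

end

/-- Let `(R,m,k)` be a regular local ring containing a field
and let `I` be an ideal of height `d` such that `R/I` satisfies Serre's
condition `S_2`.  Let `x₁,…,x_d ∈ I` be an `R`-regular sequence and set
`Ω̃ = ((x₁,…,x_d) :_R I)`; assume `Ω̃` is not generated by `d` elements.  Then
for any minimal set of generators `y₁,…,y_s` of `Ω̃`, the natural map
`K_d(y;R) ⊗_R k → Tor_d^R(R/Ω̃, k)` is the zero map. -/
theorem statement3
    (R : Type u) [CommRing R] [IsLocalRing R] (hreg : IsRegularLocal R)
    (hfield : ∃ K : Subring R, IsField K)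
    (I : Ideal R) (d : ℕ) (hht : HeightEq R I d)
    (hS2 : SerreS (R ⧸ I) 2)
    (x : Fin d → R) (hxI : ∀ j, x j ∈ I)
    (hxreg : RingTheory.Sequence.IsRegular R (List.ofFn x))
    (hnot : ¬ ∃ z : Fin d → R,
      Ideal.span (Set.range z) = (Ideal.span (Set.range x)).colon I)
    {s : ℕ} (y : Fin s → R)
    (hmin : MinimalGenerators R y ((Ideal.span (Set.range x)).colon I)) :
    KoszulTorMapZero R y ((Ideal.span (Set.range x)).colon I) d := by
  obtain ⟨_, n, x', hx', hn⟩ := hreg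
  obtain ⟨K, hK⟩ := hfield
  let := hK.toField
  set 𝔞 := (Ideal.span (Set.range x)).colon (I : Set R) with h𝔞
  intro P L v
  by_cases htop : 𝔞 = ⊤
  · obtain rfl : d = 0 := by
      by_contra hd
      have : Nonempty (Fin d) := ⟨⟨0, Nat.pos_of_ne_zero hd⟩⟩
      exact hnot ⟨fun _ => 1, by simp [htop]⟩
    have : Subsingleton (R ⧸ 𝔞) := Ideal.Quotient.subsingleton_iff.mpr htop
    refine Submodule.mem_sup_left ?_
    rw [← P.exact0]
    exact Subsingleton.elim _ _
  refine L.ψ_mem K.subtype hx' hn (IsLocalRing.le_maximalIdeal htop) (xs := List.ofFn x)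
    (List.length_ofFn ..) hxreg.toIsWeaklyRegular ?_ hnot (fun j => ?_) v
  · have h : Ideal.ofList (List.ofFn x) = Ideal.span (Set.range x) := by
      rw [Ideal.ofList]
      congr 1
      ext
      simp
    rw [h]
    exact KProd.isLinked_colon
  · exact hmin.1 ▸ Ideal.subset_span ⟨j, rfl⟩
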